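/- Let K be a triangulated 2-disk in ℝ² (affine simplices) and f : ∂K → ℝ² a simplexwise-linear embedding with convex image such that no spanning edge of K is f-obstructive. Then f extends to a simplexwise-linear embedding of K into ℝ². -/

import Mathlib

/-! Basic notions for triangulated 2-disks with straight simplices in the plane. -/

/-- Vertex set of an ordered triangle. -/
def vset {ι : Type} [DecidableEq ι] (t : ι × ι × ι) : Finset ι := {t.1, t.2.1, t.2.2}

/-- The geometric (closed, filled) triangle spanned by an ordered triple of vertices. -/
def triSet {ι : Type} (pos : ι → ℝ × ℝ) (t : ι × ι × ι) : Set (ℝ × ℝ) :=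
  convexHull ℝ {pos t.1, pos t.2.1, pos t.2.2}

/-- A triangulated 2-disk with straight (affine) simplices in the plane: finitely many
nondegenerate affine triangles, any two of which intersect exactly in the convex hull of
their common vertices, whose union is homeomorphic to the closed 2-disk. -/
structure TriDisk (ι : Type) [Fintype ι] [DecidableEq ι] where
  pos : ι → ℝ × ℝ
  inj : Function.Injective pos
  tris : Finset (ι × ι × ι)
  nonempty : tris.Nonempty
  indep : ∀ t ∈ tris, AffineIndependent ℝ ![pos t.1, pos t.2.1, pos t.2.2]
  glue : ∀ s ∈ tris, ∀ t ∈ tris,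
    triSet pos s ∩ triSet pos t = convexHull ℝ (pos '' ((vset s ∩ vset t : Finset ι) : Set ι))
  disk : Nonempty ((⋃ t ∈ tris, triSet pos t) ≃ₜ
      (Metric.closedBall (0 : EuclideanSpace ℝ (Fin 2)) 1))

namespace TriDisk

variable {ι : Type} [Fintype ι] [DecidableEq ι]

/-- The underlying space of the triangulated disk. -/
def space (D : TriDisk ι) : Set (ℝ × ℝ) := ⋃ t ∈ D.tris, triSet D.pos t

/-- `a b` span an edge (1-simplex) of the triangulation. -/
def IsEdge (D : TriDisk ι) (a b : ι) : Prop :=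
  a ≠ b ∧ ∃ t ∈ D.tris, a ∈ vset t ∧ b ∈ vset t

/-- A spanning edge: both endpoints on the boundary circle, open edge in the interior. -/
def IsSpanningEdge (D : TriDisk ι) (a b : ι) : Prop :=
  D.IsEdge a b ∧ D.pos a ∈ frontier D.space ∧ D.pos b ∈ frontier D.space ∧
    openSegment ℝ (D.pos a) (D.pos b) ⊆ interior D.space

/-- `K` is simple if it has no spanning edge. -/
def Simple (D : TriDisk ι) : Prop := ∀ a b : ι, ¬ D.IsSpanningEdge a b

/-- Transverse to the verticals: every intersection with a vertical line is connected. -/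
def TrV (D : TriDisk ι) : Prop :=
  ∀ c : ℝ, IsPreconnected (D.space ∩ {p : ℝ × ℝ | p.1 = c})

/-- A boundary edge of the triangulation. -/
def IsBoundaryEdge (D : TriDisk ι) (a b : ι) : Prop :=
  D.IsEdge a b ∧ segment ℝ (D.pos a) (D.pos b) ⊆ frontier D.space

/-- A roof edge: a boundary edge no ascending vertical ray from which meets the interior. -/
def IsRoofEdge (D : TriDisk ι) (a b : ι) : Prop :=
  D.IsBoundaryEdge a b ∧
    ∀ p ∈ segment ℝ (D.pos a) (D.pos b), ∀ s : ℝ, 0 ≤ s →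
      (p.1, p.2 + s) ∉ interior D.space

/-- The roof of a TrV disk, as a subset of the boundary. -/
def roof (D : TriDisk ι) : Set (ℝ × ℝ) :=
  ⋃ (a : ι) (b : ι) (_ : D.IsRoofEdge a b), segment ℝ (D.pos a) (D.pos b)

/-- `F` is simplexwise linear on the boundary of `D`. -/
def SLOnBoundary (D : TriDisk ι) (F : ℝ × ℝ → ℝ × ℝ) : Prop :=
  ∀ a b : ι, D.IsBoundaryEdge a b →
    ∃ g : (ℝ × ℝ) →ᵃ[ℝ] (ℝ × ℝ), Set.EqOn F g (segment ℝ (D.pos a) (D.pos b))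

/-- `F` is simplexwise linear on the whole disk `D`. -/
def SLOn (D : TriDisk ι) (F : ℝ × ℝ → ℝ × ℝ) : Prop :=
  ∀ t ∈ D.tris, ∃ g : (ℝ × ℝ) →ᵃ[ℝ] (ℝ × ℝ), Set.EqOn F g (triSet D.pos t)

/-- `F` is vertical on `S`: it preserves first coordinates there. -/
def VerticalOn (F : ℝ × ℝ → ℝ × ℝ) (S : Set (ℝ × ℝ)) : Prop :=
  ∀ p ∈ S, (F p).1 = p.1

/-- The image of the boundary under `F` is a convex polygon, i.e. it is the boundary
of a compact convex set with nonempty interior. -/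
def ConvexImage (D : TriDisk ι) (F : ℝ × ℝ → ℝ × ℝ) : Prop :=
  ∃ C : Set (ℝ × ℝ), Convex ℝ C ∧ IsCompact C ∧ (interior C).Nonempty ∧
    F '' frontier D.space = frontier C

/-- A spanning edge `{a,b}` is `F`-obstructive: `F` maps (the closure of) one of the two
arcs of the boundary circle determined by its endpoints into a straight line. -/
def Obstructive (D : TriDisk ι) (F : ℝ × ℝ → ℝ × ℝ) (a b : ι) : Prop :=
  D.IsSpanningEdge a b ∧ ∃ x ∈ frontier D.space \ {D.pos a, D.pos b},
    Collinear ℝ (F '' closure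
      (connectedComponentIn (frontier D.space \ {D.pos a, D.pos b}) x))

end TriDisk

set_option linter.unusedSectionVars false

namespace TD
open Finset

section comb
variable {ι : Type} [Fintype ι] [DecidableEq ι]

/-- adjacency in the 1-skeleton -/
def Adj (F : Finset (Finset ι)) (a b : ι) : Prop := a ≠ b ∧ ∃ t ∈ F, a ∈ t ∧ b ∈ t

/-- number of triangles containing a pair -/
def ec (F : Finset (Finset ι)) (a b : ι) : ℕ := (F.filter (fun t => a ∈ t ∧ b ∈ t)).card

/-- combinatorial boundary edge -/
def BdE (F : Finset (Finset ι)) (a b : ι) : Prop := a ≠ b ∧ ec F a b = 1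

/-- combinatorial interior edge -/
def IntE (F : Finset (Finset ι)) (a b : ι) : Prop := a ≠ b ∧ ec F a b = 2

/-- vertices of triangles -/
def Used (F : Finset (Finset ι)) (v : ι) : Prop := ∃ t ∈ F, v ∈ t

/-- combinatorial boundary vertex -/
def Bd (F : Finset (Finset ι)) (v : ι) : Prop := ∃ b, BdE F v b

open Classical in
/-- the set of ordered adjacent pairs -/
noncomputable def apairs (F : Finset (Finset ι)) : Finset (ι × ι) :=
  univ.filter (fun p => Adj F p.1 p.2)

open Classical in
/-- the set of used vertices -/
noncomputable def verts (F : Finset (Finset ι)) : Finset ι := univ.filter (fun v => Used F v)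

/-- combinatorial disk -/
structure Disk (F : Finset (Finset ι)) : Prop where
  card3 : ∀ t ∈ F, t.card = 3
  ec_le : ∀ a b, a ≠ b → ec F a b ≤ 2
  link : ∀ (v : ι) (X : Set ι), (∃ x ∈ X, Adj F v x) →
    (∀ x y, x ∈ X → ({v, x, y} : Finset ι) ∈ F → y ∈ X) → ∀ y, Adj F v y → y ∈ X
  conn : ∀ X : Set ι, (∃ x ∈ X, Used F x) → (∀ x y, x ∈ X → Adj F x y → y ∈ X) →
    ∀ y, Used F y → y ∈ X
  euler : (apairs F).card + 2 ≤ 2 * ((verts F).card + F.card)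
  bd_ex : ∃ v, Bd F v

variable {F : Finset (Finset ι)}

lemma Adj.symm {a b : ι} (h : Adj F a b) : Adj F b a := by
  obtain ⟨h1, t, ht, ha, hb⟩ := h
  exact ⟨h1.symm, t, ht, hb, ha⟩

lemma ec_comm (a b : ι) : ec F a b = ec F b a := by
  unfold ec; congr 1; ext t; simp [and_comm]

lemma BdE.symm {a b : ι} (h : BdE F a b) : BdE F b a := ⟨h.1.symm, by rw [ec_comm]; exact h.2⟩
lemma IntE.symm {a b : ι} (h : IntE F a b) : IntE F b a := ⟨h.1.symm, by rw [ec_comm]; exact h.2⟩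

lemma ec_pos {a b : ι} (h : Adj F a b) : 1 ≤ ec F a b := by
  obtain ⟨h1, t, ht, ha, hb⟩ := h
  exact Finset.card_pos.2 ⟨t, by simp [ht, ha, hb]⟩

lemma adj_of_ec {a b : ι} (h : a ≠ b) (h1 : 1 ≤ ec F a b) : Adj F a b := by
  obtain ⟨t, ht⟩ := Finset.card_pos.1 h1
  simp at ht
  exact ⟨h, t, ht.1, ht.2.1, ht.2.2⟩

lemma BdE.adj {a b : ι} (h : BdE F a b) : Adj F a b := adj_of_ec h.1 (by rw [h.2])
lemma IntE.adj {a b : ι} (h : IntE F a b) : Adj F a b := adj_of_ec h.1 (by rw [h.2]; norm_num)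

lemma Adj.bd_or_int (hF : Disk F) {a b : ι} (h : Adj F a b) : BdE F a b ∨ IntE F a b := by
  have h1 := ec_pos h
  have h2 := hF.ec_le a b h.1
  have : ec F a b = 1 ∨ ec F a b = 2 := by omega
  rcases this with h3 | h3
  · exact Or.inl ⟨h.1, h3⟩
  · exact Or.inr ⟨h.1, h3⟩

lemma Adj.used {a b : ι} (h : Adj F a b) : Used F a := by
  obtain ⟨h1, t, ht, ha, hb⟩ := h; exact ⟨t, ht, ha⟩

lemma tri_ne (hF : Disk F) {a b c : ι} (h : ({a, b, c} : Finset ι) ∈ F) : a ≠ b ∧ a ≠ c ∧ b ≠ c := by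
  have := hF.card3 _ h
  refine ⟨?_, ?_, ?_⟩
  · rintro rfl
    have h3 := Finset.card_le_two (a := a) (b := c)
    simp at this; omega
  · rintro rfl
    have h3 := Finset.card_le_two (a := b) (b := a)
    have e : ({a, b, a} : Finset ι) = {b, a} := by ext x; simp
    rw [e] at this; omega
  · rintro rfl
    have h3 := Finset.card_le_two (a := a) (b := b)
    simp at this; omega

lemma tri_swap {a b c : ι} : ({a, b, c} : Finset ι) = {a, c, b} := by
  ext x; simp; tauto
lemma tri_rot {a b c : ι} : ({a, b, c} : Finset ι) = {b, a, c} := by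
  ext x; simp; tauto

lemma tri_adj (hF : Disk F) {a b c : ι} (h : ({a, b, c} : Finset ι) ∈ F) : Adj F a b :=
  ⟨(tri_ne hF h).1, _, h, by simp, by simp⟩
lemma tri_adj' (hF : Disk F) {a b c : ι} (h : ({a, b, c} : Finset ι) ∈ F) : Adj F a c :=
  ⟨(tri_ne hF h).2.1, _, h, by simp, by simp⟩

lemma third (hF : Disk F) {t : Finset ι} (ht : t ∈ F) {a b : ι} (hab : a ≠ b) (ha : a ∈ t) (hb : b ∈ t) :
    ∃ c, t = {a, b, c} := by
  have h3 := hF.card3 t ht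
  have h2 : ((t.erase a).erase b).card = 1 := by
    rw [card_erase_of_mem (by simp [hb, hab.symm]), card_erase_of_mem ha, h3]
  obtain ⟨c, hc⟩ := card_eq_one.1 h2
  refine ⟨c, ?_⟩
  ext x
  have := Finset.ext_iff.1 hc x
  simp at this ⊢
  constructor
  · intro hx
    by_cases h1 : x = a
    · tauto
    by_cases h2 : x = b
    · tauto
    right; right; exact this.1 ⟨h2, h1, hx⟩
  · rintro (rfl | rfl | rfl)
    · exact ha
    · exact hb
    · exact (this.2 rfl).2.2

lemma Adj.third (hF : Disk F) {a b : ι} (h : Adj F a b) : ∃ c, ({a, b, c} : Finset ι) ∈ F := by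
  obtain ⟨h1, t, ht, ha, hb⟩ := h
  obtain ⟨c, rfl⟩ := TD.third hF ht h1 ha hb
  exact ⟨c, ht⟩

lemma ec_eq_link (hF : Disk F) {z x : ι} (h : z ≠ x) :
    (univ.filter (fun y => ({z, x, y} : Finset ι) ∈ F)).card = ec F z x := by
  unfold ec
  refine Finset.card_bij (fun y _ => {z, x, y}) ?_ ?_ ?_
  · intro y hy; simp at hy ⊢; exact hy
  · intro y hy y' hy' hh
    simp at hy hy'
    have h1 := tri_ne hF hy
    have : y ∈ ({z, x, y'} : Finset ι) := by rw [← hh]; simp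
    simp at this
    rcases this with h2 | h2 | h2
    · exact absurd h2.symm h1.2.1
    · exact absurd h2.symm h1.2.2
    · exact h2
  · intro t ht
    simp at ht
    obtain ⟨c, rfl⟩ := third hF ht.1 h ht.2.1 ht.2.2
    exact ⟨c, by simpa using ht.1, rfl⟩

/-- the two triangles at an interior edge -/
lemma IntE.two (hF : Disk F) {a b : ι} (h : IntE F a b) :
    ∃ c d, c ≠ d ∧ ({a, b, c} : Finset ι) ∈ F ∧ ({a, b, d} : Finset ι) ∈ F ∧
      ∀ e, ({a, b, e} : Finset ι) ∈ F → e = c ∨ e = d := by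
  have := ec_eq_link hF h.1
  rw [h.2] at this
  obtain ⟨c, d, hcd, h2⟩ := card_eq_two.1 this
  have h3 := fun x => Finset.ext_iff.1 h2 x
  simp at h3
  exact ⟨c, d, hcd, (h3 c).2 (by simp), (h3 d).2 (by simp), fun e he => (h3 e).1 he⟩

lemma BdE.one (hF : Disk F) {a b c d : ι} (h : BdE F a b) (hc : ({a, b, c} : Finset ι) ∈ F)
    (hd : ({a, b, d} : Finset ι) ∈ F) : c = d := by
  have := ec_eq_link hF h.1
  rw [h.2] at this
  exact Finset.card_le_one.1 this.le c (by simpa using hc) d (by simpa using hd)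

lemma IntE.of_two (hF : Disk F) {a b c d : ι} (hc : ({a, b, c} : Finset ι) ∈ F)
    (hd : ({a, b, d} : Finset ι) ∈ F) (h : c ≠ d) : IntE F a b := by
  rcases (tri_adj hF hc).bd_or_int hF with h1 | h1
  · exact absurd (h1.one hF hc hd) h
  · exact h1

lemma int_of_not_bd (hF : Disk F) {v x : ι} (hv : ¬ Bd F v) (h : Adj F v x) : IntE F v x := by
  rcases h.bd_or_int hF with h1 | h1
  · exact absurd ⟨x, h1⟩ hv
  · exact h1

/-- parity of a cut -/
lemma parity (L : ι → ι → Prop) [DecidableRel L] (hs : ∀ x y, L x y → L y x) (hi : ∀ x, ¬ L x x)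
    (X : Finset ι) :
    ((∑ x ∈ X, (univ.filter (fun y => L x y)).card : ℕ) : ZMod 2) =
      ((univ.filter (fun p : ι × ι => p.1 ∈ X ∧ p.2 ∉ X ∧ L p.1 p.2)).card : ZMod 2) := by
  have h1 : ∑ x ∈ X, (univ.filter (fun y => L x y)).card =
      (univ.filter (fun p : ι × ι => p.1 ∈ X ∧ L p.1 p.2)).card := by
    rw [← Finset.card_sigma]
    refine Finset.card_bij (fun p _ => (p.1, p.2)) ?_ ?_ ?_
    · rintro ⟨a, b⟩; simp
    · rintro ⟨a, b⟩ _ ⟨c, d⟩ _; simp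
    · rintro ⟨a, b⟩ h; simp at h; exact ⟨⟨a, b⟩, by simpa using h, rfl⟩
  have h2 : (univ.filter (fun p : ι × ι => p.1 ∈ X ∧ L p.1 p.2)).card =
      (univ.filter (fun p : ι × ι => p.1 ∈ X ∧ p.2 ∈ X ∧ L p.1 p.2)).card + 
      (univ.filter (fun p : ι × ι => p.1 ∈ X ∧ p.2 ∉ X ∧ L p.1 p.2)).card := by
    rw [← Finset.card_union_of_disjoint]
    · congr 1; ext p; simp; tauto
    · rw [Finset.disjoint_left]; intro p; simp; tauto
  have h3 : (((univ.filter (fun p : ι × ι => p.1 ∈ X ∧ p.2 ∈ X ∧ L p.1 p.2)).card : ℕ) : ZMod 2) = 0 := by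
    rw [Finset.card_eq_sum_ones]
    push_cast
    refine Finset.sum_involution (fun p _ => (p.2, p.1)) ?_ ?_ ?_ ?_
    · intros; decide
    · rintro ⟨a, b⟩ h _; simp at h ⊢; rintro rfl; exact absurd h.2.2 (hi _)
    · rintro ⟨a, b⟩ h; simp at h ⊢; exact ⟨h.2.1, h.1, hs _ _ h.2.2⟩
    · rintro ⟨a, b⟩ h; rfl
  rw [h1, h2]; push_cast; rw [h3]; simp

/-- two boundary edges at every boundary vertex -/
lemma bd_two (hF : Disk F) {v : ι} (hv : Bd F v) : 2 ≤ (univ.filter (fun b => v ≠ b ∧ ec F v b = 1)).card := by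
  classical
  have h0 := parity (fun x y => ({v, x, y} : Finset ι) ∈ F) (fun x y h => by rwa [tri_swap])
    (fun x h => (tri_ne hF h).2.2 rfl) (univ.filter (fun x => Adj F v x))
  have h1 : (univ.filter (fun p : ι × ι => p.1 ∈ (univ.filter (fun x => Adj F v x)) ∧
      p.2 ∉ (univ.filter (fun x => Adj F v x)) ∧ ({v, p.1, p.2} : Finset ι) ∈ F)) = ∅ := by
    ext ⟨a, b⟩; simp
    intro _ h2 h3
    exact h2 (tri_adj' hF h3)
  rw [h1] at h0
  have h2 : ∑ x ∈ (univ.filter (fun x => Adj F v x)), (univ.filter (fun y => ({v, x, y} : Finset ι) ∈ F)).card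
      = ∑ x ∈ (univ.filter (fun x => Adj F v x)), ec F v x :=
    sum_congr rfl (fun x hx => ec_eq_link hF (by simp at hx; exact hx.1))
  have h3 : ((∑ x ∈ (univ.filter (fun x => Adj F v x)), ec F v x : ℕ) : ZMod 2) =
      ((univ.filter (fun b => v ≠ b ∧ ec F v b = 1)).card : ZMod 2) := by
    push_cast
    rw [Finset.card_eq_sum_ones]
    push_cast
    rw [← Finset.sum_filter_add_sum_filter_not (univ.filter (fun x => Adj F v x)) (fun x => ec F v x = 1)]
    have e1 : ∑ x ∈ (univ.filter (fun x => Adj F v x)) with ¬ ec F v x = 1, (ec F v x : ZMod 2) = 0 := by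
      refine sum_eq_zero (fun x hx => ?_)
      simp at hx
      rcases hx.1.bd_or_int hF with h | h
      · exact absurd h.2 hx.2
      · rw [h.2]; rfl
    rw [e1, add_zero]
    refine Finset.sum_congr_of_eq_on_inter ?_ ?_ ?_
    · intro x hx hx'
      simp at hx hx'
      exact absurd hx.2 (hx' hx.1.1)
    · intro x hx hx'
      simp at hx hx'
      exact absurd hx.2 (hx' (adj_of_ec hx.1 hx.2.ge))
    · intro x hx hx'
      simp at hx
      rw [hx.2]; simp
  rw [h2, h3] at h0
  obtain ⟨b, hb⟩ := hv
  have h4 : 1 ≤ (univ.filter (fun b => v ≠ b ∧ ec F v b = 1)).card :=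
    Finset.card_pos.2 ⟨b, by simp; exact hb⟩
  simp only [card_empty, Nat.cast_zero] at h0
  have h5 := (ZMod.natCast_eq_zero_iff _ 2).1 h0
  exact Nat.le_of_dvd h4 h5

lemma bd_two' (hF : Disk F) {v : ι} (hv : Bd F v) : ∃ b c, b ≠ c ∧ BdE F v b ∧ BdE F v c := by
  obtain ⟨b, hb, c, hc, h⟩ := Finset.one_lt_card.1 (bd_two hF hv)
  simp at hb hc
  exact ⟨b, c, h, hb, hc⟩

end comb
end TD

namespace TD
open Finset
section index
variable {ι : Type} [Fintype ι] [DecidableEq ι] {F : Finset (Finset ι)}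
variable {α : Type} [LinearOrder α]

/-- sign changes around a vertex -/
def scs (F : Finset (Finset ι)) (r : ι → α) (z : ι) : Finset (ι × ι) :=
  univ.filter (fun p : ι × ι => ({z, p.1, p.2} : Finset ι) ∈ F ∧ r p.1 < r z ∧ r z < r p.2)

lemma mem_scs {r : ι → α} {z : ι} {p : ι × ι} :
    p ∈ scs F r z ↔ ({z, p.1, p.2} : Finset ι) ∈ F ∧ r p.1 < r z ∧ r z < r p.2 := by
  simp [scs]

lemma sum_sc (hF : Disk F) (r : ι → α) (hr : ∀ a b, Adj F a b → r a ≠ r b) :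
    ∑ z, (scs F r z).card = F.card := by
  rw [← Finset.card_sigma]
  refine Finset.card_bij (fun p _ => {p.1, p.2.1, p.2.2}) ?_ ?_ ?_
  · rintro ⟨z, x, y⟩ h; simp [mem_scs] at h ⊢; exact h.1
  · rintro ⟨z, x, y⟩ h ⟨z', x', y'⟩ h' he
    simp [mem_scs] at h h' he ⊢
    obtain ⟨-, h1, h2⟩ := h
    obtain ⟨-, h3, h4⟩ := h'
    have m1 : z' ∈ ({z, x, y} : Finset ι) := by rw [he]; simp
    have m2 : x' ∈ ({z, x, y} : Finset ι) := by rw [he]; simp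
    have m3 : y' ∈ ({z, x, y} : Finset ι) := by rw [he]; simp
    simp only [mem_insert, mem_singleton] at m1 m2 m3
    clear he
    rcases m1 with e1 | e1 | e1 <;> rcases m2 with e2 | e2 | e2 <;> rcases m3 with e3 | e3 | e3 <;>
      rw [e1, e2] at h3 <;> rw [e1, e3] at h4 <;>
      first
      | exact ⟨e1.symm, e2.symm, e3.symm⟩
      | (exfalso; order)
  · intro t ht
    obtain ⟨a, b, c, hab, hac, hbc, rfl⟩ := card_eq_three.1 (hF.card3 t ht)
    have n1 : r a ≠ r b := hr a b ⟨hab, _, ht, by simp, by simp⟩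
    have n2 : r a ≠ r c := hr a c ⟨hac, _, ht, by simp, by simp⟩
    have n3 : r b ≠ r c := hr b c ⟨hbc, _, ht, by simp, by simp⟩
    have key : ∀ x z y, r x < r z → r z < r y → ({a, b, c} : Finset ι) = {z, x, y} →
        ∃ p, ∃ (_ : p ∈ (univ : Finset ι).sigma (fun z => scs F r z)), 
          ({p.1, p.2.1, p.2.2} : Finset ι) = {a, b, c} := by
      intro x z y h1 h2 h3
      refine ⟨⟨z, x, y⟩, ?_, h3.symm⟩
      simp [mem_scs, h1, h2, ← h3, ht]
    rcases lt_or_gt_of_ne n1 with h1 | h1 <;> rcases lt_or_gt_of_ne n2 with h2 | h2 <;>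
      rcases lt_or_gt_of_ne n3 with h3 | h3
    · exact key a b c h1 h3 (by ext x; simp; tauto)
    · exact key a c b h2 h3 (by ext x; simp; tauto)
    · exfalso; order
    · exact key c a b h2 h1 (by ext x; simp; tauto)
    · exact key b a c h1 h2 (by ext x; simp)
    · exfalso; order
    · exact key b c a h3 h2 (by ext x; simp; tauto)
    · exact key c b a h3 h1 (by ext x; simp; tauto)

/-- has a lower and a higher neighbour -/
def LH (F : Finset (Finset ι)) (r : ι → α) (z : ι) : Prop :=
  (∃ x, Adj F z x ∧ r x < r z) ∧ ∃ y, Adj F z y ∧ r z < r y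

lemma sc_one (hF : Disk F) (r : ι → α) (hr : ∀ a b, Adj F a b → r a ≠ r b) {z : ι} (h : LH F r z) :
    1 ≤ (scs F r z).card := by
  by_contra hc
  have hc : scs F r z = ∅ := by rw [← Finset.card_eq_zero]; omega
  obtain ⟨⟨x, hx, hxz⟩, y, hy, hyz⟩ := h
  have := hF.link z {x | r x < r z} ⟨x, hxz, hx⟩ (fun a b ha hab => by
    by_contra hb
    have h1 : r z < r b := lt_of_le_of_ne (not_lt.1 hb) (hr _ _ (tri_adj' hF hab))
    have : (a, b) ∈ scs F r z := mem_scs.2 ⟨hab, ha, h1⟩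
    rw [hc] at this; simp at this) y hy
  exact absurd hyz (not_lt.2 (le_of_lt this))

lemma sc_even (hF : Disk F) (r : ι → α) (hr : ∀ a b, Adj F a b → r a ≠ r b) {z : ι} (hz : ¬ Bd F z) :
    2 ∣ (scs F r z).card := by
  classical
  have h0 := parity (fun x y => ({z, x, y} : Finset ι) ∈ F) (fun x y h => by rwa [tri_swap])
    (fun x h => (tri_ne hF h).2.2 rfl) (univ.filter (fun x => Adj F z x ∧ r x < r z))
  have h1 : (univ.filter (fun p : ι × ι => p.1 ∈ (univ.filter (fun x => Adj F z x ∧ r x < r z)) ∧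
      p.2 ∉ (univ.filter (fun x => Adj F z x ∧ r x < r z)) ∧ ({z, p.1, p.2} : Finset ι) ∈ F)) = scs F r z := by
    ext ⟨a, b⟩; simp [mem_scs]
    constructor
    · rintro ⟨⟨h1, h2⟩, h3, h4⟩
      have := tri_adj' hF h4
      exact ⟨h4, h2, lt_of_le_of_ne (h3 this) (hr _ _ this)⟩
    · rintro ⟨h1, h2, h3⟩
      exact ⟨⟨tri_adj hF h1, h2⟩, fun _ => h3.le, h1⟩
  rw [h1] at h0
  have h2 : ∑ x ∈ (univ.filter (fun x => Adj F z x ∧ r x < r z)), (univ.filter (fun y => ({z, x, y} : Finset ι) ∈ F)).card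
      = ∑ x ∈ (univ.filter (fun x => Adj F z x ∧ r x < r z)), 2 := 
    sum_congr rfl (fun x hx => by
      simp at hx
      rw [ec_eq_link hF hx.1.1, (int_of_not_bd hF hz hx.1).2])
  rw [h2] at h0
  rw [← ZMod.natCast_eq_zero_iff, ← h0, ZMod.natCast_eq_zero_iff]
  simp

open Classical in
/-- expected count -/
noncomputable def up (F : Finset (Finset ι)) (v : ι) : ℕ :=
  if Used F v then (if Bd F v then 1 else 2) else 0

lemma Bd.used {v : ι} (h : Bd F v) : Used F v := by
  obtain ⟨b, hb⟩ := h; exact hb.adj.used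

lemma count (hF : Disk F) : F.card + 2 ≤ ∑ v, up F v := by
  classical
  have e1 : ∑ v, up F v + (univ.filter (fun v => Bd F v)).card = 2 * (verts F).card := by
    rw [verts, Finset.card_filter, Finset.card_filter, ← sum_add_distrib, mul_sum]
    refine sum_congr rfl (fun v _ => ?_)
    unfold up
    by_cases h1 : Used F v
    · by_cases h2 : Bd F v <;> simp [h1, h2]
    · have h2 : ¬ Bd F v := fun h => h1 h.used
      simp [h1, h2]
  have e2 : ∑ p ∈ apairs F, ec F p.1 p.2 = 6 * F.card := by
    have := Finset.sum_card_bipartiteAbove_eq_sum_card_bipartiteBelow (s := apairs F) (t := F)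
      (fun p t => p.1 ∈ t ∧ p.2 ∈ t)
    have e : ∑ p ∈ apairs F, ec F p.1 p.2 = ∑ a ∈ apairs F, (bipartiteAbove (fun p t => p.1 ∈ t ∧ p.2 ∈ t) F a).card := rfl
    rw [e, this]
    rw [sum_const_nat (m := 6), mul_comm]
    intro t ht
    have : bipartiteBelow (fun p t => p.1 ∈ t ∧ p.2 ∈ t) (apairs F) t = t.offDiag := by
      ext ⟨a, b⟩
      simp [bipartiteBelow, apairs]
      constructor
      · rintro ⟨h1, h2, h3⟩; exact ⟨h2, h3, h1.1⟩
      · rintro ⟨h1, h2, h3⟩; exact ⟨⟨h3, t, ht, h1, h2⟩, h1, h2⟩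
    rw [this, offDiag_card, hF.card3 t ht]
  have e3 : ∑ p ∈ apairs F, ec F p.1 p.2 + ((apairs F).filter (fun p => ec F p.1 p.2 = 1)).card = 2 * (apairs F).card := by
    rw [card_filter, ← sum_add_distrib, sum_const_nat (m := 2), mul_comm]
    rintro ⟨a, b⟩ h
    simp [apairs] at h
    rcases h.bd_or_int hF with h | h <;> simp [h.2]
  have e4 : 2 * (univ.filter (fun v => Bd F v)).card ≤ ((apairs F).filter (fun p => ec F p.1 p.2 = 1)).card := by
    have : ∑ v ∈ univ.filter (fun v => Bd F v), 2 ≤ 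
        ∑ v ∈ univ.filter (fun v => Bd F v), (univ.filter (fun b => v ≠ b ∧ ec F v b = 1)).card :=
      sum_le_sum (fun v hv => bd_two hF (by simpa using hv))
    rw [← Finset.card_sigma] at this
    simp only [sum_const, smul_eq_mul] at this
    rw [mul_comm]
    refine this.trans ?_
    refine card_le_card_of_injOn (fun p => (p.1, p.2)) ?_ ?_
    · rintro ⟨a, b⟩ h
      simp [apairs] at h ⊢
      exact ⟨adj_of_ec h.2.1 h.2.2.ge, h.2.2⟩
    · rintro ⟨a, b⟩ _ ⟨c, d⟩ _; simp
  have := hF.euler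
  omega

lemma index (hF : Disk F) (r : ι → α) (hr : ∀ a b, Adj F a b → r a ≠ r b)
    (hintr : ∀ v, Used F v → ¬ Bd F v → LH F r v) (Ex : Finset ι) (hEx : Ex.card ≤ 2)
    (hbd : ∀ v, Bd F v → v ∉ Ex → LH F r v) (v : ι) (hv : v ∉ Ex) : (scs F r v).card ≤ up F v := by
  classical
  set lo : ι → ℕ := fun v => if v ∈ Ex then up F v - 1 else up F v with hlo
  have h1 : ∀ v ∈ (univ : Finset ι), lo v ≤ (scs F r v).card := by
    intro v _
    simp only [hlo]
    have h4 : Used F v → ¬ Bd F v → 2 ≤ (scs F r v).card := fun h2 h3 => by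
      have a := sc_one hF r hr (hintr v h2 h3)
      exact Nat.le_of_dvd a (sc_even hF r hr h3)
    have h5 : Bd F v → v ∉ Ex → 1 ≤ (scs F r v).card := fun h2 h3 => sc_one hF r hr (hbd v h2 h3)
    unfold up
    split_ifs <;> first | omega | (have := h4 (by assumption) (by assumption); omega) | exact h5 (by assumption) (by assumption)
  have h2 : ∑ v, up F v ≤ ∑ v, lo v + 2 := by
    have : ∑ v, up F v ≤ ∑ v, (lo v + if v ∈ Ex then 1 else 0) := by
      refine sum_le_sum (fun v _ => ?_)
      simp only [hlo]; split_ifs <;> omega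
    rw [sum_add_distrib] at this
    simp at this
    omega
  have h3 := sum_sc hF r hr
  have h4 := count hF
  have h5 := (Finset.sum_eq_sum_iff_of_le h1).1 (le_antisymm (sum_le_sum h1) (by omega)) v (mem_univ _)
  rw [← h5]; simp [hlo, hv]
end index
end TD

namespace TD
open Finset
section ear
variable {ι : Type} [Fintype ι] [DecidableEq ι] {F : Finset (Finset ι)}

lemma Disk.conn2 (hF : Disk F) (x : ι) (X : Set ι) (h1 : ∃ a ∈ X, a ≠ x ∧ Used F a)
    (h2 : ∀ a b, a ∈ X → a ≠ x → b ≠ x → Adj F a b → b ∈ X) : ∀ b, Used F b → b ≠ x → b ∈ X := by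
  obtain ⟨a, ha, hax, hua⟩ := h1
  intro b hb hbx
  by_cases h3 : ∃ y ∈ X, Adj F x y
  · obtain ⟨y, hy, hxy⟩ := h3
    have h4 : ∀ w, Adj F x w → w ∈ X := hF.link x X ⟨y, hy, hxy⟩ (fun p q hp hpq => by
      have := tri_ne hF hpq
      exact h2 p q hp this.1.symm this.2.1.symm ⟨this.2.2, _, hpq, by simp, by simp⟩)
    have := hF.conn (X ∪ {x}) ⟨a, Or.inl ha, hua⟩ (by
      rintro p q (hp | hp) hpq
      · by_cases hq : q = x
        · exact Or.inr hq
        by_cases hp' : p = x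
        · subst hp'; exact Or.inl (h4 q hpq)
        · exact Or.inl (h2 p q hp hp' hq hpq)
      · rw [Set.mem_singleton_iff] at hp; subst hp
        exact Or.inl (h4 q hpq)) b hb
    rcases this with h | h
    · exact h
    · exact absurd h hbx
  · push Not at h3
    have := hF.conn (X \ {x}) ⟨a, ⟨ha, hax⟩, hua⟩ (by
      rintro p q ⟨hp, hp'⟩ hpq
      have hq : q ≠ x := by
        rintro rfl
        exact h3 p hp hpq.symm
      exact ⟨h2 p q hp hp' hq hpq, hq⟩) b hb
    exact this.1

/-- the lexicographic rank -/
def lx (h g : ι → ℝ) (v : ι) : ℝ ×ₗ ℝ := toLex (h v, g v)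

lemma lx_lt {h g : ι → ℝ} {a b : ι} : lx h g a < lx h g b ↔ h a < h b ∨ (h a = h b ∧ g a < g b) := by
  unfold lx; rw [Prod.Lex.toLex_lt_toLex]

lemma lx_inj {h g : ι → ℝ} {a b : ι} : lx h g a = lx h g b ↔ h a = h b ∧ g a = g b := by
  unfold lx; simp

/-- existence of an ear path -/
lemma ear_path (hF : Disk F) (S : Finset ι) (hS : ∃ a ∈ S, ∃ b ∈ S, a ≠ b ∧ Used F a ∧ Used F b)
    (u : ι) (hu : u ∉ S) (hU : ∀ u ∉ S, Used F u) :
    ∃ (n : ℕ) (x : ℕ → ι), 2 ≤ n ∧ x 0 ∈ S ∧ x n ∈ S ∧ (∀ i, 0 < i → i < n → x i ∉ S) ∧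
      (∀ i j, i ≤ n → j ≤ n → x i = x j → i = j) ∧ ∀ i < n, Adj F (x i) (x (i+1)) := by
  classical
  set X : Set ι := {x | Relation.ReflTransGen (fun a b => a ∉ S ∧ Adj F a b) u x} with hX
  have hcl : ∀ p q, p ∈ X → p ∉ S → Adj F p q → q ∈ X := fun p q hp hpS hpq => 
    Relation.ReflTransGen.tail hp ⟨hpS, hpq⟩
  have huX : u ∈ X := Relation.ReflTransGen.refl
  have key : ∀ s ∈ S, ∃ b ∈ S, b ∈ X ∧ b ≠ s := by
    intro s hs
    by_contra hcon
    push Not at hcon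
    have h2 := hF.conn2 s X ⟨u, huX, fun h => hu (h ▸ hs), hU u hu⟩ (fun a b ha has _ hab => 
      hcl a b ha (fun haS => has (hcon a haS ha)) hab)
    obtain ⟨a, ha, b, hb, hab, hua, hub⟩ := hS
    by_cases h3 : a = s
    · subst h3
      exact hab (hcon b hb (h2 b hub (Ne.symm hab))).symm
    · exact h3 (hcon a ha (h2 a hua h3))
  obtain ⟨s, hs, -⟩ := id hS
  obtain ⟨a, ha, haX, -⟩ := key s hs
  obtain ⟨b, hb, hbX, hba⟩ := key a ha
  let H : SimpleGraph ι := SimpleGraph.fromRel (fun p q => Adj F p q ∧ p ∉ S ∧ (q ∉ S ∨ q = a ∨ q = b))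
  have hreach : ∀ y, y ∈ X → (y ∉ S ∨ y = a ∨ y = b) → H.Reachable u y := by
    intro y hy
    induction hy with
    | refl => intro _; exact SimpleGraph.Reachable.refl _
    | tail _ h2 ih =>
      intro h3
      refine (ih (Or.inl h2.1)).trans (SimpleGraph.Adj.reachable ?_)
      rw [SimpleGraph.fromRel_adj]
      exact ⟨h2.2.1, Or.inl ⟨h2.2, h2.1, h3⟩⟩
  have hab : H.Reachable a b := (hreach a haX (by simp)).symm.trans (hreach b hbX (by simp))
  obtain ⟨p, hp⟩ := hab.exists_isPath
  have hHF : ∀ x y, H.Adj x y → Adj F x y := by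
    intro x y h
    rw [SimpleGraph.fromRel_adj] at h
    rcases h.2 with h | h
    · exact h.1
    · exact h.1.symm
  have hinj : ∀ i j, i ≤ p.length → j ≤ p.length → p.getVert i = p.getVert j → i = j := 
    fun i j hi hj h => hp.getVert_injOn hi hj h
  have hmid : ∀ i, 0 < i → i < p.length → p.getVert i ∉ S := by
    intro i h0 h1 hi
    have h2 := p.adj_getVert_succ h1
    rw [SimpleGraph.fromRel_adj] at h2
    have h3 : p.getVert i = a ∨ p.getVert i = b := by
      rcases h2.2 with h | h
      · exact absurd hi h.2.1
      · exact h.2.2.resolve_left (not_not.2 hi)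
    rcases h3 with h3 | h3
    · have := hinj i 0 h1.le (Nat.zero_le _) (by rw [h3, p.getVert_zero]); omega
    · have := hinj i p.length h1.le le_rfl (by rw [h3, p.getVert_length]); omega
  refine ⟨p.length, p.getVert, ?_, by simpa using ha, by simpa using hb, hmid, hinj,
    fun i hi => hHF _ _ (p.adj_getVert_succ hi)⟩
  by_contra hlt
  have : p.length = 0 ∨ p.length = 1 := by omega
  rcases this with h | h
  · exact hba (SimpleGraph.Walk.eq_of_length_eq_zero h).symm
  · have h2 := p.adj_getVert_succ (i := 0) (by omega)
    have e : p.getVert (0+1) = b := by rw [zero_add, ← h, p.getVert_length]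
    rw [e, p.getVert_zero, SimpleGraph.fromRel_adj] at h2
    rcases h2.2 with h | h
    · exact h.2.1 ha
    · exact h.2.1 hb

lemma ear (hF : Disk F) (h : ι → ℝ) : ∀ (m : ℕ) (S : Finset ι) (g : ι → ℝ), (Sᶜ).card ≤ m →
    (∃ a ∈ S, ∃ b ∈ S, a ≠ b ∧ Used F a ∧ Used F b) →
    (∀ a ∈ S, ∀ b ∈ S, h a = h b → g a = g b → a = b) →
    (∀ u ∉ S, Used F u) → (∀ u ∉ S, ∀ w, Adj F u w → h w = h u) →
    ∃ g' : ι → ℝ, (∀ a ∈ S, g' a = g a) ∧ (∀ a b, h a = h b → g' a = g' b → a = b) ∧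
      ∀ u ∉ S, LH F (lx h g') u := by
  intro m
  induction m with
  | zero =>
    intro S g hm _ hi _ _
    have hS : ∀ a, a ∈ S := by
      intro a; by_contra ha
      have : a ∈ Sᶜ := by simpa using ha
      have := card_pos.2 ⟨a, this⟩
      omega
    exact ⟨g, fun _ _ => rfl, fun a b => hi a (hS a) b (hS b), fun u hu => absurd (hS u) hu⟩
  | succ m ih =>
    intro S g hm h2 hi hU hfl
    by_cases hS : ∃ u, u ∉ S
    swap
    · push Not at hS
      exact ⟨g, fun _ _ => rfl, fun a b => hi a (hS a) b (hS b), fun u hu => absurd (hS u) hu⟩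
    obtain ⟨u, hu⟩ := hS
    have hpath : ∃ (n : ℕ) (x : ℕ → ι), 2 ≤ n ∧ x 0 ∈ S ∧ x n ∈ S ∧ (∀ i, 0 < i → i < n → x i ∉ S) ∧
      (∀ i j, i ≤ n → j ≤ n → x i = x j → i = j) ∧ (∀ i < n, Adj F (x i) (x (i+1))) ∧
      (∀ i ≤ n, h (x i) = h (x 0)) ∧ g (x 0) < g (x n) := by
      obtain ⟨n, x, hn, h0, hnS, hmid, hinj, hadj⟩ := ear_path hF S h2 u hu hU
      have hh : ∀ i ≤ n, h (x i) = h (x 0) := by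
        intro i
        induction i with
        | zero => intro _; rfl
        | succ i ih2 =>
          intro hi2
          rw [← ih2 (by omega)]
          by_cases hi0 : i = 0
          · subst hi0
            exact (hfl (x (0+1)) (hmid _ (by omega) (by omega)) _ (hadj 0 (by omega)).symm).symm
          · exact hfl (x i) (hmid i (by omega) (by omega)) _ (hadj i (by omega))
      have hne : g (x 0) ≠ g (x n) := by
        intro he
        have := hinj 0 n (by omega) le_rfl (hi _ h0 _ hnS (hh n le_rfl).symm he)
        omega
      rcases lt_or_gt_of_ne hne with hl | hl
      · exact ⟨n, x, hn, h0, hnS, hmid, hinj, hadj, hh, hl⟩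
      · refine ⟨n, fun i => x (n - i), hn, by simpa using hnS, by simpa using h0, ?_, ?_, ?_, ?_, by simpa using hl⟩
        · intro i h1 h2; exact hmid _ (by omega) (by omega)
        · intro i j h1 h2 h3
          have := hinj _ _ (by omega) (by omega) h3; omega
        · intro i h1
          have := (hadj (n - (i+1)) (by omega)).symm
          rwa [show n - (i+1) + 1 = n - i by omega] at this
        · intro i h1
          show h (x (n-i)) = h (x (n-0))
          exact (hh _ (by omega)).trans (hh _ (by omega)).symm
    obtain ⟨n, x, hn, h0, hnS, hmid, hinj, hadj, hh, hl⟩ := hpath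
    -- free interval
    obtain ⟨d, hd0, hd1⟩ : ∃ d > 0, ∀ s ∈ S, g (x 0) < g s → g (x 0) + d ≤ g s := by
      have hne : (S.filter (fun s => g (x 0) < g s)).Nonempty := ⟨x n, by simp [hnS, hl]⟩
      obtain ⟨s, hs, hmin⟩ := Finset.exists_min_image _ (fun s => g s) hne
      simp at hs hmin
      exact ⟨g s - g (x 0), by linarith [hs.2], fun t ht h => by have := hmin t ht h; linarith⟩
    classical
    let g1 : ι → ℝ := fun v => if hv : ∃ i, 0 < i ∧ i < n ∧ x i = v then g (x 0) + d * (hv.choose / n) else g v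
    have hn0 : (0:ℝ) < n := by exact_mod_cast (by omega : 0 < n)
    have g1x : ∀ i, 0 < i → i < n → g1 (x i) = g (x 0) + d * (i / n) := by
      intro i hi0 hin
      have hv : ∃ j, 0 < j ∧ j < n ∧ x j = x i := ⟨i, hi0, hin, rfl⟩
      have : hv.choose = i := hinj _ _ hv.choose_spec.2.1.le hin.le hv.choose_spec.2.2
      simp only [g1]
      rw [dif_pos hv, this]
    have g1S : ∀ v ∈ S, g1 v = g v := by
      intro v hv
      simp only [g1]
      rw [dif_neg]
      rintro ⟨i, a, b, rfl⟩
      exact hmid i a b hv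
    have fr : ∀ i, 0 < i → i < n → 0 < d * ((i:ℝ) / n) ∧ d * ((i:ℝ) / n) < d := by
      intro i hi0 hin
      have a1 : (0:ℝ) < i := by exact_mod_cast hi0
      have a2 : (i:ℝ) < n := by exact_mod_cast hin
      have a3 : (i:ℝ)/n < 1 := by rw [div_lt_one hn0]; exact a2
      exact ⟨by positivity, by nlinarith⟩
    have mono : ∀ i < n, g1 (x i) < g1 (x (i+1)) := by
      intro i hin
      rcases Nat.eq_zero_or_pos i with rfl | hi0
      · rw [g1S _ h0, g1x (0+1) (by omega) (by omega)]
        linarith [(fr (0+1) (by omega) (by omega)).1]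
      · rw [g1x i hi0 hin]
        by_cases hi1 : i + 1 = n
        · rw [hi1, g1S _ hnS]
          linarith [(fr i hi0 hin).2, hd1 _ hnS hl]
        · rw [g1x (i+1) (by omega) (by omega)]
          push_cast
          have : (i:ℝ)/n < (i+1)/n := by gcongr; linarith
          nlinarith
    let S' : Finset ι := S ∪ (Finset.range (n+1)).image x
    have hxS' : ∀ i ≤ n, x i ∈ S' := fun i hi => by
      simp only [S', mem_union, mem_image, mem_range]; exact Or.inr ⟨i, by omega, rfl⟩
    have hSS' : ∀ v ∈ S, v ∈ S' := fun v hv => by simp [S', hv]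
    have hS'c : ∀ v ∈ S', v ∈ S ∨ ∃ i, 0 < i ∧ i < n ∧ x i = v := by
      intro v hv
      simp only [S', mem_union, mem_image, mem_range] at hv
      rcases hv with hv | ⟨i, hi, rfl⟩
      · exact Or.inl hv
      · rcases Nat.eq_zero_or_pos i with rfl | hi0
        · exact Or.inl h0
        · by_cases hin : i = n
          · subst hin; exact Or.inl hnS
          · exact Or.inr ⟨i, hi0, by omega, rfl⟩
    have hsep : ∀ v ∈ S, ∀ i, 0 < i → i < n → g1 v ≠ g1 (x i) := by
      intro v hv i hi0 hin
      rw [g1S v hv, g1x i hi0 hin]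
      have := fr i hi0 hin
      rcases lt_or_ge (g (x 0)) (g v) with h1 | h1
      · have := hd1 v hv h1; intro he; linarith
      · intro he; linarith
    obtain ⟨g', e1, e2, e3⟩ := ih S' g1 (by
        have : S'ᶜ ⊂ Sᶜ := by
          rw [Finset.ssubset_iff_of_subset (by intro v; simp only [mem_compl]; exact fun h1 h2 => h1 (hSS' v h2))]
          exact ⟨x 1, by simpa using hmid 1 (by omega) (by omega), by simpa using hxS' 1 (by omega)⟩
        have := card_lt_card this
        omega) 
      (by obtain ⟨a, ha, b, hb, h3⟩ := h2
          exact ⟨a, hSS' a ha, b, hSS' b hb, h3⟩)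
      (by
        intro a ha b hb hab gab
        rcases hS'c a ha with ha | ⟨i, i0, i1, rfl⟩ <;> rcases hS'c b hb with hb | ⟨j, j0, j1, rfl⟩
        · rw [g1S a ha, g1S b hb] at gab; exact hi a ha b hb hab gab
        · exact absurd gab (hsep a ha j j0 j1)
        · exact absurd gab.symm (hsep b hb i i0 i1)
        · rw [g1x i i0 i1, g1x j j0 j1] at gab
          have : (i:ℝ) / n = j / n := by
            have := add_left_cancel gab
            exact mul_left_cancel₀ hd0.ne' this
          field_simp at this
          have : i = j := by exact_mod_cast this
          rw [this])
      (fun u hu => hU u (fun h => hu (hSS' u h)))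
      (fun u hu => hfl u (fun h => hu (hSS' u h)))
    refine ⟨g', fun a ha => by rw [e1 a (hSS' a ha), g1S a ha], e2, ?_⟩
    intro v hv
    by_cases hvS : v ∈ S'
    · rcases hS'c v hvS with h3 | ⟨i, i0, i1, rfl⟩
      · exact absurd h3 hv
      · constructor
        · refine ⟨x (i-1), ?_, ?_⟩
          · have := (hadj (i-1) (by omega)).symm
            rwa [show i - 1 + 1 = i by omega] at this
          · rw [lx_lt]; right
            refine ⟨(hh _ (by omega)).trans (hh _ (by omega)).symm, ?_⟩
            rw [e1 _ (hxS' _ (by omega)), e1 _ (hxS' _ (by omega))]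
            have := mono (i-1) (by omega)
            rwa [show i - 1 + 1 = i by omega] at this
        · refine ⟨x (i+1), hadj i i1, ?_⟩
          rw [lx_lt]; right
          refine ⟨(hh _ (by omega)).trans (hh _ (by omega)).symm, ?_⟩
          rw [e1 _ (hxS' _ (by omega)), e1 _ (hxS' _ (by omega))]
          exact mono i i1
    · exact e3 v hvS
end ear
end TD

namespace TD
open Finset
section main
variable {ι : Type} [Fintype ι] [DecidableEq ι] {F : Finset (Finset ι)}

/-- hypotheses on a level function -/
structure Lev (F : Finset (Finset ι)) (h h1 : ι → ℝ) (c : ℝ) : Prop where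
  hintr : ∀ v, Used F v → ¬ Bd F v → (∀ w, Adj F v w → h w = h v) ∨
    ((∃ w, Adj F v w ∧ h w < h v) ∧ ∃ w, Adj F v w ∧ h v < h w)
  inj : ∀ a b, Bd F a → Bd F b → h a = h b → h1 a = h1 b → a = b
  bmax : ∀ v a b, BdE F v a → BdE F v b → a ≠ b → lx h h1 a < lx h h1 v → lx h h1 b < lx h h1 v →
    ∀ w, Bd F w → lx h h1 w ≤ lx h h1 v
  bmin : ∀ v a b, BdE F v a → BdE F v b → a ≠ b → lx h h1 v < lx h h1 a → lx h h1 v < lx h h1 b →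
    ∀ w, Bd F w → lx h h1 v ≤ lx h h1 w
  lo : ∃ w, Bd F w ∧ h w < c
  hi : ∃ w, Bd F w ∧ c < h w
  nb : ∀ a b, BdE F a b → h a = c → h b ≠ c

lemma lx_neg {h h1 : ι → ℝ} {a b : ι} :
    lx (fun v => - h v) (fun v => - h1 v) a < lx (fun v => - h v) (fun v => - h1 v) b ↔
      lx h h1 b < lx h h1 a := by
  rw [lx_lt, lx_lt]; simp [eq_comm]

lemma Lev.neg {h h1 : ι → ℝ} {c : ℝ} (H : Lev F h h1 c) : Lev F (fun v => - h v) (fun v => - h1 v) (-c) where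
  hintr v hv hb := by
    rcases H.hintr v hv hb with h2 | ⟨⟨a, ha⟩, ⟨b, hb⟩⟩
    · left; intro w hw; rw [h2 w hw]
    · right; exact ⟨⟨b, hb.1, by linarith [hb.2]⟩, a, ha.1, by linarith [ha.2]⟩
  inj a b ha hb e1 e2 := H.inj a b ha hb (by linarith) (by linarith)
  bmax v a b h2 h3 hab h4 h5 w hw := by
    rw [lx_neg] at h4 h5
    rw [← not_lt, lx_neg, not_lt]
    exact H.bmin v a b h2 h3 hab h4 h5 w hw
  bmin v a b h2 h3 hab h4 h5 w hw := by
    rw [lx_neg] at h4 h5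
    rw [← not_lt, lx_neg, not_lt]
    exact H.bmax v a b h2 h3 hab h4 h5 w hw
  lo := by obtain ⟨w, h1, h2⟩ := H.hi; exact ⟨w, h1, by linarith⟩
  hi := by obtain ⟨w, h1, h2⟩ := H.lo; exact ⟨w, h1, by linarith⟩
  nb a b h1 h2 := fun h3 => H.nb a b h1 (by linarith) (by linarith)

lemma Lev.idx (hF : Disk F) {h h1 : ι → ℝ} {c : ℝ} (H : Lev F h h1 c) {z : ι} (hzc : h z = c)
    (hz : ∃ w, Adj F z w ∧ h w ≠ c) (Neg : Set ι) :
    ∃ r : ι → ℝ ×ₗ ℝ, (∀ a b, Adj F a b → r a ≠ r b) ∧ (∀ w, h w < c → r w < r z) ∧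
      (∀ w, c < h w → r z < r w) ∧
      (∀ w, w ≠ z → h w = c → (∃ x, Adj F w x ∧ h x ≠ c) → w ∈ Neg → r w < r z) ∧
      (∀ w, w ≠ z → h w = c → (∃ x, Adj F w x ∧ h x ≠ c) → w ∉ Neg → r z < r w) ∧
      (scs F r z).card ≤ up F z := by
  classical
  obtain ⟨n, hn⟩ : ∃ n : ι → ℕ, Function.Injective n := 
    ⟨fun v => (Fintype.equivFin ι v : ℕ), fun a b hab => (Fintype.equivFin ι).injective (Fin.ext hab)⟩
  have hnR : ∀ a b, (n a : ℝ) = n b → a = b := fun a b e => hn (by exact_mod_cast e)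
  have hn0 : ∀ a, (0:ℝ) ≤ n a := fun a => Nat.cast_nonneg _
  let g : ι → ℝ := fun v => if h v = c then (if v = z then 0 else if v ∈ Neg then -(n v + 1) else n v + 1)
    else if Bd F v then Real.arctan (h1 v) else n v + 2
  let S : Finset ι := univ.filter (fun w => Bd F w ∨ ¬ Used F w ∨ ¬ (∀ x, Adj F w x → h x = h w))
  have hSm : ∀ w, w ∈ S ↔ (Bd F w ∨ ¬ Used F w ∨ ¬ (∀ x, Adj F w x → h x = h w)) := by intro w; simp [S]
  have hat : ∀ x, Real.arctan x < 2 := fun x => by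
    have h2 := Real.arctan_lt_pi_div_two x
    have h3 := Real.pi_lt_four
    linarith
  obtain ⟨v0, hv0⟩ := hF.bd_ex
  obtain ⟨b0, hb0⟩ := id hv0
  obtain ⟨g', e1, e2, e3⟩ := ear hF h (Sᶜ).card S g le_rfl
    ⟨v0, (hSm _).2 (Or.inl hv0), b0, (hSm _).2 (Or.inl ⟨_, hb0.symm⟩), hb0.1, hb0.adj.used, hb0.adj.symm.used⟩
    (by
      intro a _ b _ hab gab
      simp only [g] at gab
      rw [hab] at gab
      have na := hn0 a
      have nb := hn0 b
      have aa := hat (h1 a)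
      have ab := hat (h1 b)
      split_ifs at gab with t1 t2 t3 t4 t5 t6 t7 t8 t9 t10 <;>
      first
      | (exact hnR a b (by linarith))
      | (subst_vars; rfl)
      | (exfalso; linarith)
      | (exact H.inj a b (by assumption) (by assumption) hab (Real.arctan_injective gab)))
    (fun u hu => by
      rw [hSm] at hu; push Not at hu; exact hu.2.1)
    (fun u hu => by
      rw [hSm] at hu; push Not at hu; exact hu.2.2)
  have ltr : ∀ {a b}, h a < h b → lx h g' a < lx h g' b := fun hab => lx_lt.2 (Or.inl hab)
  have hzS : z ∈ S := by
    rw [hSm]; right; right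
    obtain ⟨w, hw, hw'⟩ := hz
    intro h3; exact hw' ((h3 w hw).trans hzc)
  have gz : g z = 0 := by simp [g, hzc]
  have hr : ∀ a b, Adj F a b → lx h g' a ≠ lx h g' b := by
    intro a b hab he
    rw [lx_inj] at he
    exact hab.1 (e2 a b he.1 he.2)
  have hbb : ∀ a b, BdE F a b → (lx h g' a < lx h g' b ↔ lx h h1 a < lx h h1 b) := by
    intro a b hab
    rw [lx_lt, lx_lt]
    have : h a = h b → (g' a < g' b ↔ h1 a < h1 b) := by
      intro he
      have ha : Bd F a := ⟨b, hab⟩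
      have hb : Bd F b := ⟨a, hab.symm⟩
      rw [e1 a ((hSm _).2 (Or.inl ha)), e1 b ((hSm _).2 (Or.inl hb))]
      have n1 : h a ≠ c := fun h3 => H.nb a b hab h3 (he ▸ h3)
      have n2 : h b ≠ c := fun h3 => n1 (he ▸ h3)
      simp only [g]
      rw [if_neg n1, if_neg n2, if_pos ha, if_pos hb]
      exact Real.arctan_strictMono.lt_iff_lt
    constructor
    · rintro (h3 | ⟨h3, h4⟩)
      · exact Or.inl h3
      · exact Or.inr ⟨h3, (this h3).1 h4⟩
    · rintro (h3 | ⟨h3, h4⟩)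
      · exact Or.inl h3
      · exact Or.inr ⟨h3, (this h3).2 h4⟩
  refine ⟨lx h g', hr, fun w hw => ltr (by rw [hzc]; exact hw), fun w hw => ltr (by rw [hzc]; exact hw), ?_, ?_, ?_⟩
  · rintro w hwz hwc ⟨x, hx, hxc⟩ hwN
    have hwS : w ∈ S := (hSm _).2 (Or.inr (Or.inr (fun h3 => hxc ((h3 x hx).trans hwc))))
    rw [lx_lt]; right
    refine ⟨hwc.trans hzc.symm, ?_⟩
    rw [e1 w hwS, e1 z hzS, gz]
    simp only [g]; rw [if_pos hwc, if_neg hwz, if_pos hwN]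
    linarith [hn0 w]
  · rintro w hwz hwc ⟨x, hx, hxc⟩ hwN
    have hwS : w ∈ S := (hSm _).2 (Or.inr (Or.inr (fun h3 => hxc ((h3 x hx).trans hwc))))
    rw [lx_lt]; right
    refine ⟨hzc.trans hwc.symm, ?_⟩
    rw [e1 w hwS, e1 z hzS, gz]
    simp only [g]; rw [if_pos hwc, if_neg hwz, if_neg hwN]
    linarith [hn0 w]
  · have hne : (univ.filter (fun v => Bd F v)).Nonempty := ⟨v0, by simpa using hv0⟩
    obtain ⟨vM, hM1, hM2⟩ := Finset.exists_max_image _ (lx h h1) hne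
    obtain ⟨vm, hm1, hm2⟩ := Finset.exists_min_image _ (lx h h1) hne
    simp only [mem_filter, mem_univ, true_and] at hM1 hM2 hm1 hm2
    have hlxinj : ∀ a b, Bd F a → Bd F b → lx h h1 a = lx h h1 b → a = b := by
      intro a b ha hb he; rw [lx_inj] at he; exact H.inj a b ha hb he.1 he.2
    refine index hF (lx h g') hr ?_ {vM, vm} card_le_two ?_ z ?_
    · intro v hv hvb
      by_cases hvS : v ∈ S
      · rw [hSm] at hvS
        rcases H.hintr v hv hvb with h3 | ⟨⟨a, ha, ha'⟩, b, hb, hb'⟩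
        · rcases hvS with h4 | h4 | h4
          · exact absurd h4 hvb
          · exact absurd hv h4
          · exact absurd h3 h4
        · exact ⟨⟨a, ha, ltr ha'⟩, b, hb, ltr hb'⟩
      · exact e3 v hvS
    · intro v hv hvE
      simp only [mem_insert, mem_singleton, not_or] at hvE
      obtain ⟨a, b, hab, ha, hb⟩ := bd_two' hF hv
      rcases lt_or_gt_of_ne (hr _ _ ha.adj) with h3 | h3 <;> rcases lt_or_gt_of_ne (hr _ _ hb.adj) with h4 | h4
      · exfalso
        have := H.bmin v a b ha hb hab ((hbb _ _ ha).1 h3) ((hbb _ _ hb).1 h4)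
        exact hvE.2 (hlxinj _ _ hv hm1 (le_antisymm (this _ hm1) (hm2 _ hv)))
      · exact ⟨⟨b, hb.adj, h4⟩, a, ha.adj, h3⟩
      · exact ⟨⟨a, ha.adj, h3⟩, b, hb.adj, h4⟩
      · exfalso
        have := H.bmax v a b ha hb hab ((hbb _ _ ha.symm).1 h3) ((hbb _ _ hb.symm).1 h4)
        exact hvE.1 (hlxinj _ _ hv hM1 (le_antisymm (hM2 _ hv) (this _ hM1)))
    · simp only [mem_insert, mem_singleton, not_or]
      constructor
      · rintro rfl
        obtain ⟨w, hw, hwc⟩ := H.hi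
        exact absurd (hM2 w hw) (not_le.2 (lx_lt.2 (Or.inl (by rw [hzc]; exact hwc))))
      · rintro rfl
        obtain ⟨w, hw, hwc⟩ := H.lo
        exact absurd (hm2 w hw) (not_le.2 (lx_lt.2 (Or.inl (by rw [hzc]; exact hwc))))

/-- zero component in the link -/
def comp (F : Finset (Finset ι)) (h : ι → ℝ) (c : ℝ) (z v : ι) : Set ι :=
  {x | Relation.ReflTransGen (fun x y => ({z, x, y} : Finset ι) ∈ F ∧ h y = c) v x}

lemma comp_props {h : ι → ℝ} {c : ℝ} {z v : ι} (hF : Disk F) (hzv : Adj F z v) (hv : h v = c) {x : ι}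
    (hx : x ∈ comp F h c z v) : h x = c ∧ Adj F z x := by
  have hx : Relation.ReflTransGen (fun x y => ({z, x, y} : Finset ι) ∈ F ∧ h y = c) v x := hx
  induction hx with
  | refl => exact ⟨hv, hzv⟩
  | tail _ h2 ih => exact ⟨h2.2, tri_adj' hF h2.1⟩

lemma comp_cut {h : ι → ℝ} {c : ℝ} {z v x y : ι} (hx : x ∈ comp F h c z v) (hxy : ({z, x, y} : Finset ι) ∈ F)
    (hy : y ∉ comp F h c z v) : h y ≠ c :=
  fun h3 => hy (Relation.ReflTransGen.tail hx ⟨hxy, h3⟩)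

lemma card3_le {α : Type} [DecidableEq α] {s : Finset α} {a b c : α} (ha : a ∈ s) (hb : b ∈ s) (hc : c ∈ s) (hab : a ≠ b) (hac : a ≠ c)
    (hbc : b ≠ c) : 3 ≤ s.card := by
  have : ({a, b, c} : Finset α) ⊆ s := by
    intro x; simp; rintro (rfl | rfl | rfl) <;> assumption
  have h2 := card_le_card this
  rwa [card_eq_three.2 ⟨a, b, c, hab, hac, hbc, rfl⟩] at h2

lemma card2_le {α : Type} [DecidableEq α] {s : Finset α} {a b : α} (ha : a ∈ s) (hb : b ∈ s) (hab : a ≠ b) : 2 ≤ s.card :=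
  Finset.one_lt_card.2 ⟨a, ha, b, hb, hab⟩

lemma up_bd {z : ι} (hz : Bd F z) : up F z = 1 := by
  unfold up; rw [if_pos hz.used, if_pos hz]

lemma up_int {z : ι} (hz : ¬ Bd F z) : up F z ≤ 2 := by
  unfold up; split_ifs <;> omega

/-- the cut of the component -/
lemma Lev.two_cut (hF : Disk F) {h h1 : ι → ℝ} {c : ℝ} (H : Lev F h h1 c) {z : ι} (hzc : h z = c)
    (hz : ∃ w, Adj F z w ∧ h w ≠ c) {v : ι} (hzv : Adj F z v) (hv : h v = c) :
    ∃ p p' : ι × ι, p ≠ p' ∧ (p.1 ∈ comp F h c z v ∧ p.2 ∉ comp F h c z v ∧ ({z, p.1, p.2} : Finset ι) ∈ F) ∧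
     (p'.1 ∈ comp F h c z v ∧ p'.2 ∉ comp F h c z v ∧ ({z, p'.1, p'.2} : Finset ι) ∈ F) := by
  classical
  set R := comp F h c z v with hR
  have hvR : v ∈ R := Relation.ReflTransGen.refl
  have h0 := parity (fun x y => ({z, x, y} : Finset ι) ∈ F) (fun x y h => by rwa [tri_swap])
    (fun x h => (tri_ne hF h).2.2 rfl) (univ.filter (fun x => x ∈ R))
  have h2 : ∑ x ∈ (univ.filter (fun x => x ∈ R)), (univ.filter (fun y => ({z, x, y} : Finset ι) ∈ F)).card
      = ∑ x ∈ (univ.filter (fun x => x ∈ R)), 2 := 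
    sum_congr rfl (fun x hx => by
      simp at hx
      have h3 := comp_props hF hzv hv hx
      rw [ec_eq_link hF h3.2.1]
      rcases h3.2.bd_or_int hF with h4 | h4
      · exact absurd h3.1 (H.nb _ _ h4 hzc)
      · exact h4.2)
  rw [h2] at h0
  have h3 : 2 ∣ (univ.filter (fun p : ι × ι => p.1 ∈ (univ.filter (fun x => x ∈ R)) ∧
      p.2 ∉ (univ.filter (fun x => x ∈ R)) ∧ ({z, p.1, p.2} : Finset ι) ∈ F)).card := by
    rw [← ZMod.natCast_eq_zero_iff, ← h0, ZMod.natCast_eq_zero_iff]; simp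
  have h4 : 0 < (univ.filter (fun p : ι × ι => p.1 ∈ (univ.filter (fun x => x ∈ R)) ∧
      p.2 ∉ (univ.filter (fun x => x ∈ R)) ∧ ({z, p.1, p.2} : Finset ι) ∈ F)).card := by
    rw [card_pos]
    by_contra hcon
    rw [not_nonempty_iff_eq_empty] at hcon
    obtain ⟨w, hw, hwc⟩ := hz
    have := hF.link z R ⟨v, hvR, hzv⟩ (fun x y hx hxy => by
      by_contra hy
      have : (x, y) ∈ (∅ : Finset (ι × ι)) := by
        rw [← hcon]; simp; exact ⟨hx, hy, hxy⟩
      simp at this) w hw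
    exact hwc (comp_props hF hzv hv this).1
  obtain ⟨p, hp, p', hp', hne⟩ := Finset.one_lt_card.1 (Nat.le_of_dvd h4 h3)
  simp at hp hp'
  exact ⟨p, p', hne, hp, hp'⟩

lemma Lev.caseA (hF : Disk F) {h h1 : ι → ℝ} {c : ℝ} (H : Lev F h h1 c) {z : ι} (hzc : h z = c)
    (hz : ∃ w, Adj F z w ∧ h w ≠ c) {v : ι} (hzv : Adj F z v) (hv : h v = c)
    (hpos : ∀ x y, x ∈ comp F h c z v → y ∉ comp F h c z v → ({z, x, y} : Finset ι) ∈ F → c < h y) : False := by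
  classical
  obtain ⟨p, p', hne, hp, hp'⟩ := H.two_cut hF hzc hz hzv hv
  obtain ⟨r, r1, r2, r3, r4, r5, r6⟩ := H.idx hF hzc hz (comp F h c z v)
  have key : ∀ p : ι × ι, (p.1 ∈ comp F h c z v ∧ p.2 ∉ comp F h c z v ∧ ({z, p.1, p.2} : Finset ι) ∈ F) → p ∈ scs F r z := by
    intro p hp
    have hy := hpos _ _ hp.1 hp.2.1 hp.2.2
    rw [mem_scs]
    have ne := tri_ne hF hp.2.2
    refine ⟨hp.2.2, r4 _ ne.1.symm (comp_props hF hzv hv hp.1).1 ⟨p.2, ⟨ne.2.2, _, hp.2.2, by simp, by simp⟩, hy.ne'⟩ hp.1, r3 _ hy⟩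
  have c2 := card2_le (key p hp) (key p' hp') hne
  by_cases hb : Bd F z
  · rw [up_bd hb] at r6; omega
  have hu := up_int hb
  rcases H.hintr z hzv.used hb with h3 | ⟨⟨a, ha, ha'⟩, b, hb, hb'⟩
  · obtain ⟨w, hw, hwc⟩ := hz
    exact hwc ((h3 w hw).trans hzc)
  rw [hzc] at ha' hb'
  have : ∃ x y, ({z, x, y} : Finset ι) ∈ F ∧ h x < c ∧ c ≤ h y := by
    by_contra hcon
    push Not at hcon
    have := hF.link z {x | h x < c} ⟨a, ha', ha⟩ (fun x y hx hxy => hcon x y hxy hx) b hb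
    have : h b < c := this
    linarith
  obtain ⟨x, y, hxy, hx, hy⟩ := this
  have ne := tri_ne hF hxy
  have hyR : y ∉ comp F h c z v := by
    intro hyR
    have := hpos y x hyR (fun hxR => hx.ne (comp_props hF hzv hv hxR).1) (by rwa [tri_swap])
    linarith
  have hm : (x, y) ∈ scs F r z := by
    rw [mem_scs]
    refine ⟨hxy, r2 x hx, ?_⟩
    rcases eq_or_lt_of_le hy with h3 | h3
    · exact r5 y ne.2.1.symm h3.symm ⟨x, ⟨ne.2.2.symm, _, hxy, by simp, by simp⟩, hx.ne⟩ hyR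
    · exact r3 y h3
  have n1 : ∀ p : ι × ι, p.1 ∈ comp F h c z v → p ≠ (x, y) := by
    rintro p h3 rfl
    exact hx.ne (comp_props hF hzv hv h3).1
  have := card3_le (key p hp) (key p' hp') hm hne (n1 _ hp.1) (n1 _ hp'.1)
  omega

lemma comp_neg {h : ι → ℝ} {c : ℝ} {z v : ι} : comp F (fun v => - h v) (-c) z v = comp F h c z v := by
  unfold comp; simp

theorem Lev.main (hF : Disk F) {h h1 : ι → ℝ} {c : ℝ} (H : Lev F h h1 c) {z : ι} (hzc : h z = c)
    (hz : ∃ w, Adj F z w ∧ h w ≠ c) {v v1 v2 : ι} (hv : h v = c) (t1 : ({z, v, v1} : Finset ι) ∈ F)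
    (t2 : ({z, v, v2} : Finset ι) ∈ F) (h12 : v1 ≠ v2) : (h v1 - c) * (h v2 - c) < 0 := by
  classical
  have hzv := tri_adj hF t1
  by_contra hcon
  by_cases hA : ∀ x y, x ∈ comp F h c z v → y ∉ comp F h c z v → ({z, x, y} : Finset ι) ∈ F → c < h y
  · exact H.caseA hF hzc hz hzv hv hA
  by_cases hB : ∀ x y, x ∈ comp F h c z v → y ∉ comp F h c z v → ({z, x, y} : Finset ι) ∈ F → h y < c
  · refine H.neg.caseA hF (z := z) (v := v) (by simp [hzc]) ?_ hzv (by simp [hv]) ?_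
    · obtain ⟨w, hw, hw'⟩ := hz
      exact ⟨w, hw, fun h3 => hw' (by linarith)⟩
    · rw [comp_neg]
      intro x y hx hy hxy
      have := hB x y hx hy hxy
      linarith
  push Not at hA hB
  obtain ⟨q0, o0, hq0, ho0, l0, s0⟩ := hA
  obtain ⟨q1, o1, hq1, ho1, l1, s1⟩ := hB
  have s0 := lt_of_le_of_ne s0 (comp_cut hq0 l0 ho0)
  have s1 := lt_of_le_of_ne s1 (comp_cut hq1 l1 ho1).symm
  have hne : q0 ≠ q1 := by
    rintro rfl
    have hoo : o0 ≠ o1 := by rintro rfl; linarith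
    obtain ⟨a, b, hab, _, _, honly⟩ := (IntE.of_two hF l0 l1 hoo).two hF
    have honly' : ∀ e, ({z, q0, e} : Finset ι) ∈ F → e = o0 ∨ e = o1 := by
      intro e he
      have := honly e he
      have := honly o0 l0
      have := honly o1 l1
      grind
    have hcomp : ∀ x, x ∈ comp F h c z v → x = q0 := by
      have : comp F h c z v ⊆ {q0} := by
        by_contra hnot
        -- v reaches q0 backwards; use symmetric closure
        have hsym : ∀ x, x ∈ comp F h c z v → Relation.ReflTransGen (fun x y => ({z, x, y} : Finset ι) ∈ F ∧ h y = c) x v := by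
          intro x hx
          have hx' : Relation.ReflTransGen (fun x y => ({z, x, y} : Finset ι) ∈ F ∧ h y = c) v x := hx
          induction hx' with
          | refl => exact Relation.ReflTransGen.refl
          | tail h3 h4 ih =>
            exact Relation.ReflTransGen.head ⟨by rw [tri_swap]; exact h4.1, (comp_props hF hzv hv h3).1⟩ (ih h3)
        have hall : ∀ x, Relation.ReflTransGen (fun x y => ({z, x, y} : Finset ι) ∈ F ∧ h y = c) q0 x → x = q0 := by
          intro x hx
          induction hx with
          | refl => rfl
          | tail h3 h4 ih =>
            subst ih
            rcases honly' _ h4.1 with h5 | h5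
            · subst h5; exact absurd h4.2 s0.ne
            · subst h5; exact absurd h4.2 s1.ne'
        exact hnot (fun x hx => hall x ((hsym q0 hq0).trans hx))
      exact this
    have hvq := hcomp v Relation.ReflTransGen.refl
    subst hvq
    apply hcon
    rcases honly' v1 t1 with e1 | e1 <;> rcases honly' v2 t2 with e2 | e2
    · exact absurd (e1.trans e2.symm) h12
    · rw [e1, e2]; nlinarith
    · rw [e1, e2]; nlinarith
    · exact absurd (e1.trans e2.symm) h12
  obtain ⟨r, r1, r2, r3, r4, r5, r6⟩ := H.idx hF hzc hz {q1}
  have n0 := tri_ne hF l0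
  have n1 := tri_ne hF l1
  have p0 := comp_props hF hzv hv hq0
  have p1 := comp_props hF hzv hv hq1
  have g0 : r z < r q0 := r5 q0 n0.1.symm p0.1 ⟨o0, ⟨n0.2.2, _, l0, by simp, by simp⟩, s0.ne⟩ hne
  have g1 : r q1 < r z := r4 q1 n1.1.symm p1.1 ⟨o1, ⟨n1.2.2, _, l1, by simp, by simp⟩, s1.ne'⟩ rfl
  have m0 : (o0, q0) ∈ scs F r z := mem_scs.2 ⟨by rw [tri_swap]; exact l0, r2 _ s0, g0⟩
  have m1 : (q1, o1) ∈ scs F r z := mem_scs.2 ⟨l1, g1, r3 _ s1⟩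
  have m01 : (o0, q0) ≠ (q1, o1) := by
    intro he; simp at he; rw [he.1, p1.1] at s0; exact lt_irrefl _ s0
  have c2 := card2_le m0 m1 m01
  by_cases hb : Bd F z
  · rw [up_bd hb] at r6; omega
  have hu := up_int hb
  have : ∃ x y, ({z, x, y} : Finset ι) ∈ F ∧ h x = c ∧ h y = c ∧ r x < r z ∧ r z < r y := by
    by_contra hno
    push Not at hno
    have hconst : ∀ x, x ∈ comp F h c z v → (r x < r z ↔ r v < r z) := by
      intro x hx
      have hx' : Relation.ReflTransGen (fun x y => ({z, x, y} : Finset ι) ∈ F ∧ h y = c) v x := hx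
      induction hx' with
      | refl => exact Iff.rfl
      | @tail b d h3 h4 ih =>
        refine Iff.trans ?_ (ih h3)
        have hbc := (comp_props hF hzv hv h3).1
        have a1 := r1 _ _ (tri_adj hF h4.1)
        have a2 := r1 _ _ (tri_adj' hF h4.1)
        constructor
        · intro h5
          have := hno d b (by rw [tri_swap]; exact h4.1) h4.2 hbc h5
          exact lt_of_le_of_ne this a1.symm
        · intro h5
          have := hno b d h4.1 hbc h4.2 h5
          exact lt_of_le_of_ne this a2.symm
    have := (hconst q0 hq0).2 ((hconst q1 hq1).1 g1)
    exact lt_asymm this g0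
  obtain ⟨x, y, hxy, hx, hy, hrx, hry⟩ := this
  have m2 : (x, y) ∈ scs F r z := mem_scs.2 ⟨hxy, hrx, hry⟩
  have := card3_le m0 m1 m2 m01 (by intro he; simp at he; rw [he.1, hx] at s0; exact lt_irrefl _ s0)
    (by intro he; simp at he; rw [he.2, hy] at s1; exact lt_irrefl _ s1)
  omega
end main
end TD

namespace TD
open Finset
section tutte
variable {ι : Type} [Fintype ι] [DecidableEq ι] {F : Finset (Finset ι)}

open Classical in
/-- harmonic at interior vertices -/
def Harm (F : Finset (Finset ι)) (h : ι → ℝ) : Prop :=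
  ∀ v, Used F v → ¬ Bd F v → ∑ w ∈ univ.filter (fun w => Adj F v w), (h w - h v) = 0

lemma Harm.flat_or {h : ι → ℝ} (H : Harm F h) (v : ι) (hv : Used F v) (hb : ¬ Bd F v) :
    (∀ w, Adj F v w → h w = h v) ∨ ((∃ w, Adj F v w ∧ h w < h v) ∧ ∃ w, Adj F v w ∧ h v < h w) := by
  classical
  have h0 := H v hv hb
  by_cases h1 : ∃ w, Adj F v w ∧ h w < h v
  · right
    refine ⟨h1, ?_⟩
    by_contra h2
    push Not at h2
    obtain ⟨w, hw, hw'⟩ := h1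
    have : ∑ w ∈ univ.filter (fun w => Adj F v w), (h w - h v) < 0 := by
      refine Finset.sum_neg' (fun i hi => ?_) ⟨w, by simpa using hw, by linarith⟩
      simp at hi; linarith [h2 i hi]
    linarith
  · left
    push Not at h1
    have := (Finset.sum_eq_zero_iff_of_nonneg (fun i hi => by simp at hi; linarith [h1 i hi])).1 h0
    intro w hw
    have := this w (by simpa using hw)
    linarith

/-- maximum principle -/
lemma Harm.le_bd (hF : Disk F) {h : ι → ℝ} (H : Harm F h) {M : ℝ} (hM : ∀ v, Bd F v → h v ≤ M) :
    ∀ v, Used F v → h v ≤ M := by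
  classical
  intro v hv
  have hne : (univ.filter (fun v => Used F v)).Nonempty := ⟨v, by simpa using hv⟩
  obtain ⟨x, hx, hmax⟩ := Finset.exists_max_image _ h hne
  simp at hx hmax
  refine (hmax v hv).trans ?_
  by_contra hcon
  push Not at hcon
  have hall := hF.conn {y | Used F y ∧ h y = h x} ⟨x, ⟨hx, rfl⟩, hx⟩ (by
    rintro a b ⟨ha, ha'⟩ hab
    refine ⟨hab.symm.used, ?_⟩
    have hnb : ¬ Bd F a := fun h3 => by have := hM a h3; linarith
    rcases H.flat_or a ha hnb with h3 | ⟨_, w, hw, hw'⟩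
    · rw [h3 b hab, ha']
    · have := hmax w hw.symm.used; linarith)
  obtain ⟨b, hb⟩ := hF.bd_ex
  have := (hall b hb.used).2
  have := hM b hb
  linarith

lemma tutte (hF : Disk F) (φ : ι → ℝ) : ∃ h : ι → ℝ, (∀ v, Bd F v → h v = φ v) ∧ Harm F h := by
  classical
  let L : (ι → ℝ) →ₗ[ℝ] (ι → ℝ) := 
    { toFun := fun h v => if Used F v ∧ ¬ Bd F v then ∑ w ∈ univ.filter (fun w => Adj F v w), (h w - h v) else h v
      map_add' := by
        intro h g; ext v; simp only [Pi.add_apply]; split_ifs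
        · rw [← sum_add_distrib]; exact sum_congr rfl (fun _ _ => by ring)
        · rfl
      map_smul' := by
        intro c g; ext v; simp only [Pi.smul_apply, smul_eq_mul, RingHom.id_apply]; split_ifs
        · rw [mul_sum]; exact sum_congr rfl (fun _ _ => by ring)
        · rfl }
  have hL : ∀ h v, L h v = if Used F v ∧ ¬ Bd F v then ∑ w ∈ univ.filter (fun w => Adj F v w), (h w - h v) else h v :=
    fun _ _ => rfl
  have hinj : Function.Injective L := by
    rw [injective_iff_map_eq_zero]
    intro h hh
    have e : ∀ v, L h v = 0 := fun v => by rw [hh]; rfl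
    have H : Harm F h := fun v hv hb => by
      have := e v; rw [hL, if_pos ⟨hv, hb⟩] at this; exact this
    have H' : Harm F (fun v => - h v) := fun v hv hb => by
      have := H v hv hb
      rw [← neg_eq_zero, ← sum_neg_distrib] at this
      rw [← this]
      exact sum_congr rfl (fun _ _ => by ring)
    have hz : ∀ v, ¬ (Used F v ∧ ¬ Bd F v) → h v = 0 := fun v hv => by
      have := e v; rwa [hL, if_neg hv] at this
    ext v
    by_cases hv : Used F v ∧ ¬ Bd F v
    · have h1 := H.le_bd hF (M := 0) (fun v hv => (hz v (by tauto)).le) v hv.1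
      have h2 := H'.le_bd hF (M := 0) (fun v hv => by simp [(hz v (by tauto))]) v hv.1
      show h v = 0
      linarith
    · exact hz v hv
  obtain ⟨h, hh⟩ := LinearMap.surjective_of_injective hinj (fun v => if Used F v ∧ ¬ Bd F v then 0 else φ v)
  have e : ∀ v, L h v = if Used F v ∧ ¬ Bd F v then 0 else φ v := fun v => by rw [hh]
  refine ⟨h, fun v hv => ?_, fun v hv hb => ?_⟩
  · have := e v; rwa [hL, if_neg (by tauto), if_neg (by tauto)] at this
  · have := e v; rwa [hL, if_pos ⟨hv, hb⟩, if_pos ⟨hv, hb⟩] at this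
end tutte
end TD

namespace TD
open Finset
section bary
variable {ι : Type} [Fintype ι] [DecidableEq ι] {Q : ι → ℝ × ℝ} {t : Finset ι}

/-- the simplex spanned by a set of vertices -/
def hull (Q : ι → ℝ × ℝ) (t : Finset ι) : Set (ℝ × ℝ) := convexHull ℝ (Q '' (t : Set ι))

/-- nondegenerate triangle -/
def Good (Q : ι → ℝ × ℝ) (t : Finset ι) : Prop := t.card = 3 ∧ AffineIndependent ℝ (fun v : t => Q v)

lemma Good.top (h : Good Q t) : affineSpan ℝ (Set.range (fun v : t => Q v)) = ⊤ := by
  rw [h.2.affineSpan_eq_top_iff_card_eq_finrank_add_one]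
  simp [h.1]

/-- the affine basis -/
noncomputable def Good.basis (h : Good Q t) : AffineBasis t ℝ (ℝ × ℝ) := ⟨fun v => Q v, h.2, h.top⟩

lemma Good.basis_apply (h : Good Q t) (v : t) : h.basis v = Q v := rfl

open Classical in
/-- barycentric coordinates -/
noncomputable def bc (Q : ι → ℝ × ℝ) (t : Finset ι) (v : ι) : (ℝ × ℝ) →ᵃ[ℝ] ℝ :=
  if h : Good Q t ∧ v ∈ t then h.1.basis.coord ⟨v, h.2⟩ else 0

lemma bc_eq (h : Good Q t) {v : ι} (hv : v ∈ t) : bc Q t v = h.basis.coord ⟨v, hv⟩ := by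
  unfold bc; rw [dif_pos ⟨h, hv⟩]

lemma bc_not {v : ι} (hv : v ∉ t) (p : ℝ × ℝ) : bc Q t v p = 0 := by
  unfold bc; rw [dif_neg (fun h => hv h.2)]; rfl

lemma bc_sum (h : Good Q t) (p : ℝ × ℝ) : ∑ v ∈ t, bc Q t v p = 1 := by
  rw [← h.basis.sum_coord_apply_eq_one p, ← Finset.sum_coe_sort t]
  exact sum_congr rfl (fun v _ => by rw [bc_eq h v.2])

lemma bc_comb (h : Good Q t) (p : ℝ × ℝ) : ∑ v ∈ t, bc Q t v p • Q v = p := by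
  have := h.basis.linear_combination_coord_eq_self p
  rw [← Finset.sum_coe_sort t]
  refine Eq.trans ?_ this
  exact sum_congr rfl (fun v _ => by rw [bc_eq h v.2, h.basis_apply])

lemma bc_self (h : Good Q t) {v : ι} (hv : v ∈ t) : bc Q t v (Q v) = 1 := by
  rw [bc_eq h hv]; have h2 := h.basis.coord_apply_eq ⟨v, hv⟩; rwa [h.basis_apply] at h2

lemma bc_ne (h : Good Q t) {v w : ι} (hw : w ∈ t) (hvw : v ≠ w) : bc Q t v (Q w) = 0 := by
  by_cases hv : v ∈ t
  · rw [bc_eq h hv]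
    have : (⟨v, hv⟩ : t) ≠ ⟨w, hw⟩ := fun he => hvw (by simpa using he)
    have h2 := h.basis.coord_apply_ne this
    rwa [h.basis_apply] at h2
  · exact bc_not hv _

lemma mem_hull (h : Good Q t) {p : ℝ × ℝ} : p ∈ hull Q t ↔ ∀ v ∈ t, 0 ≤ bc Q t v p := by
  have e : hull Q t = convexHull ℝ (Set.range h.basis) := by
    unfold hull; congr 1; ext x; simp [h.basis_apply]
  rw [e, AffineBasis.convexHull_eq_nonneg_coord]
  constructor
  · intro h2 v hv; rw [bc_eq h hv]; exact h2 ⟨v, hv⟩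
  · rintro h2 ⟨v, hv⟩; rw [← bc_eq h hv]; exact h2 v hv

lemma mem_int (h : Good Q t) {p : ℝ × ℝ} : p ∈ interior (hull Q t) ↔ ∀ v ∈ t, 0 < bc Q t v p := by
  have e : hull Q t = convexHull ℝ (Set.range h.basis) := by
    unfold hull; congr 1; ext x; simp [h.basis_apply]
  rw [e, AffineBasis.interior_convexHull]
  constructor
  · intro h2 v hv; rw [bc_eq h hv]; exact h2 ⟨v, hv⟩
  · rintro h2 ⟨v, hv⟩; rw [← bc_eq h hv]; exact h2 v hv

lemma bc_cont (v : ι) : Continuous (bc Q t v) := AffineMap.continuous_of_finiteDimensional _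

lemma hull_closed : IsClosed (hull Q t) := 
  (Set.Finite.isCompact_convexHull (𝕜 := ℝ) (Set.toFinite (Q '' (t : Set ι)))).isClosed

lemma hull_compact : IsCompact (hull Q t) := 
  Set.Finite.isCompact_convexHull (𝕜 := ℝ) (Set.toFinite (Q '' (t : Set ι)))

lemma hull_convex : Convex ℝ (hull Q t) := convex_convexHull _ _

lemma vert_mem {v : ι} (hv : v ∈ t) : Q v ∈ hull Q t := subset_convexHull _ _ ⟨v, hv, rfl⟩

lemma hull_mono {s : Finset ι} (h : s ⊆ t) : hull Q s ⊆ hull Q t :=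
  convexHull_mono (Set.image_mono (by exact_mod_cast h))

/-- affine combination formula -/
lemma aff_comb {V : Type} [AddCommGroup V] [Module ℝ V] (g : (ℝ × ℝ) →ᵃ[ℝ] V) (s : Finset ι) (w : ι → ℝ)
    (hw : ∑ v ∈ s, w v = 1) : g (∑ v ∈ s, w v • Q v) = ∑ v ∈ s, w v • g (Q v) := by
  have h1 := Finset.map_affineCombination s Q w hw g
  rw [Finset.affineCombination_eq_linear_combination s Q w hw,
    Finset.affineCombination_eq_linear_combination s _ w hw] at h1
  exact h1

lemma bc_uniq (h : Good Q t) (w : ι → ℝ) (hw : ∑ v ∈ t, w v = 1) {v : ι} (hv : v ∈ t) :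
    bc Q t v (∑ v ∈ t, w v • Q v) = w v := by
  rw [aff_comb _ _ _ hw, Finset.sum_eq_single v]
  · rw [bc_self h hv]; simp
  · intro u hu huv; rw [bc_ne h hu huv.symm]; simp
  · intro h2; exact absurd hv h2

/-- an affine map in barycentric coordinates -/
lemma aff_bc {V : Type} [AddCommGroup V] [Module ℝ V] (h : Good Q t) (g : (ℝ × ℝ) →ᵃ[ℝ] V) (p : ℝ × ℝ) :
    g p = ∑ v ∈ t, bc Q t v p • g (Q v) := by
  conv_lhs => rw [← bc_comb h p]
  exact aff_comb _ _ _ (bc_sum h p)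

lemma mem_hull_iff {s : Finset ι} {p : ℝ × ℝ} : p ∈ hull Q s ↔
    ∃ w : ι → ℝ, (∀ v ∈ s, 0 ≤ w v) ∧ ∑ v ∈ s, w v = 1 ∧ ∑ v ∈ s, w v • Q v = p := by
  classical
  constructor
  · intro hp
    have : hull Q s ⊆ {p | ∃ w : ι → ℝ, (∀ v ∈ s, 0 ≤ w v) ∧ ∑ v ∈ s, w v = 1 ∧ ∑ v ∈ s, w v • Q v = p} := by
      refine convexHull_min ?_ ?_
      · rintro _ ⟨v, hv, rfl⟩
        have hv : v ∈ s := hv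
        refine ⟨fun u => if u = v then 1 else 0, ?_, ?_, ?_⟩
        · intro u _; dsimp only; split_ifs <;> norm_num
        · simp [hv]
        · simp [hv]
      · rintro x ⟨w, h1, h2, rfl⟩ y ⟨w', h1', h2', rfl⟩ a b ha hb hab
        refine ⟨fun u => a * w u + b * w' u, fun v hv => ?_, ?_, ?_⟩
        · have := h1 v hv; have := h1' v hv; positivity
        · rw [sum_add_distrib, ← mul_sum, ← mul_sum, h2, h2']; linarith
        · simp only [add_smul, mul_smul]
          rw [sum_add_distrib, ← smul_sum, ← smul_sum]
    exact this hp
  · rintro ⟨w, h1, h2, rfl⟩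
    exact (convex_convexHull ℝ _).sum_mem h1 h2 (fun v hv => subset_convexHull _ _ ⟨v, hv, rfl⟩)

/-- faces in barycentric coordinates -/
lemma mem_face (h : Good Q t) {s : Finset ι} (hs : s ⊆ t) {p : ℝ × ℝ} :
    p ∈ hull Q s ↔ p ∈ hull Q t ∧ ∀ v ∈ t, v ∉ s → bc Q t v p = 0 := by
  classical
  constructor
  · intro hp
    refine ⟨hull_mono hs hp, fun v hv hvs => ?_⟩
    obtain ⟨w, h1, h2, rfl⟩ := mem_hull_iff.1 hp
    rw [aff_comb _ _ _ h2]
    refine sum_eq_zero (fun u hu => ?_)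
    rw [bc_ne h (hs hu) (by rintro rfl; exact hvs hu)]; simp
  · rintro ⟨h1, h2⟩
    rw [mem_hull h] at h1
    refine mem_hull_iff.2 ⟨fun v => bc Q t v p, fun v hv => h1 v (hs hv), ?_, ?_⟩
    · rw [← bc_sum h p]
      exact sum_subset hs (fun v hv hvs => h2 v hv hvs)
    · conv_rhs => rw [← bc_comb h p]
      exact sum_subset hs (fun v hv hvs => by dsimp only; rw [h2 v hv hvs]; simp)

lemma sum_tri {M : Type} [AddCommMonoid M] {a b c : ι} (hab : a ≠ b) (hac : a ≠ c) (hbc : b ≠ c) (f : ι → M) :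
    ∑ v ∈ ({a, b, c} : Finset ι), f v = f a + (f b + f c) := by
  rw [sum_insert (by simp [hab, hac]), sum_insert (by simp [hbc]), sum_singleton]

lemma card3_ne {a b c : ι} (h : ({a, b, c} : Finset ι).card = 3) : a ≠ b ∧ a ≠ c ∧ b ≠ c := by
  refine ⟨?_, ?_, ?_⟩
  · rintro rfl
    have h3 := Finset.card_le_two (a := a) (b := c)
    simp at h; omega
  · rintro rfl
    have h3 := Finset.card_le_two (a := b) (b := a)
    have e : ({a, b, a} : Finset ι) = {b, a} := by ext x; simp
    rw [e] at h; omega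
  · rintro rfl
    have h3 := Finset.card_le_two (a := a) (b := b)
    simp at h; omega

/-- determinant -/
def det3 (a b c : ℝ × ℝ) : ℝ := (b.1 - a.1) * (c.2 - a.2) - (b.2 - a.2) * (c.1 - a.1)

/-- determinant as an affine map of the last argument -/
noncomputable def detA (a b : ℝ × ℝ) : (ℝ × ℝ) →ᵃ[ℝ] ℝ :=
  ((b.1 - a.1) • (LinearMap.snd ℝ ℝ ℝ) - (b.2 - a.2) • (LinearMap.fst ℝ ℝ ℝ)).toAffineMap +
    AffineMap.const ℝ _ (-(b.1 - a.1) * a.2 + (b.2 - a.2) * a.1)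

lemma detA_apply (a b c : ℝ × ℝ) : detA a b c = det3 a b c := by
  simp [detA, det3]; ring

lemma bc_det {a b c : ι} (h : Good Q {a, b, c}) (p : ℝ × ℝ) :
    det3 (Q a) (Q b) p = bc Q {a, b, c} c p * det3 (Q a) (Q b) (Q c) := by
  obtain ⟨n1, n2, n3⟩ := card3_ne h.1
  rw [← detA_apply, aff_bc h (detA (Q a) (Q b)) p, sum_tri n1 n2 n3]
  simp only [detA_apply, smul_eq_mul]
  have e1 : det3 (Q a) (Q b) (Q a) = 0 := by unfold det3; ring
  have e2 : det3 (Q a) (Q b) (Q b) = 0 := by unfold det3; ring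
  rw [e1, e2]; ring

lemma det_rot (a b c : ℝ × ℝ) : det3 b c a = det3 a b c := by unfold det3; ring
lemma det_swap (a b c : ℝ × ℝ) : det3 b a c = - det3 a b c := by unfold det3; ring

lemma Good.det_ne {a b c : ι} (h : Good Q {a, b, c}) : det3 (Q a) (Q b) (Q c) ≠ 0 := by
  intro h0
  obtain ⟨n1, n2, n3⟩ := card3_ne h.1
  have hall : ∀ p, det3 (Q a) (Q b) p = 0 := fun p => by rw [bc_det h, h0, mul_zero]
  have h1 := hall (Q a + (0, 1))
  have h2 := hall (Q a + (1, 0))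
  simp [det3] at h1 h2
  have e : Q a = Q b := by ext <;> linarith
  have h3 := bc_self h (v := a) (by simp)
  rw [e, bc_ne h (by simp) n1] at h3
  norm_num at h3

lemma good_of_det {a b c : ι} (h : det3 (Q a) (Q b) (Q c) ≠ 0) : Good Q {a, b, c} := by
  have n1 : a ≠ b := by rintro rfl; apply h; unfold det3; ring
  have n2 : a ≠ c := by rintro rfl; apply h; unfold det3; ring
  have n3 : b ≠ c := by rintro rfl; apply h; unfold det3; ring
  refine ⟨card_eq_three.2 ⟨a, b, c, n1, n2, n3, rfl⟩, ?_⟩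
  rw [affineIndependent_iff_of_fintype]
  intro w hw0 hw
  rw [Finset.weightedVSub_eq_weightedVSubOfPoint_of_sum_eq_zero _ _ _ hw0 0] at hw
  simp only [Finset.weightedVSubOfPoint_apply, vsub_eq_sub, sub_zero] at hw
  classical
  let u : ι → ℝ := fun v => if hv : v ∈ ({a, b, c} : Finset ι) then w ⟨v, hv⟩ else 0
  have hu : ∀ v : ({a, b, c} : Finset ι), w v = u v := by
    intro v; simp only [u]; rw [dif_pos v.2]
  have s1 : ∑ v ∈ ({a, b, c} : Finset ι), u v = 0 := by
    rw [← Finset.sum_coe_sort, ← hw0]; exact sum_congr rfl (fun v _ => (hu v).symm)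
  have s2 : ∑ v ∈ ({a, b, c} : Finset ι), u v • Q v = 0 := by
    rw [← Finset.sum_coe_sort, ← hw]; exact sum_congr rfl (fun v _ => by rw [hu v])
  rw [sum_tri n1 n2 n3] at s1 s2
  have s3 := congrArg Prod.fst s2
  have s4 := congrArg Prod.snd s2
  simp at s3 s4
  have k1 : u c * det3 (Q a) (Q b) (Q c) = 0 := by
    unfold det3
    have : u a = - u b - u c := by linarith
    rw [this] at s3 s4
    linear_combination ((Q b).1 - (Q a).1) * s4 - ((Q b).2 - (Q a).2) * s3
  have k2 : u b * det3 (Q a) (Q b) (Q c) = 0 := by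
    unfold det3
    have : u a = - u b - u c := by linarith
    rw [this] at s3 s4
    linear_combination ((Q c).2 - (Q a).2) * s3 - ((Q c).1 - (Q a).1) * s4
  have k3 := (mul_eq_zero.1 k1).resolve_right h
  have k4 := (mul_eq_zero.1 k2).resolve_right h
  have k5 : u a = 0 := by linarith
  rintro ⟨v, hv⟩
  rw [hu]
  simp at hv
  rcases hv with rfl | rfl | rfl <;> assumption

end bary
end TD

namespace TD
open Finset Topology
section cfg
variable {ι : Type} [Fintype ι] [DecidableEq ι] {Q : ι → ℝ × ℝ} {t : Finset ι} {𝓕 : Finset (Finset ι)}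

/-- nondegenerate locally unfolded configuration -/
structure Cfg (Q : ι → ℝ × ℝ) (𝓕 : Finset (Finset ι)) : Prop where
  good : ∀ t ∈ 𝓕, Good Q t
  opp : ∀ a b c d, ({a, b, c} : Finset ι) ∈ 𝓕 → ({a, b, d} : Finset ι) ∈ 𝓕 → c ≠ d → bc Q {a, b, c} c (Q d) < 0

lemma Cfg.sub (h : Cfg Q 𝓕) {𝓖 : Finset (Finset ι)} (hs : 𝓖 ⊆ 𝓕) : Cfg Q 𝓖 :=
  ⟨fun t ht => h.good t (hs ht), fun a b c d h1 h2 => h.opp a b c d (hs h1) (hs h2)⟩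

lemma bc_scale {a b c d : ι} (h : Good Q {a, b, c}) (h' : Good Q {a, b, d}) (p : ℝ × ℝ) :
    bc Q {a, b, d} d p = bc Q {a, b, c} c p * bc Q {a, b, d} d (Q c) := by
  obtain ⟨n1, n2, n3⟩ := card3_ne h.1
  obtain ⟨m1, m2, m3⟩ := card3_ne h'.1
  rw [aff_bc h (bc Q {a, b, d} d) p, sum_tri n1 n2 n3, bc_ne h' (w := a) (by simp) m2.symm,
    bc_ne h' (w := b) (by simp) m3.symm]
  simp

lemma Cfg.unique (h : Cfg Q 𝓕) {a b c d e : ι} (hc : ({a, b, c} : Finset ι) ∈ 𝓕)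
    (hd : ({a, b, d} : Finset ι) ∈ 𝓕) (he : ({a, b, e} : Finset ι) ∈ 𝓕) (h1 : c ≠ d) (h2 : c ≠ e) : d = e := by
  by_contra hde
  have k1 := h.opp a b c e hc he h2
  have k2 := h.opp a b d c hd hc h1.symm
  have k3 := h.opp a b d e hd he hde
  rw [bc_scale (h.good _ hc) (h.good _ hd)] at k3
  nlinarith

open Classical in
/-- local multiplicity -/
noncomputable def mm (Q : ι → ℝ × ℝ) (t : Finset ι) (p : ℝ × ℝ) : ℤ :=
  (if p ∈ hull Q t then 1 else 0) + (if p ∈ interior (hull Q t) then 1 else 0)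

/-- total multiplicity -/
noncomputable def MM (Q : ι → ℝ × ℝ) (𝓕 : Finset (Finset ι)) (p : ℝ × ℝ) : ℤ := ∑ t ∈ 𝓕, mm Q t p

/-- partner triangles at a point of an open edge -/
def Par (Q : ι → ℝ × ℝ) (𝓕 : Finset (Finset ι)) (p : ℝ × ℝ) (t t' : Finset ι) : Prop :=
  ∃ a b c d, t = {a, b, c} ∧ t' = {a, b, d} ∧ t ∈ 𝓕 ∧ t' ∈ 𝓕 ∧ c ≠ d ∧ 0 < bc Q t a p ∧ 0 < bc Q t b p ∧ bc Q t c p = 0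

lemma bc_edge {a b c d : ι} (h : Good Q {a, b, c}) (h' : Good Q {a, b, d}) {p : ℝ × ℝ}
    (hp : bc Q {a, b, c} c p = 0) : bc Q {a, b, d} a p = bc Q {a, b, c} a p ∧
      bc Q {a, b, d} b p = bc Q {a, b, c} b p ∧ bc Q {a, b, d} d p = 0 := by
  obtain ⟨n1, n2, n3⟩ := card3_ne h.1
  obtain ⟨m1, m2, m3⟩ := card3_ne h'.1
  refine ⟨?_, ?_, ?_⟩
  · rw [aff_bc h (bc Q {a, b, d} a) p, sum_tri n1 n2 n3, hp, bc_self h' (by simp),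
      bc_ne h' (w := b) (by simp) m1]; simp
  · rw [aff_bc h (bc Q {a, b, d} b) p, sum_tri n1 n2 n3, hp, bc_self h' (by simp),
      bc_ne h' (w := a) (by simp) m1.symm]; simp
  · rw [bc_scale h h', hp, zero_mul]

lemma Par.symm (hC : Cfg Q 𝓕) {p : ℝ × ℝ} {t t' : Finset ι} (h : Par Q 𝓕 p t t') : Par Q 𝓕 p t' t := by
  obtain ⟨a, b, c, d, rfl, rfl, h1, h2, h3, h4, h5, h6⟩ := h
  obtain ⟨e1, e2, e3⟩ := bc_edge (hC.good _ h1) (hC.good _ h2) h6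
  exact ⟨a, b, d, c, rfl, rfl, h2, h1, h3.symm, by rw [e1]; exact h4, by rw [e2]; exact h5, e3⟩

lemma Par.ne (hC : Cfg Q 𝓕) {p : ℝ × ℝ} {t t' : Finset ι} (h : Par Q 𝓕 p t t') : t ≠ t' := by
  obtain ⟨a, b, c, d, rfl, rfl, h1, h2, h3, h4, h5, h6⟩ := h
  obtain ⟨n1, n2, n3⟩ := card3_ne (hC.good _ h1).1
  intro he
  have : c ∈ ({a, b, d} : Finset ι) := by rw [← he]; simp
  simp at this
  rcases this with h | h | h
  · exact n2 h.symm
  · exact n3 h.symm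
  · exact h3 h

lemma Par.uniq (hC : Cfg Q 𝓕) {p : ℝ × ℝ} {t t' t'' : Finset ι} (h : Par Q 𝓕 p t t') (h' : Par Q 𝓕 p t t'') : t' = t'' := by
  obtain ⟨a, b, c, d, rfl, rfl, h1, h2, h3, h4, h5, h6⟩ := h
  obtain ⟨a', b', c', d', he, rfl, h1', h2', h3', h4', h5', h6'⟩ := h'
  obtain ⟨n1, n2, n3⟩ := card3_ne (hC.good _ h1).1
  have n' := hC.good _ h1'
  rw [he] at n'
  obtain ⟨m1, m2, m3⟩ := card3_ne n'.1
  have hc' : c = c' := by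
    have : c ∈ ({a', b', c'} : Finset ι) := by rw [← he]; simp
    simp at this
    rcases this with h | h | h
    · subst h; linarith
    · subst h; linarith
    · exact h
  subst hc'
  have key : ∀ x, ({a', b', x} : Finset ι) = {a, b, x} := by
    intro x
    have e1 : ({a', b'} : Finset ι) = ({a', b', c} : Finset ι).erase c := by
      ext y; simp; constructor
      · rintro (rfl | rfl)
        · exact ⟨m2, Or.inl rfl⟩
        · exact ⟨m3, Or.inr (Or.inl rfl)⟩
      · rintro ⟨k, l | l | l⟩ <;> tauto
    have e2 : ({a, b} : Finset ι) = ({a, b, c} : Finset ι).erase c := by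
      ext y; simp; constructor
      · rintro (rfl | rfl)
        · exact ⟨n2, Or.inl rfl⟩
        · exact ⟨n3, Or.inr (Or.inl rfl)⟩
      · rintro ⟨k, l | l | l⟩ <;> tauto
    have e3 : ({a', b'} : Finset ι) = {a, b} := by rw [e1, e2, he]
    have e4 : ∀ u v : ι, ({u, v, x} : Finset ι) = insert x {u, v} := by intro u v; ext y; simp; tauto
    rw [e4, e4, e3]
  rw [key d'] at h2' ⊢
  rw [hC.unique h1 h2 h2' h3 h3']

lemma Par.mm_eq (hC : Cfg Q 𝓕) {p : ℝ × ℝ} {t t' : Finset ι} (h : Par Q 𝓕 p t t') :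
    ∀ᶠ q in 𝓝 p, mm Q t q + mm Q t' q = 2 := by
  obtain ⟨a, b, c, d, rfl, rfl, h1, h2, h3, h4, h5, h6⟩ := h
  have g1 := hC.good _ h1
  have g2 := hC.good _ h2
  obtain ⟨e1, e2, e3⟩ := bc_edge g1 g2 h6
  have ev : ∀ (t : Finset ι) (v : ι), 0 < bc Q t v p → ∀ᶠ q in 𝓝 p, 0 < bc Q t v q := fun t v hv =>
    (bc_cont v).continuousAt.eventually (lt_mem_nhds hv)
  filter_upwards [ev _ _ h4, ev _ _ h5, ev {a, b, d} a (by rw [e1]; exact h4), ev {a, b, d} b (by rw [e2]; exact h5)]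
    with q q1 q2 q3 q4
  have hs := bc_scale g1 g2 q
  have ho := hC.opp a b d c h2 h1 h3.symm
  unfold mm
  rw [mem_hull g1, mem_hull g2, mem_int g1, mem_int g2]
  simp only [mem_insert, mem_singleton, forall_eq_or_imp, forall_eq, q1, q2, q3, q4, q1.le, q2.le, q3.le, q4.le, true_and]
  rcases lt_trichotomy (bc Q {a, b, c} c q) 0 with k | k | k
  · have k' : 0 < bc Q {a, b, d} d q := by rw [hs]; nlinarith
    rw [if_neg (not_le.2 k), if_neg (not_lt.2 k.le), if_pos k'.le, if_pos k']; norm_num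
  · have k' : bc Q {a, b, d} d q = 0 := by rw [hs, k, zero_mul]
    rw [k, k']; simp
  · have k' : bc Q {a, b, d} d q < 0 := by rw [hs]; nlinarith
    rw [if_neg (not_le.2 k'), if_neg (not_lt.2 k'.le), if_pos k.le, if_pos k]; norm_num

/-- regular point for the multiplicity -/
def Reg (Q : ι → ℝ × ℝ) (𝓕 : Finset (Finset ι)) (p : ℝ × ℝ) : Prop :=
  ∀ t ∈ 𝓕, p ∈ hull Q t → p ∈ interior (hull Q t) ∨ ∃ t', Par Q 𝓕 p t t'

lemma mm_off {p : ℝ × ℝ} (h : p ∉ hull Q t) : mm Q t p = 0 := by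
  unfold mm; rw [if_neg h, if_neg (fun h2 => h (interior_subset h2))]; rfl
lemma mm_in {p : ℝ × ℝ} (h : p ∈ interior (hull Q t)) : mm Q t p = 2 := by
  unfold mm; rw [if_pos (interior_subset h), if_pos h]; rfl
lemma mm_bd {p : ℝ × ℝ} (h : p ∈ hull Q t) (h' : p ∉ interior (hull Q t)) : mm Q t p = 1 := by
  unfold mm; rw [if_pos h, if_neg h']; rfl
lemma mm_nonneg {p : ℝ × ℝ} : 0 ≤ mm Q t p := by
  unfold mm; split_ifs <;> norm_num
lemma mm_pos {p : ℝ × ℝ} (h : p ∈ hull Q t) : 1 ≤ mm Q t p := by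
  unfold mm; rw [if_pos h]; split_ifs <;> norm_num

lemma MM_local (hC : Cfg Q 𝓕) {p : ℝ × ℝ} (hp : Reg Q 𝓕 p) : ∀ᶠ q in 𝓝 p, MM Q 𝓕 q = MM Q 𝓕 p := by
  classical
  have h1 : ∀ᶠ q in 𝓝 p, ∀ t ∈ 𝓕, p ∉ hull Q t → q ∉ hull Q t := by
    rw [Filter.eventually_all_finset]
    intro t ht
    by_cases h : p ∈ hull Q t
    · exact Filter.Eventually.of_forall (fun q h2 => absurd h h2)
    · filter_upwards [hull_closed.isOpen_compl.mem_nhds h] with q hq _ using hq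
  have h2 : ∀ᶠ q in 𝓝 p, ∀ t ∈ 𝓕, p ∈ interior (hull Q t) → q ∈ interior (hull Q t) := by
    rw [Filter.eventually_all_finset]
    intro t ht
    by_cases h : p ∈ interior (hull Q t)
    · filter_upwards [isOpen_interior.mem_nhds h] with q hq _ using hq
    · exact Filter.Eventually.of_forall (fun q h2 => absurd h2 h)
  have h3 : ∀ᶠ q in 𝓝 p, ∀ t ∈ 𝓕, ∀ t' ∈ 𝓕, Par Q 𝓕 p t t' → mm Q t q + mm Q t' q = 2 := by
    rw [Filter.eventually_all_finset]
    intro t ht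
    rw [Filter.eventually_all_finset]
    intro t' ht'
    by_cases h : Par Q 𝓕 p t t'
    · filter_upwards [h.mm_eq hC] with q hq _ using hq
    · exact Filter.Eventually.of_forall (fun q h2 => absurd h2 h)
  have h3p := h3.self_of_nhds
  filter_upwards [h1, h2, h3] with q q1 q2 q3
  rw [← sub_eq_zero]
  unfold MM
  rw [← sum_sub_distrib]
  rw [← Finset.sum_filter_add_sum_filter_not 𝓕 (fun t => ∃ t', Par Q 𝓕 p t t')]
  have z2 : ∑ t ∈ 𝓕.filter (fun t => ¬ ∃ t', Par Q 𝓕 p t t'), (mm Q t q - mm Q t p) = 0 := by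
    refine sum_eq_zero (fun t ht => ?_)
    simp only [mem_filter] at ht
    by_cases h : p ∈ hull Q t
    · have h' := (hp t ht.1 h).resolve_right ht.2
      rw [mm_in h', mm_in (q2 t ht.1 h')]; rfl
    · rw [mm_off h, mm_off (q1 t ht.1 h)]; rfl
  rw [z2, add_zero]
  have hch : ∀ t ∈ 𝓕.filter (fun t => ∃ t', Par Q 𝓕 p t t'), ∃ t', Par Q 𝓕 p t t' := by
    intro t ht; simp only [mem_filter] at ht; exact ht.2
  choose! σ hσ using hch
  have hmem : ∀ t t', Par Q 𝓕 p t t' → t ∈ 𝓕 ∧ t' ∈ 𝓕 := by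
    rintro t t' ⟨a, b, c, d, h1, h2, h3, h4, _⟩; exact ⟨h3, h4⟩
  have hmem' : ∀ t (ht : t ∈ 𝓕.filter (fun t => ∃ t', Par Q 𝓕 p t t')), σ t ∈ 𝓕.filter (fun t => ∃ t', Par Q 𝓕 p t t') := by
    intro t ht
    simp only [mem_filter]
    exact ⟨(hmem _ _ (hσ t ht)).2, t, (hσ t ht).symm hC⟩
  refine Finset.sum_involution (fun t _ => σ t) ?_ ?_ ?_ ?_
  · intro t ht
    have := hmem _ _ (hσ t ht)
    have a1 := q3 t this.1 _ this.2 (hσ t ht)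
    have a2 := h3p t this.1 _ this.2 (hσ t ht)
    linarith
  · intro t ht _ he
    exact (hσ t ht).ne hC he.symm
  · exact hmem'
  · intro t ht
    exact (hσ _ (hmem' t ht)).uniq hC ((hσ t ht).symm hC)

lemma MM_const (hC : Cfg Q 𝓕) {U : Set (ℝ × ℝ)} (hU : IsPreconnected U) (hp : ∀ p ∈ U, Reg Q 𝓕 p)
    {p q : ℝ × ℝ} (h1 : p ∈ U) (h2 : q ∈ U) : MM Q 𝓕 p = MM Q 𝓕 q := by
  refine hU.constant (f := MM Q 𝓕) ?_ h1 h2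
  intro x hx
  refine ContinuousAt.continuousWithinAt ?_
  exact tendsto_nhds_of_eventually_eq (MM_local hC (hp x hx))

end cfg
end TD

namespace TD
open Topology Set Convex
section conn
variable {E : Type} [NormedAddCommGroup E] [NormedSpace ℝ E]

lemma diff_countable_preconnected (h : 1 < Module.rank ℝ E) {U s : Set E} (hU : IsOpen U) (hc : Convex ℝ U) (hs : s.Countable) :
    IsPreconnected (U \ s) := by
  have : Nontrivial E := (rank_pos_iff_nontrivial (R := ℝ)).1 (zero_lt_one.trans h)
  rcases (U \ s).eq_empty_or_nonempty with h0 | ⟨a, ha⟩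
  · rw [h0]; exact isPreconnected_empty
  suffices IsPathConnected (U \ s) from this.isConnected.isPreconnected
  refine ⟨a, ha, ?_⟩
  intro b hb
  rcases eq_or_ne a b with rfl | hab
  · exact JoinedIn.refl ha
  let c := (2 : ℝ)⁻¹ • (a + b)
  let x := (2 : ℝ)⁻¹ • (b - a)
  have Ia : c - x = a := by
    simp only [c, x]
    module
  have Ib : c + x = b := by
    simp only [c, x]
    module
  have hcU : c ∈ U := by
    have := hc ha.1 hb.1 (show (0:ℝ) ≤ 2⁻¹ by norm_num) (show (0:ℝ) ≤ 2⁻¹ by norm_num) (by norm_num)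
    simpa only [c, smul_add] using this
  have x_ne_zero : x ≠ 0 := by simpa [x] using sub_ne_zero.2 hab.symm
  obtain ⟨y, hy⟩ : ∃ y, LinearIndependent ℝ ![x, y] :=
    exists_linearIndependent_pair_of_one_lt_rank h x_ne_zero
  have A : Set.Countable {t : ℝ | ([c + x -[ℝ] c + t • y] ∩ s).Nonempty} := by
    apply countable_ofPred_nonempty_of_disjoint _ (fun t ↦ inter_subset_right) hs
    intro t t' htt'
    apply disjoint_iff_inter_eq_empty.2
    have N : {c + x} ∩ s = ∅ := by
      simpa only [singleton_inter_eq_empty, mem_compl_iff, Ib] using hb.2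
    rw [inter_assoc, inter_comm s, inter_assoc, inter_self, ← inter_assoc, ← subset_empty_iff, ← N]
    apply inter_subset_inter_left
    apply Eq.subset
    apply segment_inter_eq_endpoint_of_linearIndependent_of_ne hy htt'.symm
  have B : Set.Countable {t : ℝ | ([c - x -[ℝ] c + t • y] ∩ s).Nonempty} := by
    apply countable_ofPred_nonempty_of_disjoint _ (fun t ↦ inter_subset_right) hs
    intro t t' htt'
    apply disjoint_iff_inter_eq_empty.2
    have N : {c - x} ∩ s = ∅ := by
      simpa only [singleton_inter_eq_empty, mem_compl_iff, Ia] using ha.2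
    rw [inter_assoc, inter_comm s, inter_assoc, inter_self, ← inter_assoc, ← subset_empty_iff, ← N]
    apply inter_subset_inter_left
    rw [sub_eq_add_neg _ x]
    apply Eq.subset
    apply segment_inter_eq_endpoint_of_linearIndependent_of_ne _ htt'.symm
    convert! hy.units_smul ![-1, 1]
    simp [← List.ofFn_inj]
  have hop : IsOpen {t : ℝ | c + t • y ∈ U} := hU.preimage (by fun_prop)
  have hopn : {t : ℝ | c + t • y ∈ U}.Nonempty := ⟨0, by simpa using hcU⟩
  obtain ⟨t, htU, ht⟩ := ((A.union B).dense_compl ℝ).inter_open_nonempty _ hop hopn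
  let z := c + t • y
  simp only [compl_union, mem_inter_iff, mem_compl_iff, mem_ofPred_eq, not_nonempty_iff_eq_empty]
    at ht
  have JA : JoinedIn (U \ s) a z := by
    apply JoinedIn.of_segment_subset
    rw [subset_sdiff]
    refine ⟨hc.segment_subset ha.1 htU, ?_⟩
    rw [disjoint_iff_inter_eq_empty]
    convert! ht.2
    exact Ia.symm
  have JB : JoinedIn (U \ s) b z := by
    apply JoinedIn.of_segment_subset
    rw [subset_sdiff]
    refine ⟨hc.segment_subset hb.1 htU, ?_⟩
    rw [disjoint_iff_inter_eq_empty]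
    convert! ht.1
    exact Ib.symm
  exact JA.trans JB.symm

lemma convex_diff_preconnected (h : 1 < Module.rank ℝ E) {W : Set E} (hc : Convex ℝ W) (hi : (interior W).Nonempty) (p : E) :
    IsPreconnected (W \ {p}) := by
  have : Nontrivial E := (rank_pos_iff_nontrivial (R := ℝ)).1 (zero_lt_one.trans h)
  have h1 := diff_countable_preconnected h isOpen_interior hc.interior (countable_singleton p)
  refine h1.subset_closure (sdiff_subset_sdiff_left interior_subset) ?_
  have h2 : closure (interior W \ {p}) = closure (interior W) := by
    refine subset_antisymm (closure_mono sdiff_subset) ?_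
    have := (dense_compl_singleton p).open_subset_closure_inter (isOpen_interior (s := W))
    rw [← sdiff_eq] at this
    exact closure_minimal this isClosed_closure
  rw [h2, hc.closure_interior_eq_closure_of_nonempty_interior hi]
  exact sdiff_subset.trans subset_closure

lemma rank_plane : 1 < Module.rank ℝ (ℝ × ℝ) := by
  rw [← Module.finrank_eq_rank]; simp
lemma rank_euc : 1 < Module.rank ℝ (EuclideanSpace ℝ (Fin 2)) := by
  rw [← Module.finrank_eq_rank]; simp
end conn
end TD

namespace TD
open Finset Topology
section geo
variable {ι : Type} [Fintype ι] [DecidableEq ι] {Q P : ι → ℝ × ℝ} {t : Finset ι} {𝓕 F : Finset (Finset ι)}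

lemma third3 (h3 : t.card = 3) {a b : ι} (hab : a ≠ b) (ha : a ∈ t) (hb : b ∈ t) :
    ∃ c, c ≠ a ∧ c ≠ b ∧ t = {a, b, c} := by
  have h1 : ((t.erase a).erase b).card = 1 := by
    rw [card_erase_of_mem (by simp [hb, hab.symm]), card_erase_of_mem ha, h3]
  obtain ⟨c, hc⟩ := card_eq_one.1 h1
  have hcm : c ∈ (t.erase a).erase b := by rw [hc]; simp
  simp at hcm
  refine ⟨c, hcm.2.1, hcm.1, ?_⟩
  rw [← insert_erase ha, ← insert_erase (show b ∈ t.erase a by simp [hb, hab.symm]), hc]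

lemma third2 (h3 : t.card = 3) {a : ι} (ha : a ∈ t) : ∃ b c, a ≠ b ∧ a ≠ c ∧ b ≠ c ∧ t = {a, b, c} := by
  have h1 : (t.erase a).card = 2 := by rw [card_erase_of_mem ha, h3]
  obtain ⟨b, hb⟩ := card_pos.1 (by rw [h1]; norm_num : 0 < (t.erase a).card)
  simp at hb
  obtain ⟨c, h1, h2, h3⟩ := third3 h3 (Ne.symm hb.1) ha hb.2
  exact ⟨b, c, Ne.symm hb.1, h1.symm, h2.symm, h3⟩

lemma bc_line (v : ι) (p q : ℝ × ℝ) (s : ℝ) :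
    bc Q t v (AffineMap.lineMap p q s) = bc Q t v p + s * (bc Q t v q - bc Q t v p) := by
  rw [AffineMap.apply_lineMap, AffineMap.lineMap_apply]; simp; ring

lemma edge_case (g : Good Q t) {p : ℝ × ℝ} (hp : p ∈ hull Q t) (hni : p ∉ interior (hull Q t))
    (hv : ∀ v ∈ t, p ≠ Q v) : ∃ a b c, t = {a, b, c} ∧ 0 < bc Q t a p ∧ 0 < bc Q t b p ∧ bc Q t c p = 0 := by
  rw [mem_hull g] at hp
  rw [mem_int g] at hni
  push Not at hni
  obtain ⟨c, hc, hc0⟩ := hni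
  obtain ⟨a, b, n1, n2, n3, ht⟩ := third2 g.1 hc
  have hc1 : bc Q t c p = 0 := le_antisymm hc0 (hp c hc)
  have ha : a ∈ t := by rw [ht]; simp
  have hb : b ∈ t := by rw [ht]; simp
  have key : ∀ u w, u ∈ t → w ∈ t → c ≠ u → c ≠ w → u ≠ w → t = {c, u, w} → 0 < bc Q t u p := by
    intro u w hu hw m1 m2 m3 ht'
    rcases (hp u hu).lt_or_eq with h | h
    · exact h
    · exfalso
      apply hv w hw
      have e1 := bc_comb g p
      have e2 := bc_sum g p
      have e3 : ∀ {M : Type} [AddCommMonoid M] (f : ι → M), ∑ v ∈ t, f v = f c + (f u + f w) := by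
        intro M _ f; rw [ht']; exact sum_tri m1 m2 m3 f
      rw [e3, hc1, ← h] at e1 e2
      simp at e1 e2
      rw [← e1, e2, one_smul]
  exact ⟨a, b, c, by rw [ht]; ext x; simp; tauto, key a b ha hb n1 n2 n3 ht,
    key b a hb ha n2 n1 n3.symm (by rw [ht, tri_swap]), hc1⟩

/-- the polyhedron -/
def KK (Q : ι → ℝ × ℝ) (𝓕 : Finset (Finset ι)) : Set (ℝ × ℝ) := ⋃ t ∈ 𝓕, hull Q t

lemma mem_KK {p : ℝ × ℝ} : p ∈ KK Q 𝓕 ↔ ∃ t ∈ 𝓕, p ∈ hull Q t := by simp [KK]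

lemma KK_compact : IsCompact (KK Q 𝓕) := 𝓕.isCompact_biUnion (fun _ _ => hull_compact)

lemma MM_pos {p : ℝ × ℝ} (h : p ∈ KK Q 𝓕) : 1 ≤ MM Q 𝓕 p := by
  obtain ⟨t, ht, hp⟩ := mem_KK.1 h
  exact (mm_pos hp).trans (single_le_sum (f := fun t => mm Q t p) (fun _ _ => mm_nonneg) ht)

lemma KK_of_MM {p : ℝ × ℝ} (h : 1 ≤ MM Q 𝓕 p) : p ∈ KK Q 𝓕 := by
  by_contra hp
  have : MM Q 𝓕 p = 0 := sum_eq_zero (fun t ht => mm_off (fun hh => hp (mem_KK.2 ⟨t, ht, hh⟩)))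
  omega

lemma Reg.int (hC : Cfg Q 𝓕) {p : ℝ × ℝ} (hr : Reg Q 𝓕 p) (hp : p ∈ KK Q 𝓕) : p ∈ interior (KK Q 𝓕) := by
  rw [mem_interior_iff_mem_nhds]
  filter_upwards [MM_local hC hr] with q hq
  exact KK_of_MM (by rw [hq]; exact MM_pos hp)

/-- a vertex whose star is closed up is interior to the star -/
lemma star_cover (hC : Cfg Q 𝓕) (v : ι) (hne : 𝓕.Nonempty) (hall : ∀ t ∈ 𝓕, v ∈ t)
    (hedge : ∀ x y, ({v, x, y} : Finset ι) ∈ 𝓕 → ∃ d, d ≠ y ∧ ({v, x, d} : Finset ι) ∈ 𝓕) :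
    ∀ᶠ q in 𝓝 (Q v), q ∈ KK Q 𝓕 := by
  have h1 : ∀ᶠ q in 𝓝 (Q v), ∀ t ∈ 𝓕, 0 < bc Q t v q := by
    rw [Filter.eventually_all_finset]
    intro t ht
    refine (bc_cont v).continuousAt.eventually (lt_mem_nhds ?_)
    rw [bc_self (hC.good t ht) (hall t ht)]; norm_num
  obtain ⟨ε, hε, hb⟩ := Metric.eventually_nhds_iff_ball.1 h1
  have hreg : ∀ q ∈ Metric.ball (Q v) ε \ {Q v}, Reg Q 𝓕 q := by
    intro q hq t ht hqt
    by_cases hi : q ∈ interior (hull Q t)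
    · exact Or.inl hi
    right
    have g := hC.good t ht
    have hv0 := hb q hq.1 t ht
    obtain ⟨a, b, c, he, ha, hb', hc⟩ := edge_case g hqt hi (by
      intro u hu hqu
      by_cases huv : u = v
      · subst huv; exact hq.2 hqu
      · rw [hqu, bc_ne g hu (Ne.symm huv)] at hv0
        exact lt_irrefl _ hv0)
    have hvt := hall t ht
    rw [he] at hvt
    simp at hvt
    rcases hvt with h | h | h
    · subst h
      obtain ⟨d, hd, hdF⟩ := hedge b c (by rwa [← he])
      exact ⟨_, v, b, c, d, he, rfl, ht, hdF, hd.symm, ha, hb', hc⟩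
    · subst h
      have he' : t = {v, a, c} := by rw [he, tri_rot]
      obtain ⟨d, hd, hdF⟩ := hedge a c (by rwa [← he'])
      exact ⟨_, v, a, c, d, he', rfl, ht, hdF, hd.symm, hb', ha, hc⟩
    · subst h; linarith
  have hconn : IsPreconnected (Metric.ball (Q v) ε \ {Q v}) := by
    exact diff_countable_preconnected rank_plane Metric.isOpen_ball (convex_ball _ _) (Set.countable_singleton _)
  obtain ⟨t, ht⟩ := hne
  obtain ⟨x, y, n1, n2, n3, rfl⟩ := third2 (hC.good t ht).1 (hall t ht)
  have g := hC.good _ ht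
  -- a point of the punctured ball in KK
  have hx : ∃ q ∈ Metric.ball (Q v) ε \ {Q v}, q ∈ KK Q 𝓕 := by
    have hQ : Q v ≠ Q x := by
      intro h
      have := bc_self g (v := v) (by simp)
      rw [h, bc_ne g (by simp) n1] at this
      norm_num at this
    have hcont : Continuous (fun s : ℝ => AffineMap.lineMap (k := ℝ) (Q v) (Q x) s) := AffineMap.lineMap_continuous
    have hev : ∀ᶠ s in 𝓝[>] (0:ℝ), AffineMap.lineMap (k := ℝ) (Q v) (Q x) s ∈ Metric.ball (Q v) ε := by
      apply Filter.Eventually.filter_mono nhdsWithin_le_nhds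
      apply hcont.continuousAt.eventually_mem
      apply Metric.isOpen_ball.mem_nhds
      simpa using hε
    obtain ⟨s, hs, hs1⟩ := (hev.and (Ioo_mem_nhdsGT (show (0:ℝ) < 1 by norm_num))).exists
    refine ⟨_, ⟨hs, ?_⟩, mem_KK.2 ⟨_, ht, ?_⟩⟩
    · intro h
      have h' : AffineMap.lineMap (k := ℝ) (Q v) (Q x) s = Q v := h
      rw [AffineMap.lineMap_eq_left_iff] at h'
      rcases h' with h' | h'
      · exact hQ h'
      · exact hs1.1.ne' h'
    · have := (hull_convex (Q := Q) (t := {v, x, y})).lineMap_mem (vert_mem (v := v) (by simp)) (vert_mem (v := x) (by simp)) (t := s) ⟨hs1.1.le, hs1.2.le⟩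
      exact this
  obtain ⟨q0, hq0, hq0K⟩ := hx
  rw [Metric.eventually_nhds_iff_ball]
  refine ⟨ε, hε, fun q hq => ?_⟩
  by_cases hqv : q = Q v
  · rw [hqv]; exact mem_KK.2 ⟨_, ht, vert_mem (by simp)⟩
  · exact KK_of_MM (by rw [MM_const hC hconn hreg ⟨hq, hqv⟩ hq0]; exact MM_pos hq0K)

end geo
end TD

namespace TD
open Finset Topology
section geo
variable {ι : Type} [Fintype ι] [DecidableEq ι] {Q P : ι → ℝ × ℝ} {t : Finset ι} {𝓕 F : Finset (Finset ι)}

/-- geometric triangulated disk -/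
structure Geo (P : ι → ℝ × ℝ) (F : Finset (Finset ι)) : Prop where
  inj : Function.Injective P
  good : ∀ t ∈ F, Good P t
  glue : ∀ s ∈ F, ∀ t ∈ F, hull P s ∩ hull P t = hull P (s ∩ t)
  ne : F.Nonempty
  disk : Nonempty (KK P F ≃ₜ Metric.closedBall (0 : EuclideanSpace ℝ (Fin 2)) 1)

lemma ne3 {a b c d : ι} (h : ({a, b, c} : Finset ι).card = 3) (hcd : c ≠ d) :
    ({a, b, c} : Finset ι) ∩ {a, b, d} = {a, b} := by
  obtain ⟨n1, n2, n3⟩ := card3_ne h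
  ext x
  simp only [mem_inter, mem_insert, mem_singleton]
  constructor
  · rintro ⟨h1, h2⟩
    rcases h1 with h1 | h1 | h1
    · exact Or.inl h1
    · exact Or.inr h1
    · subst h1
      rcases h2 with h2 | h2 | h2
      · exact Or.inl h2
      · exact Or.inr h2
      · exact absurd h2 hcd
  · tauto

lemma Geo.cfg (H : Geo P F) : Cfg P F := by
  refine ⟨H.good, ?_⟩
  intro a b c d hc hd hcd
  by_contra hneg
  push Not at hneg
  have gc := H.good _ hc
  have gd := H.good _ hd
  obtain ⟨n1, n2, n3⟩ := card3_ne gc.1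
  obtain ⟨m1, m2, m3⟩ := card3_ne gd.1
  have hintr : hull P {a, b, c} ∩ hull P {a, b, d} = hull P {a, b} := by
    rw [H.glue _ hc _ hd, ne3 gc.1 hcd]
  set m := AffineMap.lineMap (k := ℝ) (P a) (P b) (1/2) with hm
  have ma : bc P {a, b, c} a m = 1/2 := by
    rw [hm, bc_line, bc_self gc (by simp), bc_ne gc (by simp) n1]; norm_num
  have mb : bc P {a, b, c} b m = 1/2 := by
    rw [hm, bc_line, bc_self gc (by simp), bc_ne gc (by simp) n1.symm]; norm_num
  have mc : bc P {a, b, c} c m = 0 := by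
    rw [hm, bc_line, bc_ne gc (by simp) n2.symm, bc_ne gc (by simp) n3.symm]; norm_num
  have md : bc P {a, b, d} d m = 0 := by
    rw [hm, bc_line, bc_ne gd (by simp) m2.symm, bc_ne gd (by simp) m3.symm]; norm_num
  have hmd : m ∈ hull P {a, b, d} := 
    hull_convex.lineMap_mem (vert_mem (by simp)) (vert_mem (by simp)) ⟨by norm_num, by norm_num⟩
  have hev : ∀ v, bc P {a, b, c} v m = 1/2 → ∀ᶠ s in 𝓝[>] (0:ℝ), 0 < bc P {a, b, c} v (AffineMap.lineMap m (P d) s) := by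
    intro v hv
    apply Filter.Eventually.filter_mono nhdsWithin_le_nhds
    have hcont : Continuous (fun s : ℝ => bc P {a, b, c} v (AffineMap.lineMap m (P d) s)) :=
      (bc_cont v).comp AffineMap.lineMap_continuous
    apply hcont.continuousAt.eventually (lt_mem_nhds ?_)
    simp only [AffineMap.lineMap_apply_zero]; rw [hv]; norm_num
  obtain ⟨s, ⟨h1, h2⟩, hs⟩ := (((hev a ma).and (hev b mb)).and (Ioo_mem_nhdsGT (show (0:ℝ) < 1 by norm_num))).exists
  have hs1 : AffineMap.lineMap m (P d) s ∈ hull P {a, b, d} :=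
    hull_convex.lineMap_mem hmd (vert_mem (by simp)) ⟨hs.1.le, hs.2.le⟩
  have hs2 : AffineMap.lineMap m (P d) s ∈ hull P {a, b, c} := by
    rw [mem_hull gc]
    simp only [mem_insert, mem_singleton, forall_eq_or_imp, forall_eq]
    refine ⟨h1.le, h2.le, ?_⟩
    rw [bc_line, mc]
    have := mul_nonneg hs.1.le hneg
    simpa using this
  have hs3 : AffineMap.lineMap m (P d) s ∈ hull P {a, b} := by rw [← hintr]; exact ⟨hs2, hs1⟩
  have hs4 := ((mem_face gd (s := {a, b}) (by intro x; simp; tauto)).1 hs3).2 d (by simp) (by simp; exact ⟨m2.symm, m3.symm⟩)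
  rw [bc_line, md, bc_self gd (by simp)] at hs4
  have := hs.1
  simp at hs4
  linarith

lemma Geo.ec_le (H : Geo P F) (a b : ι) (hab : a ≠ b) : ec F a b ≤ 2 := by
  unfold ec
  by_contra h
  push Not at h
  obtain ⟨t1, h1, t2, h2, t3, h3, n1, n2, n3⟩ := Finset.two_lt_card.1 h
  simp only [mem_filter] at h1 h2 h3
  obtain ⟨c1, _, _, rfl⟩ := third3 (H.good _ h1.1).1 hab h1.2.1 h1.2.2
  obtain ⟨c2, _, _, rfl⟩ := third3 (H.good _ h2.1).1 hab h2.2.1 h2.2.2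
  obtain ⟨c3, _, _, rfl⟩ := third3 (H.good _ h3.1).1 hab h3.2.1 h3.2.2
  have := H.cfg.unique h1.1 h2.1 h3.1 (fun h => n1 (by rw [h])) (fun h => n2 (by rw [h]))
  exact n3 (by rw [this])

lemma ec_two {a b c d : ι} (hc : ({a, b, c} : Finset ι) ∈ F) (hd : ({a, b, d} : Finset ι) ∈ F)
    (h : ({a, b, c} : Finset ι) ≠ {a, b, d}) : 2 ≤ ec F a b := by
  unfold ec
  exact Finset.one_lt_card.2 ⟨_, by simp [hc], _, by simp [hd], h⟩

lemma ec_two' {a b c : ι} (g : ∀ t ∈ F, t.card = 3) (hab : a ≠ b) (h : 2 ≤ ec F a b) : ∃ d, d ≠ c ∧ ({a, b, d} : Finset ι) ∈ F := by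
  unfold ec at h
  obtain ⟨t1, h1, t2, h2, n⟩ := Finset.one_lt_card.1 h
  simp only [mem_filter] at h1 h2
  obtain ⟨c1, _, _, rfl⟩ := third3 (g _ h1.1) hab h1.2.1 h1.2.2
  obtain ⟨c2, _, _, rfl⟩ := third3 (g _ h2.1) hab h2.2.1 h2.2.2
  by_cases h : c1 = c
  · exact ⟨c2, fun h' => n (by rw [h, h']), h2.1⟩
  · exact ⟨c1, h, h1.1⟩

lemma Geo.card3 (H : Geo P F) : ∀ t ∈ F, t.card = 3 := fun t ht => (H.good t ht).1

/-- the minimal face contains the support -/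
lemma Geo.carrier (H : Geo P F) {s t : Finset ι} (hs : s ∈ F) (ht : t ∈ F) {p : ℝ × ℝ} (ps : p ∈ hull P s)
    (pt : p ∈ hull P t) {v : ι} (hv : v ∈ s) (h : bc P s v p ≠ 0) : v ∈ t := by
  have h1 : p ∈ hull P (s ∩ t) := by rw [← H.glue s hs t ht]; exact ⟨ps, pt⟩
  by_contra hvt
  exact h (((mem_face (H.good s hs) inter_subset_left).1 h1).2 v hv (by simp [hvt]))

lemma Geo.reg_of_int (H : Geo P F) {a b c : ι} (hc : ({a, b, c} : Finset ι) ∈ F) {p : ℝ × ℝ}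
    (ha : 0 < bc P {a, b, c} a p) (hb : 0 < bc P {a, b, c} b p) (h0 : bc P {a, b, c} c p = 0) (h2 : 2 ≤ ec F a b) : Reg P F p := by
  have gc := H.good _ hc
  obtain ⟨n1, n2, n3⟩ := card3_ne gc.1
  have hp : p ∈ hull P {a, b, c} := by
    rw [mem_hull gc]; simp [ha.le, hb.le, h0]
  intro t ht hpt
  have hat := H.carrier hc ht hp hpt (v := a) (by simp) ha.ne'
  have hbt := H.carrier hc ht hp hpt (v := b) (by simp) hb.ne'
  obtain ⟨d, _, _, rfl⟩ := third3 (H.good _ ht).1 n1 hat hbt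
  obtain ⟨e, he, heF⟩ := ec_two' H.card3 (c := d) n1 h2
  obtain ⟨e1, e2, e3⟩ := bc_edge gc (H.good _ ht) h0
  exact Or.inr ⟨_, a, b, d, e, rfl, rfl, ht, heF, he.symm, by rw [e1]; exact ha, by rw [e2]; exact hb, e3⟩

lemma Geo.bd_front (H : Geo P F) {a b : ι} (h : BdE F a b) : hull P {a, b} ⊆ frontier (KK P F) := by
  obtain ⟨hab, t, ht, ha, hb⟩ := h.adj
  obtain ⟨c, hca, hcb, rfl⟩ := third3 (H.good _ ht).1 hab ha hb
  have g := H.good _ ht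
  obtain ⟨n1, n2, n3⟩ := card3_ne g.1
  -- open edge points
  have key : ∀ p, 0 < bc P {a, b, c} a p → 0 < bc P {a, b, c} b p → bc P {a, b, c} c p = 0 → p ∈ frontier (KK P F) := by
    intro p pa pb pc
    have hp : p ∈ hull P {a, b, c} := by
      rw [mem_hull g]; simp [pa.le, pb.le, pc]
    refine ⟨subset_closure (mem_KK.2 ⟨_, ht, hp⟩), ?_⟩
    intro hintr
    have h1 : ∀ᶠ q in 𝓝 p, ∀ s ∈ F, s ≠ {a, b, c} → q ∉ hull P s := by
      rw [Filter.eventually_all_finset]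
      intro s hs
      by_cases hsc : s = {a, b, c}
      · exact Filter.Eventually.of_forall (fun q h2 => absurd hsc h2)
      · have : p ∉ hull P s := by
          intro hps
          have has := H.carrier ht hs hp hps (v := a) (by simp) pa.ne'
          have hbs := H.carrier ht hs hp hps (v := b) (by simp) pb.ne'
          obtain ⟨d, _, _, rfl⟩ := third3 (H.good _ hs).1 n1 has hbs
          have := ec_two ht hs (Ne.symm hsc)
          have := h.2
          omega
        filter_upwards [hull_closed.isOpen_compl.mem_nhds this] with q hq _ using hq
    have h2 : ∀ᶠ q in 𝓝 p, q ∈ KK P F := mem_interior_iff_mem_nhds.1 hintr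
    have hcont : Continuous (fun s : ℝ => AffineMap.lineMap (k := ℝ) p (P c) s) := AffineMap.lineMap_continuous
    have hev : ∀ᶠ s in 𝓝[<] (0:ℝ), AffineMap.lineMap (k := ℝ) p (P c) s ∈ hull P {a, b, c} := by
      apply Filter.Eventually.filter_mono nhdsWithin_le_nhds
      have := hcont.tendsto 0
      simp only [AffineMap.lineMap_apply_zero] at this
      filter_upwards [this.eventually (h1.and h2)] with s hs
      obtain ⟨t', ht', hst⟩ := mem_KK.1 hs.2
      by_cases h : t' = {a, b, c}
      · rwa [h] at hst
      · exact absurd hst (hs.1 t' ht' h)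
    obtain ⟨s, hs, hs0⟩ := (hev.and self_mem_nhdsWithin).exists
    have hs0 : s < 0 := hs0
    have := (mem_hull g).1 hs c (by simp)
    rw [bc_line, pc, bc_self g (by simp)] at this
    linarith
  have hcl : IsClosed (frontier (KK P F)) := isClosed_frontier
  have hseg : hull P {a, b} = segment ℝ (P a) (P b) := by
    unfold hull; simp [Set.image_insert_eq, convexHull_pair]
  have hPab : P a ≠ P b := fun h => n1 (H.inj h)
  rw [hseg, ← closure_openSegment]
  refine closure_minimal ?_ hcl
  intro p hp
  rw [openSegment_eq_image_lineMap] at hp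
  obtain ⟨s, hs, rfl⟩ := hp
  apply key
  · rw [bc_line, bc_self g (by simp), bc_ne g (by simp) n1]; linarith [hs.2]
  · rw [bc_line, bc_self g (by simp), bc_ne g (by simp) n1.symm]; linarith [hs.1]
  · rw [bc_line, bc_ne g (by simp) n2.symm, bc_ne g (by simp) n3.symm]; norm_num

lemma Geo.vert_int (H : Geo P F) {v : ι} (hu : Used F v) (hb : ¬ Bd F v) : P v ∈ interior (KK P F) := by
  have h := star_cover (H.cfg.sub (filter_subset (fun t => v ∈ t) F)) v (by
    obtain ⟨t, ht, hv⟩ := hu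
    exact ⟨t, by simp [ht, hv]⟩) (by simp) (by
    intro x y hxy
    simp only [mem_filter] at hxy
    obtain ⟨n1, n2, n3⟩ := card3_ne (H.good _ hxy.1).1
    have h2 : 2 ≤ ec F v x := by
      have e1 := ec_pos (F := F) (a := v) (b := x) ⟨n1, _, hxy.1, by simp, by simp⟩
      by_contra h
      exact hb ⟨x, n1, by omega⟩
    obtain ⟨d, hd, hdF⟩ := ec_two' H.card3 (c := y) n1 h2
    exact ⟨d, hd, by simp [hdF]⟩)
  rw [mem_interior_iff_mem_nhds]
  filter_upwards [h] with q hq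
  obtain ⟨t, ht, hq⟩ := mem_KK.1 hq
  exact mem_KK.2 ⟨t, (mem_filter.1 ht).1, hq⟩

lemma Geo.front (H : Geo P F) {p : ℝ × ℝ} : p ∈ frontier (KK P F) ↔ ∃ a b, BdE F a b ∧ p ∈ hull P {a, b} := by
  constructor
  · intro hp
    have hpK : p ∈ KK P F := by
      have := hp.1; rwa [KK_compact.isClosed.closure_eq] at this
    obtain ⟨t, ht, hpt⟩ := mem_KK.1 hpK
    by_cases hv : ∃ v ∈ t, p = P v
    · obtain ⟨v, hvt, rfl⟩ := hv
      by_cases hb : Bd F v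
      · obtain ⟨b, hb⟩ := hb
        exact ⟨v, b, hb, vert_mem (by simp)⟩
      · exact absurd (H.vert_int ⟨t, ht, hvt⟩ hb) hp.2
    · push Not at hv
      obtain ⟨a, b, c, rfl, ha, hb, hc⟩ := edge_case (H.good t ht) hpt (by
        intro hi
        exact hp.2 (interior_mono (fun q hq => mem_KK.2 ⟨t, ht, hq⟩) hi)) hv
      obtain ⟨n1, n2, n3⟩ := card3_ne (H.good _ ht).1
      refine ⟨a, b, ⟨n1, ?_⟩, ?_⟩
      · have e1 := ec_pos (F := F) (a := a) (b := b) ⟨n1, _, ht, by simp, by simp⟩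
        by_contra h
        exact hp.2 ((H.reg_of_int ht ha hb hc (by omega)).int H.cfg hpK)
      · refine (mem_face (H.good _ ht) (by intro x; simp; tauto)).2 ⟨hpt, ?_⟩
        intro v hv hv'
        simp at hv hv'
        rcases hv with h | h | h
        · exact absurd h hv'.1
        · exact absurd h hv'.2
        · rw [h]; exact hc
  · rintro ⟨a, b, h, hp⟩
    exact H.bd_front h hp

lemma Geo.vert_front (H : Geo P F) {v : ι} (hu : Used F v) : P v ∈ frontier (KK P F) ↔ Bd F v := by
  constructor
  · intro h; by_contra hb; exact h.2 (H.vert_int hu hb)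
  · rintro ⟨b, hb⟩; exact H.bd_front hb (vert_mem (by simp))

lemma hull_pair {a b : ι} : hull P {a, b} = segment ℝ (P a) (P b) := by
  unfold hull; simp [Set.image_insert_eq, convexHull_pair]

lemma Geo.int_edge (H : Geo P F) {a b : ι} (h : IntE F a b) : openSegment ℝ (P a) (P b) ⊆ interior (KK P F) := by
  obtain ⟨hab, t, ht, ha, hb⟩ := h.adj
  obtain ⟨c, hca, hcb, rfl⟩ := third3 (H.good _ ht).1 hab ha hb
  have g := H.good _ ht
  obtain ⟨n1, n2, n3⟩ := card3_ne g.1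
  intro p hp
  have hpK : p ∈ KK P F := mem_KK.2 ⟨_, ht, hull_mono (s := {a, b}) (by intro x; simp; tauto) (by rw [hull_pair]; exact openSegment_subset_segment _ _ _ hp)⟩
  rw [openSegment_eq_image_lineMap] at hp
  obtain ⟨s, hs, rfl⟩ := hp
  refine (H.reg_of_int ht ?_ ?_ ?_ (by rw [h.2])).int H.cfg hpK
  · rw [bc_line, bc_self g (by simp), bc_ne g (by simp) n1]; linarith [hs.2]
  · rw [bc_line, bc_self g (by simp), bc_ne g (by simp) n1.symm]; linarith [hs.1]
  · rw [bc_line, bc_ne g (by simp) n2.symm, bc_ne g (by simp) n3.symm]; norm_num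

lemma Geo.bd_ex (H : Geo P F) : ∃ v, Bd F v := by
  have hne : (frontier (KK P F)).Nonempty := by
    have h1 : (KK P F).Nonempty := by
      obtain ⟨t, ht⟩ := H.ne
      obtain ⟨v, hv⟩ := card_pos.1 (by rw [(H.good t ht).1]; norm_num : 0 < t.card)
      exact ⟨P v, mem_KK.2 ⟨t, ht, vert_mem hv⟩⟩
    rw [nonempty_frontier_iff]
    exact ⟨h1, fun h => (noncompact_univ (ℝ × ℝ)) (h ▸ KK_compact)⟩
  obtain ⟨p, hp⟩ := hne
  obtain ⟨a, b, h, _⟩ := H.front.1 hp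
  exact ⟨a, b, h⟩

end geo
end TD

namespace TD
open Finset Topology
section geo
variable {ι : Type} [Fintype ι] [DecidableEq ι] {Q P : ι → ℝ × ℝ} {t : Finset ι} {𝓕 F : Finset (Finset ι)}

lemma Geo.preconn (H : Geo P F) : IsPreconnected (KK P F) := by
  obtain ⟨e⟩ := H.disk
  have h1 : PreconnectedSpace (Metric.closedBall (0 : EuclideanSpace ℝ (Fin 2)) 1) :=
    Subtype.preconnectedSpace Metric.isPreconnected_closedBall
  have h2 := (isPreconnected_univ (α := Metric.closedBall (0 : EuclideanSpace ℝ (Fin 2)) 1)).image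
    (fun z => (e.symm z : ℝ × ℝ)) (continuous_subtype_val.comp e.symm.continuous).continuousOn
  convert h2
  ext p
  constructor
  · intro hp; exact ⟨e ⟨p, hp⟩, trivial, by simp⟩
  · rintro ⟨z, -, rfl⟩; exact (e.symm z).2

lemma hull_empty : hull P ∅ = ∅ := by unfold hull; simp

lemma Geo.conn (H : Geo P F) (X : Set ι) (hx : ∃ x ∈ X, Used F x) (hX : ∀ x y, x ∈ X → Adj F x y → y ∈ X) :
    ∀ y, Used F y → y ∈ X := by
  classical
  intro y hy
  by_contra hyX
  set A := KK P (F.filter (fun t => ∃ x ∈ t, x ∈ X)) with hA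
  set B := KK P (F.filter (fun t => ¬ ∃ x ∈ t, x ∈ X)) with hB
  have hcov : KK P F ⊆ A ∪ B := by
    intro p hp
    obtain ⟨t, ht, hp⟩ := mem_KK.1 hp
    by_cases h : ∃ x ∈ t, x ∈ X
    · exact Or.inl (mem_KK.2 ⟨t, by rw [mem_filter]; exact ⟨ht, h⟩, hp⟩)
    · exact Or.inr (mem_KK.2 ⟨t, by rw [mem_filter]; exact ⟨ht, h⟩, hp⟩)
  obtain ⟨x, hxX, tx, htx, hx⟩ := hx
  obtain ⟨ty, hty, hy⟩ := hy
  have := isPreconnected_closed_iff.1 H.preconn A B KK_compact.isClosed KK_compact.isClosed hcov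
    ⟨P x, mem_KK.2 ⟨tx, htx, vert_mem hx⟩, mem_KK.2 ⟨tx, by rw [mem_filter]; exact ⟨htx, x, hx, hxX⟩, vert_mem hx⟩⟩
    ⟨P y, mem_KK.2 ⟨ty, hty, vert_mem hy⟩, mem_KK.2 ⟨ty, by
      rw [mem_filter]
      refine ⟨hty, ?_⟩
      rintro ⟨z, hz, hzX⟩
      by_cases hzy : z = y
      · exact hyX (hzy ▸ hzX)
      · exact hyX (hX z y hzX ⟨hzy, ty, hty, hz, hy⟩), vert_mem hy⟩⟩
  obtain ⟨p, -, hpA, hpB⟩ := this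
  obtain ⟨s, hs, hps⟩ := mem_KK.1 hpA
  obtain ⟨t, ht, hpt⟩ := mem_KK.1 hpB
  rw [mem_filter] at hs ht
  have hst : s ∩ t = ∅ := by
    ext z
    simp only [mem_inter, notMem_empty, iff_false]
    rintro ⟨hzs, hzt⟩
    obtain ⟨x, hxs, hxX⟩ := hs.2
    apply ht.2
    refine ⟨z, hzt, ?_⟩
    by_cases hzx : x = z
    · exact hzx ▸ hxX
    · exact hX x z hxX ⟨hzx, s, hs.1, hxs, hzs⟩
  have : p ∈ hull P (s ∩ t) := by rw [← H.glue s hs.1 t ht.1]; exact ⟨hps, hpt⟩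
  rw [hst, hull_empty] at this
  exact this

lemma Geo.link (H : Geo P F) (v : ι) (X : Set ι) (hx : ∃ x ∈ X, Adj F v x)
    (hX : ∀ x y, x ∈ X → ({v, x, y} : Finset ι) ∈ F → y ∈ X) : ∀ y, Adj F v y → y ∈ X := by
  classical
  intro y hy
  by_contra hyX
  obtain ⟨x, hxX, hvx, tx, htx, hvtx, hx⟩ := hx
  obtain ⟨hvy, ty, hty, hvty, hy⟩ := hy
  set Fx := F.filter (fun t => v ∈ t ∧ ∃ x ∈ t, x ≠ v ∧ x ∈ X) with hFx
  set Fy := F.filter (fun t => v ∈ t ∧ ¬ ∃ x ∈ t, x ≠ v ∧ x ∈ X) with hFy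
  have hX' : ∀ t ∈ F, v ∈ t → ∀ x ∈ t, x ≠ v → x ∈ X → ∀ z ∈ t, z ≠ v → z ∈ X := by
    intro t ht hvt x hxt hxv hxX z hz hzv
    obtain ⟨d, h1, h2, he⟩ := third3 (H.good t ht).1 hxv.symm hvt hxt
    rw [he] at hz
    simp at hz
    rcases hz with h | h | h
    · exact absurd h hzv
    · exact h ▸ hxX
    · rw [h]; exact hX x d hxX (he ▸ ht)
  have hAB : ∀ p, p ∈ KK P Fx → p ∈ KK P Fy → p = P v := by
    intro p hpA hpB
    obtain ⟨s, hs, hps⟩ := mem_KK.1 hpA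
    obtain ⟨t, ht, hpt⟩ := mem_KK.1 hpB
    rw [hFx, mem_filter] at hs
    rw [hFy, mem_filter] at ht
    have hst : s ∩ t = {v} := by
      ext z
      simp only [mem_inter, mem_singleton]
      constructor
      · rintro ⟨hzs, hzt⟩
        obtain ⟨x, hxs, hxv, hxX⟩ := hs.2.2
        by_contra hzv
        exact ht.2.2 ⟨z, hzt, hzv, hX' s hs.1 hs.2.1 x hxs hxv hxX z hzs hzv⟩
      · rintro rfl; exact ⟨hs.2.1, ht.2.1⟩
    have : p ∈ hull P (s ∩ t) := by rw [← H.glue s hs.1 t ht.1]; exact ⟨hps, hpt⟩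
    rw [hst] at this
    unfold hull at this
    simpa using this
  have hvK : P v ∈ KK P F := mem_KK.2 ⟨tx, htx, vert_mem hvtx⟩
  have hnear : ∀ᶠ q in 𝓝 (P v), q ∈ KK P F → q ∈ KK P Fx ∪ KK P Fy := by
    have : ∀ᶠ q in 𝓝 (P v), ∀ t ∈ F, v ∉ t → q ∉ hull P t := by
      rw [Filter.eventually_all_finset]
      intro t ht
      by_cases hvt : v ∈ t
      · exact Filter.Eventually.of_forall (fun q h2 => absurd hvt h2)
      · have : P v ∉ hull P t := by
          intro h
          exact hvt (H.carrier htx ht (vert_mem hvtx) h hvtx (by rw [bc_self (H.good _ htx) hvtx]; norm_num))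
        filter_upwards [hull_closed.isOpen_compl.mem_nhds this] with q hq _ using hq
    filter_upwards [this] with q hq hqK
    obtain ⟨t, ht, hqt⟩ := mem_KK.1 hqK
    have hvt : v ∈ t := by by_contra h; exact hq t ht h hqt
    by_cases h : ∃ x ∈ t, x ≠ v ∧ x ∈ X
    · exact Or.inl (mem_KK.2 ⟨t, by rw [hFx, mem_filter]; exact ⟨ht, hvt, h⟩, hqt⟩)
    · exact Or.inr (mem_KK.2 ⟨t, by rw [hFy, mem_filter]; exact ⟨ht, hvt, h⟩, hqt⟩)
  obtain ⟨e⟩ := H.disk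
  set c := e ⟨P v, hvK⟩ with hc
  set g : Metric.closedBall (0 : EuclideanSpace ℝ (Fin 2)) 1 → ℝ × ℝ := fun z => (e.symm z : ℝ × ℝ) with hg
  have hgc : Continuous g := continuous_subtype_val.comp e.symm.continuous
  have hgv : g c = P v := by simp [hg, hc]
  have hev : ∀ᶠ z in 𝓝 c, g z ∈ KK P F → g z ∈ KK P Fx ∪ KK P Fy := by
    have := hgc.tendsto c
    rw [hgv] at this
    exact this.eventually hnear
  obtain ⟨r, hr, hball⟩ := Metric.eventually_nhds_iff_ball.1 hev
  set W : Set (Metric.closedBall (0 : EuclideanSpace ℝ (Fin 2)) 1) := Metric.ball c r \ {c} with hW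
  have hWp : IsPreconnected W := by
    rw [← Topology.IsInducing.subtypeVal.isPreconnected_image]
    have e1 : Subtype.val '' W = (Metric.closedBall (0 : EuclideanSpace ℝ (Fin 2)) 1 ∩ Metric.ball (c : EuclideanSpace ℝ (Fin 2)) r) \ {(c : EuclideanSpace ℝ (Fin 2))} := by
      ext z
      constructor
      · rintro ⟨w, ⟨h1, h2⟩, rfl⟩
        exact ⟨⟨w.2, h1⟩, fun h => h2 (Subtype.ext h)⟩
      · rintro ⟨⟨h1, h2⟩, h3⟩
        exact ⟨⟨z, h1⟩, ⟨h2, fun h => h3 (congrArg Subtype.val h)⟩, rfl⟩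
    rw [e1]
    refine convex_diff_preconnected rank_euc ((convex_closedBall _ _).inter (convex_ball _ _)) ?_ _
    have hcb : (c : EuclideanSpace ℝ (Fin 2)) ∈ closure (Metric.ball (0 : EuclideanSpace ℝ (Fin 2)) 1) := by
      rw [closure_ball _ one_ne_zero]; exact c.2
    obtain ⟨z, hz⟩ := mem_closure_iff.1 hcb _ Metric.isOpen_ball (Metric.mem_ball_self hr)
    refine ⟨z, interior_maximal ?_ (Metric.isOpen_ball.inter Metric.isOpen_ball) hz⟩
    rintro w ⟨h1, h2⟩
    exact ⟨Metric.ball_subset_closedBall h2, h1⟩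
  have hS := hWp.image g hgc.continuousOn
  -- points of a triangle near the vertex
  have hpt : ∀ t ∈ F, v ∈ t → ∀ z ∈ t, z ≠ v → ∃ p ∈ g '' W, p ∈ hull P t := by
    intro t ht hvt z hz hzv
    have ho : IsOpen {p : KK P F | e p ∈ Metric.ball c r} := Metric.isOpen_ball.preimage e.continuous
    obtain ⟨O, hO, hOe⟩ := isOpen_induced_iff.1 ho
    have hvO : P v ∈ O := by
      have : (⟨P v, hvK⟩ : KK P F) ∈ Subtype.val ⁻¹' O := by
        rw [hOe]; exact Metric.mem_ball_self hr
      exact this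
    have hcont : Continuous (fun s : ℝ => AffineMap.lineMap (k := ℝ) (P v) (P z) s) := AffineMap.lineMap_continuous
    have hev : ∀ᶠ s in 𝓝[>] (0:ℝ), AffineMap.lineMap (k := ℝ) (P v) (P z) s ∈ O := by
      apply Filter.Eventually.filter_mono nhdsWithin_le_nhds
      apply hcont.continuousAt.eventually_mem
      apply hO.mem_nhds
      simpa using hvO
    obtain ⟨s, hs, hs1⟩ := (hev.and (Ioo_mem_nhdsGT (show (0:ℝ) < 1 by norm_num))).exists
    have hmt : AffineMap.lineMap (k := ℝ) (P v) (P z) s ∈ hull P t :=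
      hull_convex.lineMap_mem (vert_mem hvt) (vert_mem hz) ⟨hs1.1.le, hs1.2.le⟩
    set p : KK P F := ⟨_, mem_KK.2 ⟨t, ht, hmt⟩⟩ with hp
    refine ⟨p, ⟨e p, ⟨?_, ?_⟩, by simp [hg]⟩, hmt⟩
    · have : p ∈ Subtype.val ⁻¹' O := hs
      rw [hOe] at this
      exact this
    · intro h
      have h1 : p = ⟨P v, hvK⟩ := e.injective h
      have h2 : AffineMap.lineMap (k := ℝ) (P v) (P z) s = P v := congrArg Subtype.val h1
      rw [AffineMap.lineMap_eq_left_iff] at h2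
      rcases h2 with h2 | h2
      · exact hzv (H.inj h2).symm
      · exact hs1.1.ne' h2
  obtain ⟨p1, hp1, hp1t⟩ := hpt tx htx hvtx x hx hvx.symm
  obtain ⟨p2, hp2, hp2t⟩ := hpt ty hty hvty y hy hvy.symm
  have hcov : g '' W ⊆ KK P Fx ∪ KK P Fy := by
    rintro _ ⟨z, hz, rfl⟩
    exact hball z hz.1 (e.symm z).2
  obtain ⟨p, ⟨z, hz, hzp⟩, hpA, hpB⟩ := isPreconnected_closed_iff.1 hS _ _ KK_compact.isClosed KK_compact.isClosed hcov
    ⟨p1, hp1, mem_KK.2 ⟨tx, by rw [hFx, mem_filter]; exact ⟨htx, hvtx, x, hx, hvx.symm, hxX⟩, hp1t⟩⟩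
    ⟨p2, hp2, mem_KK.2 ⟨ty, by
      rw [hFy, mem_filter]
      refine ⟨hty, hvty, ?_⟩
      rintro ⟨u, hu, huv, huX⟩
      exact hyX (hX' ty hty hvty u hu huv huX y hy hvy.symm), hp2t⟩⟩
  apply hz.2
  have h1 := hAB p hpA hpB
  have h2 : e.symm z = ⟨P v, hvK⟩ := Subtype.ext (hzp.trans h1)
  show z = c
  rw [hc, ← h2]; simp

end geo
end TD

namespace TD
open Finset Topology
section geo
variable {ι : Type} [Fintype ι] [DecidableEq ι] {Q P : ι → ℝ × ℝ} {t : Finset ι} {𝓕 F : Finset (Finset ι)}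

lemma Geo.bc_glob (H : Geo P F) {s t : Finset ι} (hs : s ∈ F) (ht : t ∈ F) {p : ℝ × ℝ} (ps : p ∈ hull P s)
    (pt : p ∈ hull P t) (v : ι) : bc P s v p = bc P t v p := by
  have h0 : ∀ v, v ∉ t → bc P s v p = 0 := by
    intro v hv
    by_cases hvs : v ∈ s
    · by_contra h; exact hv (H.carrier hs ht ps pt hvs h)
    · exact bc_not hvs p
  by_cases hv : v ∈ t
  · have key : ∀ {M : Type} [AddCommGroup M] [Module ℝ M] (g : ι → M), ∑ v ∈ t, bc P s v p • g v = ∑ v ∈ s, bc P s v p • g v := by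
      intro M _ _ g
      rw [← sum_subset (inter_subset_left (s₁ := s) (s₂ := t)), ← sum_subset (inter_subset_right (s₁ := s) (s₂ := t))]
      · intro x hx hx'; rw [bc_not (fun h => hx' (mem_inter.2 ⟨h, hx⟩)), zero_smul]
      · intro x hx hx'; rw [h0 x (fun h => hx' (mem_inter.2 ⟨hx, h⟩)), zero_smul]
    have e1 := key (fun _ => (1:ℝ))
    have e2 := key P
    rw [bc_comb (H.good s hs)] at e2
    simp only [smul_eq_mul, mul_one] at e1
    rw [bc_sum (H.good s hs)] at e1
    have := bc_uniq (H.good t ht) (fun v => bc P s v p) e1 hv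
    rw [e2] at this
    exact this.symm
  · rw [h0 v hv, bc_not hv]

/-- gluing of continuous maps -/
lemma glue_cont {Y : Type} [TopologicalSpace Y] [Nonempty Y] (h : Finset ι → (ℝ × ℝ) → Y)
    (hc : ∀ t ∈ F, Continuous (h t)) (hag : ∀ s ∈ F, ∀ t ∈ F, ∀ p, p ∈ hull P s → p ∈ hull P t → h s p = h t p) :
    ∃ g : ℝ × ℝ → Y, ContinuousOn g (KK P F) ∧ ∀ t ∈ F, ∀ p ∈ hull P t, g p = h t p := by
  classical
  let g : ℝ × ℝ → Y := fun p => if hp : ∃ t ∈ F, p ∈ hull P t then h hp.choose p else Classical.arbitrary Y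
  have hg : ∀ t ∈ F, ∀ p ∈ hull P t, g p = h t p := by
    intro t ht p hp
    have hex : ∃ t ∈ F, p ∈ hull P t := ⟨t, ht, hp⟩
    simp only [g]
    rw [dif_pos hex]
    exact hag _ hex.choose_spec.1 _ ht p hex.choose_spec.2 hp
  refine ⟨g, ?_, hg⟩
  have e : KK P F = ⋃ t : F, hull P (t : Finset ι) := by
    ext p; simp [KK]
  rw [e]
  refine LocallyFinite.continuousOn_iUnion (locallyFinite_of_finite _) (fun _ => hull_closed) ?_
  intro t
  exact (hc t t.2).continuousOn.congr (fun p hp => hg t t.2 p hp)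

lemma cocycle_tri {z : ι → ι → ℤ} (hz : ∀ a b, z a b = - z b a) (h3 : t.card = 3)
    (hcoc : ∀ a b c, ({a, b, c} : Finset ι) = t → z a b + z b c + z c a = 0) {a v w : ι} (ha : a ∈ t) (hv : v ∈ t)
    (hw : w ∈ t) : z a v - z a w = z w v := by
  have h0 : ∀ a, z a a = 0 := fun a => by have := hz a a; omega
  by_cases h1 : a = v
  · subst h1; rw [h0, hz w a]; ring
  by_cases h2 : a = w
  · subst h2; rw [h0]; ring
  by_cases h4 : v = w
  · subst h4; rw [h0]; ring
  obtain ⟨c, hc1, hc2, he⟩ := third3 h3 h1 ha hv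
  have : w = c := by
    rw [he] at hw; simp at hw
    rcases hw with h | h | h
    · exact absurd h.symm h2
    · exact absurd h.symm h4
    · exact h
  subst this
  have := hcoc a v w he.symm
  have h5 := hz w a
  have h6 := hz v w
  omega

lemma Geo.cocycle (H : Geo P F) (z : ι → ι → ℤ) (hz : ∀ a b, z a b = - z b a)
    (hcoc : ∀ a b c, ({a, b, c} : Finset ι) ∈ F → z a b + z b c + z c a = 0) :
    ∃ u : ι → ℤ, ∀ a b, Adj F a b → z a b = u b - u a := by
  classical
  have htri : ∀ t ∈ F, ∀ a v w, a ∈ t → v ∈ t → w ∈ t → z a v - z a w = z w v := by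
    intro t ht a v w ha hv hw
    exact cocycle_tri hz (H.card3 t ht) (fun a b c h => hcoc a b c (h ▸ ht)) ha hv hw
  have hbase : ∀ t ∈ F, ∃ a, a ∈ t := by
    intro t ht
    exact card_pos.1 (by rw [H.card3 t ht]; norm_num : 0 < t.card)
  have hne : Nonempty ι := by
    obtain ⟨t, ht⟩ := H.ne
    exact ⟨(hbase t ht).choose⟩
  choose! β hβ using hbase
  let φ : Finset ι → ℝ × ℝ → ℝ := fun t p => ∑ v, bc P t v p * (z (β t) v : ℝ)
  have hφc : ∀ t, Continuous (φ t) := by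
    intro t
    exact continuous_finsetSum _ (fun v _ => (bc_cont v).mul continuous_const)
  have hsum : ∀ t ∈ F, ∀ p, ∑ v, bc P t v p = 1 := by
    intro t ht p
    rw [← bc_sum (H.good t ht) p]
    exact (sum_subset (subset_univ t) (fun x _ hx => bc_not hx p)).symm
  have hφv : ∀ t ∈ F, ∀ v ∈ t, φ t (P v) = z (β t) v := by
    intro t ht v hv
    simp only [φ]
    rw [sum_eq_single v]
    · rw [bc_self (H.good t ht) hv, one_mul]
    · intro w _ hw; rw [bc_ne (H.good t ht) hv hw, zero_mul]
    · simp
  have hag : ∀ s ∈ F, ∀ t ∈ F, ∀ p, p ∈ hull P s → p ∈ hull P t →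
      ((φ s p : ℝ) : AddCircle (1:ℝ)) = ((φ t p : ℝ) : AddCircle (1:ℝ)) := by
    intro s hs t ht p ps pt
    have hg := H.bc_glob hs ht ps pt
    obtain ⟨w, hws, hw⟩ : ∃ w ∈ s, bc P s w p ≠ 0 := by
      by_contra hcon
      push Not at hcon
      have := bc_sum (H.good s hs) p
      rw [sum_eq_zero hcon] at this
      norm_num at this
    have hwt := H.carrier hs ht ps pt hws hw
    have hd : φ s p = φ t p + ((z (β s) w - z (β t) w : ℤ) : ℝ) := by
      have : φ s p - φ t p = ∑ v, bc P s v p * ((z (β s) w - z (β t) w : ℤ) : ℝ) := by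
        simp only [φ]
        rw [← sum_sub_distrib]
        refine sum_congr rfl (fun v _ => ?_)
        rw [← hg v]
        by_cases hv : bc P s v p = 0
        · rw [hv]; ring
        have hvs : v ∈ s := by by_contra h; exact hv (bc_not h p)
        have hvt := H.carrier hs ht ps pt hvs hv
        have e1 := htri s hs _ v w (hβ s hs) hvs hws
        have e2 := htri t ht _ v w (hβ t ht) hvt hwt
        have e3 : z (β s) v - z (β t) v = z (β s) w - z (β t) w := by omega
        rw [← e3]; push_cast; ring
      rw [← sum_mul, hsum s hs, one_mul] at this
      linarith
    rw [hd, AddCircle.coe_add]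
    have : (((z (β s) w - z (β t) w : ℤ) : ℝ) : AddCircle (1:ℝ)) = 0 := by
      rw [AddCircle.coe_eq_zero_iff]
      exact ⟨z (β s) w - z (β t) w, by simp⟩
    rw [this, add_zero]
  obtain ⟨g, hgc, hg⟩ := glue_cont (Y := AddCircle (1:ℝ)) (F := F) (P := P) (fun t p => ((φ t p : ℝ) : AddCircle (1:ℝ)))
    (fun t _ => (AddCircle.continuous_mk' 1).comp (hφc t)) hag
  obtain ⟨e⟩ := H.disk
  let ρ : EuclideanSpace ℝ (Fin 2) → Metric.closedBall (0 : EuclideanSpace ℝ (Fin 2)) 1 := fun x =>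
    ⟨(max 1 ‖x‖)⁻¹ • x, by
      have h1 : 0 < max 1 ‖x‖ := lt_of_lt_of_le one_pos (le_max_left _ _)
      rw [mem_closedBall_zero_iff, norm_smul, norm_inv, Real.norm_of_nonneg h1.le, inv_mul_le_iff₀ h1, mul_one]
      exact le_max_right _ _⟩
  have hρ : Continuous ρ := by
    refine Continuous.subtype_mk ?_ _
    have h1 : Continuous (fun x : EuclideanSpace ℝ (Fin 2) => max 1 ‖x‖) := by fun_prop
    exact (h1.inv₀ (fun x => (lt_of_lt_of_le one_pos (le_max_left _ _)).ne')).smul continuous_id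
  have hρi : ∀ x : Metric.closedBall (0 : EuclideanSpace ℝ (Fin 2)) 1, ρ x = x := by
    intro x
    apply Subtype.ext
    have : ‖(x : EuclideanSpace ℝ (Fin 2))‖ ≤ 1 := mem_closedBall_zero_iff.1 x.2
    simp [ρ, max_eq_left this]
  let f : C(EuclideanSpace ℝ (Fin 2), AddCircle (1:ℝ)) := ⟨fun x => g (e.symm (ρ x)), by
    have := continuousOn_iff_continuous_domRestrict.1 hgc
    exact this.comp (e.symm.continuous.comp hρ)⟩
  obtain ⟨e₀, he₀⟩ := QuotientAddGroup.mk_surjective (f 0)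
  have hsc : SimplyConnectedSpace (EuclideanSpace ℝ (Fin 2)) := inferInstance
  obtain ⟨θ', ⟨-, hθ'⟩, -⟩ := (AddCircle.isCoveringMap_coe (1:ℝ)).existsUnique_continuousMap_lifts f 0 e₀ he₀
  let θ : KK P F → ℝ := fun p => θ' (e p : EuclideanSpace ℝ (Fin 2))
  have hθc : Continuous θ := θ'.continuous.comp (continuous_subtype_val.comp e.continuous)
  have hθ : ∀ p : KK P F, ((θ p : ℝ) : AddCircle (1:ℝ)) = g p := by
    intro p
    have := congrFun hθ' (e p : EuclideanSpace ℝ (Fin 2))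
    simp only [Function.comp] at this
    simp only [θ]
    rw [this]
    show g (e.symm (ρ (e p))) = g p
    rw [hρi]; simp
  have hconst : ∀ t (ht : t ∈ F), ∀ a b (ha : a ∈ t) (hb : b ∈ t),
      θ ⟨P b, mem_KK.2 ⟨t, ht, vert_mem hb⟩⟩ - θ ⟨P a, mem_KK.2 ⟨t, ht, vert_mem ha⟩⟩ = z a b := by
    intro t ht a b ha hb
    let ψ : hull P t → ℝ := fun p => θ ⟨p, mem_KK.2 ⟨t, ht, p.2⟩⟩ - φ t p
    have hψc : Continuous ψ := by
      refine Continuous.sub (hθc.comp (Continuous.subtype_mk continuous_subtype_val _)) ((hφc t).comp continuous_subtype_val)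
    have hψi : ∀ p, ∃ n : ℤ, (n : ℝ) = ψ p := by
      intro p
      have h1 := hθ ⟨p, mem_KK.2 ⟨t, ht, p.2⟩⟩
      rw [hg t ht p p.2] at h1
      have h2 : ((ψ p : ℝ) : AddCircle (1:ℝ)) = 0 := by
        simp only [ψ]; rw [AddCircle.coe_sub, h1, sub_self]
      rw [AddCircle.coe_eq_zero_iff] at h2
      obtain ⟨n, hn⟩ := h2
      exact ⟨n, by simpa using hn⟩
    choose n hn using hψi
    have hnc : Continuous n := by
      have : Continuous (fun p => ((n p : ℤ) : ℝ)) := by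
        have : (fun p => ((n p : ℤ) : ℝ)) = ψ := funext hn
        rw [this]; exact hψc
      exact Int.isClosedEmbedding_coe_real.isEmbedding.continuous_iff.2 this
    have hpc : PreconnectedSpace (hull P t) := Subtype.preconnectedSpace hull_convex.isPreconnected
    have hn2 := PreconnectedSpace.constant hpc hnc (x := ⟨P a, vert_mem ha⟩) (y := ⟨P b, vert_mem hb⟩)
    have e1 := hn ⟨P a, vert_mem ha⟩
    have e2 := hn ⟨P b, vert_mem hb⟩
    rw [hn2, e2] at e1
    simp only [ψ] at e1
    rw [hφv t ht b hb, hφv t ht a ha] at e1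
    have e3 := htri t ht _ b a (hβ t ht) hb ha
    rw [← e3]; push_cast; linarith
  refine ⟨fun v => if h : P v ∈ KK P F then ⌊θ ⟨P v, h⟩⌋ else 0, ?_⟩
  rintro a b ⟨hab, t, ht, ha, hb⟩
  have h1 : P a ∈ KK P F := mem_KK.2 ⟨t, ht, vert_mem ha⟩
  have h2 : P b ∈ KK P F := mem_KK.2 ⟨t, ht, vert_mem hb⟩
  have h3 := hconst t ht a b ha hb
  show z a b = (if h : P b ∈ KK P F then ⌊θ ⟨P b, h⟩⌋ else 0) - (if h : P a ∈ KK P F then ⌊θ ⟨P a, h⟩⌋ else 0)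
  rw [dif_pos h1, dif_pos h2]
  have h4 : θ ⟨P b, h2⟩ = θ ⟨P a, h1⟩ + (z a b : ℤ) := by linarith
  rw [h4, Int.floor_add_intCast]; ring

end geo
end TD

namespace TD
open Finset Topology
section geo
variable {ι : Type} [Fintype ι] [DecidableEq ι] {Q P : ι → ℝ × ℝ} {t : Finset ι} {𝓕 F : Finset (Finset ι)}

lemma Geo.cocycleQ (H : Geo P F) (z : ι → ι → ℚ) (hz : ∀ a b, z a b = - z b a)
    (hcoc : ∀ a b c, ({a, b, c} : Finset ι) ∈ F → z a b + z b c + z c a = 0) :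
    ∃ u : ι → ℚ, ∀ a b, Adj F a b → z a b = u b - u a := by
  set N : ℕ := ∏ p : ι × ι, (z p.1 p.2).den with hN
  have hN0 : (N : ℚ) ≠ 0 := by
    have : N ≠ 0 := by
      rw [hN]; exact Finset.prod_ne_zero_iff.2 (fun (p : ι × ι) _ => (z p.1 p.2).den_nz)
    exact_mod_cast this
  have hm : ∀ a b, ∃ m : ℤ, (m : ℚ) = z a b * N := by
    intro a b
    obtain ⟨k, hk⟩ : (z a b).den ∣ N := Finset.dvd_prod_of_mem (fun p : ι × ι => (z p.1 p.2).den) (mem_univ (a, b))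
    refine ⟨(z a b).num * k, ?_⟩
    rw [hk]; push_cast
    rw [← mul_assoc, Rat.mul_den_eq_num]
  choose m hm using hm
  obtain ⟨u, hu⟩ := H.cocycle m (by
    intro a b
    have : (m a b : ℚ) = - m b a := by rw [hm, hm, hz a b]; ring
    exact_mod_cast this) (by
    intro a b c h
    have : (m a b : ℚ) + m b c + m c a = 0 := by
      rw [hm, hm, hm, ← add_mul, ← add_mul, hcoc a b c h, zero_mul]
    exact_mod_cast this)
  refine ⟨fun v => u v / N, fun a b hab => ?_⟩
  have h1 : (m a b : ℚ) = u b - u a := by exact_mod_cast hu a b hab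
  rw [hm] at h1
  field_simp
  linarith

lemma Geo.euler (H : Geo P F) : (apairs F).card + 2 ≤ 2 * ((verts F).card + F.card) := by
  classical
  let ord : ι → ℕ := fun i => (Fintype.equivFin ι i : ℕ)
  have hord : Function.Injective ord := fun a b h => (Fintype.equivFin ι).injective (Fin.ext h)
  set Ep := (apairs F).filter (fun p => ord p.1 < ord p.2) with hEp
  have hap : ∀ p : ι × ι, p ∈ apairs F ↔ Adj F p.1 p.2 := by intro p; simp [apairs]
  have hEm : ∀ a b, (a, b) ∈ Ep ↔ Adj F a b ∧ ord a < ord b := by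
    intro a b; rw [hEp, mem_filter, hap]
  have hcard : (apairs F).card = 2 * Ep.card := by
    have h1 := Finset.card_filter_add_card_filter_not (s := apairs F) (fun p : ι × ι => ord p.1 < ord p.2)
    have h2 : ((apairs F).filter (fun p => ¬ ord p.1 < ord p.2)).card = Ep.card := by
      refine Finset.card_bij' (fun p _ => p.swap) (fun p _ => p.swap) ?_ ?_ (by simp) (by simp)
      · rintro ⟨a, b⟩ h
        rw [mem_filter, hap] at h
        show (b, a) ∈ Ep
        rw [hEm]
        refine ⟨h.1.symm, lt_of_le_of_ne (not_lt.1 h.2) (fun he => h.1.1 (hord he).symm)⟩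
      · rintro ⟨a, b⟩ h
        rw [hEm] at h
        rw [mem_filter, hap]
        exact ⟨h.1.symm, not_lt.2 h.2.le⟩
    have h3 : Ep.card + ((apairs F).filter (fun p => ¬ ord p.1 < ord p.2)).card = (apairs F).card := by
      rw [hEp]; convert h1 using 2
    omega
  let zL : ι → ι → ((Ep → ℚ) →ₗ[ℚ] ℚ) := fun a b =>
    (if h : (a, b) ∈ Ep then LinearMap.proj ⟨(a, b), h⟩ else 0) - (if h : (b, a) ∈ Ep then LinearMap.proj ⟨(b, a), h⟩ else 0)
  have hzs : ∀ z a b, zL a b z = - zL b a z := by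
    intro z a b; simp only [zL, LinearMap.sub_apply]; ring
  have htr : ∀ t : F, ∃ a b c, (t : Finset ι) = {a, b, c} := by
    intro t
    obtain ⟨a, b, c, _, _, _, h⟩ := card_eq_three.1 (H.card3 t t.2)
    exact ⟨a, b, c, h⟩
  choose A B C hABC using htr
  let δ1 : (Ep → ℚ) →ₗ[ℚ] (F → ℚ) := LinearMap.pi (fun t => zL (A t) (B t) + zL (B t) (C t) + zL (C t) (A t))
  let uL : ι → (((verts F) → ℚ) →ₗ[ℚ] ℚ) := fun v => if h : v ∈ verts F then LinearMap.proj ⟨v, h⟩ else 0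
  let δ0 : ((verts F) → ℚ) →ₗ[ℚ] (Ep → ℚ) := LinearMap.pi (fun p => uL p.1.2 - uL p.1.1)
  have hker : LinearMap.ker δ1 ≤ LinearMap.range δ0 := by
    intro z hz
    rw [LinearMap.mem_ker] at hz
    obtain ⟨u, hu⟩ := H.cocycleQ (fun a b => zL a b z) (hzs z) (by
      intro a b c h
      have h0 : zL (A ⟨_, h⟩) (B ⟨_, h⟩) z + zL (B ⟨_, h⟩) (C ⟨_, h⟩) z + zL (C ⟨_, h⟩) (A ⟨_, h⟩) z = 0 :=
        congrFun hz ⟨_, h⟩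
      have h1 := hABC ⟨_, h⟩
      simp only at h1
      generalize A ⟨_, h⟩ = A' at *
      generalize B ⟨_, h⟩ = B' at *
      generalize C ⟨_, h⟩ = C' at *
      have ha : a ∈ ({A', B', C'} : Finset ι) := by rw [← h1]; simp
      have hb : b ∈ ({A', B', C'} : Finset ι) := by rw [← h1]; simp
      have hc : c ∈ ({A', B', C'} : Finset ι) := by rw [← h1]; simp
      simp only [mem_insert, mem_singleton] at ha hb hc
      have k1 := hzs z A' B'
      have k2 := hzs z B' C'
      have k3 := hzs z C' A'
      have k4 := hzs z A' A'
      have k5 := hzs z B' B'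
      have k6 := hzs z C' C'
      rcases ha with rfl | rfl | rfl <;> rcases hb with rfl | rfl | rfl <;> rcases hc with rfl | rfl | rfl <;> linarith)
    refine ⟨fun v => u v, ?_⟩
    funext p
    obtain ⟨⟨a, b⟩, hp⟩ := p
    have hp' := (hEm a b).1 hp
    have hn : (b, a) ∉ Ep := by
      rw [hEm]; rintro ⟨_, h⟩; exact absurd h (not_lt.2 hp'.2.le)
    have h2 := hu a b hp'.1
    have ha : a ∈ verts F := by simp [verts, hp'.1.used]
    have hb : b ∈ verts F := by simp [verts, hp'.1.symm.used]
    simp only [zL, dif_pos hp, dif_neg hn, LinearMap.sub_apply, LinearMap.proj_apply, LinearMap.zero_apply, sub_zero] at h2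
    simp only [δ0, LinearMap.pi_apply, LinearMap.sub_apply, uL, dif_pos ha, dif_pos hb, LinearMap.proj_apply]
    exact h2.symm
  have e1 := LinearMap.finrank_range_add_finrank_ker δ1
  have e2 := LinearMap.finrank_range_add_finrank_ker δ0
  have e3 : Module.finrank ℚ (LinearMap.range δ1) ≤ F.card := by
    refine (Submodule.finrank_le _).trans ?_
    simp
  have e4 := Submodule.finrank_mono hker
  have e5 : 1 ≤ Module.finrank ℚ (LinearMap.ker δ0) := by
    have hmem : (fun _ => 1 : verts F → ℚ) ∈ LinearMap.ker δ0 := by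
      rw [LinearMap.mem_ker]
      funext p
      obtain ⟨⟨a, b⟩, hp⟩ := p
      have hp' := (hEm a b).1 hp
      have ha : a ∈ verts F := by simp [verts, hp'.1.used]
      have hb : b ∈ verts F := by simp [verts, hp'.1.symm.used]
      simp only [δ0, LinearMap.pi_apply, LinearMap.sub_apply, uL, dif_pos ha, dif_pos hb, LinearMap.proj_apply]
      simp
    have : Nontrivial (LinearMap.ker δ0) := by
      refine ⟨⟨⟨_, hmem⟩, 0, ?_⟩⟩
      intro h
      have h' := congrArg Subtype.val h
      obtain ⟨v, b, hv⟩ := H.bd_ex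
      have hvv : v ∈ verts F := by simp [verts, hv.adj.used]
      have := congrFun h' ⟨v, hvv⟩
      simp at this
    exact Module.finrank_pos
  simp only [Module.finrank_fintype_fun_eq_card, Fintype.card_coe] at e1 e2
  omega

lemma Geo.toDisk (H : Geo P F) : Disk F :=
  ⟨H.card3, H.ec_le, H.link, H.conn, H.euler, H.bd_ex⟩

end geo
end TD

namespace TD
open Finset Topology
section cvx
variable {ι : Type} [Fintype ι] [DecidableEq ι] {Q P : ι → ℝ × ℝ} {t : Finset ι} {𝓕 F : Finset (Finset ι)}

/-- linear functional with given coefficients -/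
def lf (α β : ℝ) (p : ℝ × ℝ) : ℝ := α * p.1 + β * p.2

lemma lf_cont (α β : ℝ) : Continuous (lf α β) := by unfold lf; fun_prop

lemma lf_line (α β : ℝ) (p q : ℝ × ℝ) (s : ℝ) :
    lf α β (AffineMap.lineMap p q s) = lf α β p + s * (lf α β q - lf α β p) := by
  simp [lf, AffineMap.lineMap_apply]; ring

lemma lf_sum {s : Finset ι} (α β : ℝ) (w : ι → ℝ) (G : ι → ℝ × ℝ) :
    lf α β (∑ v ∈ s, w v • G v) = ∑ v ∈ s, w v * lf α β (G v) := by
  simp only [lf, Prod.fst_sum, Prod.snd_sum, mul_sum, ← sum_add_distrib]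
  exact sum_congr rfl (fun v _ => by simp; ring)

/-- boundary map data -/
structure Emb (P : ι → ℝ × ℝ) (F : Finset (Finset ι)) (f : ℝ × ℝ → ℝ × ℝ) (C : Set (ℝ × ℝ)) : Prop where
  geo : Geo P F
  aff : ∀ a b, BdE F a b → ∃ g : (ℝ × ℝ) →ᵃ[ℝ] (ℝ × ℝ), Set.EqOn f g (segment ℝ (P a) (P b))
  inj : Set.InjOn f (frontier (KK P F))
  conv : Convex ℝ C
  comp : IsCompact C
  int : (interior C).Nonempty
  img : f '' frontier (KK P F) = frontier C
  noobs : ∀ a b, IntE F a b → Bd F a → Bd F b → ∀ x ∈ frontier (KK P F) \ {P a, P b},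
    ¬ Collinear ℝ (f '' closure (connectedComponentIn (frontier (KK P F) \ {P a, P b}) x))

variable {f : ℝ × ℝ → ℝ × ℝ} {C : Set (ℝ × ℝ)}

lemma Emb.line (H : Emb P F f C) {a b : ι} (h : BdE F a b) {s : ℝ} (h0 : 0 ≤ s) (h1 : s ≤ 1) :
    f (AffineMap.lineMap (P a) (P b) s) = AffineMap.lineMap (f (P a)) (f (P b)) s := by
  obtain ⟨g, hg⟩ := H.aff a b h
  rw [hg (by rw [segment_eq_image_lineMap]; exact ⟨s, ⟨h0, h1⟩, rfl⟩), hg (left_mem_segment _ _ _),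
    hg (right_mem_segment _ _ _), AffineMap.apply_lineMap]

lemma Emb.seg_front (H : Emb P F f C) {a b : ι} (h : BdE F a b) {s : ℝ} (h0 : 0 ≤ s) (h1 : s ≤ 1) :
    AffineMap.lineMap (P a) (P b) s ∈ frontier (KK P F) := by
  refine H.geo.bd_front h ?_
  rw [hull_pair, segment_eq_image_lineMap]; exact ⟨s, ⟨h0, h1⟩, rfl⟩

lemma Emb.vfront (H : Emb P F f C) {a : ι} (h : Bd F a) : P a ∈ frontier (KK P F) :=
  (H.geo.vert_front h.used).2 h

lemma Emb.fseg (H : Emb P F f C) {a b : ι} (h : BdE F a b) {s : ℝ} (h0 : 0 ≤ s) (h1 : s ≤ 1) :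
    AffineMap.lineMap (f (P a)) (f (P b)) s ∈ frontier C := by
  rw [← H.line h h0 h1, ← H.img]; exact ⟨_, H.seg_front h h0 h1, rfl⟩

lemma Emb.vfrontC (H : Emb P F f C) {a : ι} (h : Bd F a) : f (P a) ∈ frontier C := by
  rw [← H.img]; exact ⟨_, H.vfront h, rfl⟩

lemma Emb.frC (H : Emb P F f C) : frontier C ⊆ C := H.comp.isClosed.frontier_subset

lemma Emb.vinj (H : Emb P F f C) {a b : ι} (ha : Bd F a) (hb : Bd F b) (h : f (P a) = f (P b)) : a = b :=
  H.geo.inj (H.inj (H.vfront ha) (H.vfront hb) h)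

/-- supporting functional at a non-interior point -/
lemma supp (hc : Convex ℝ C) (hi : (interior C).Nonempty) {x : ℝ × ℝ} (hx : x ∉ interior C) :
    ∃ α β, (α ≠ 0 ∨ β ≠ 0) ∧ ∀ p ∈ C, lf α β p ≤ lf α β x := by
  obtain ⟨L, hL⟩ := geometric_hahn_banach_open_point hc.interior isOpen_interior hx
  have hLp : ∀ p : ℝ × ℝ, L p = lf (L (1, 0)) (L (0, 1)) p := by
    intro p
    have : p = p.1 • ((1 : ℝ), (0 : ℝ)) + p.2 • ((0 : ℝ), (1 : ℝ)) := by ext <;> simp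
    conv_lhs => rw [this]
    rw [map_add, map_smul, map_smul]; simp [lf]; ring
  refine ⟨L (1, 0), L (0, 1), ?_, ?_⟩
  · by_contra h
    push Not at h
    obtain ⟨o, ho⟩ := hi
    have := hL o ho
    rw [hLp, hLp x, h.1, h.2] at this
    simp [lf] at this
  · intro p hp
    have h1 : p ∈ closure (interior C) := by
      rw [hc.closure_interior_eq_closure_of_nonempty_interior hi]; exact subset_closure hp
    have h2 : closure (interior C) ⊆ {p | lf (L (1, 0)) (L (0, 1)) p ≤ lf (L (1, 0)) (L (0, 1)) x} := by
      refine closure_minimal (fun y hy => ?_) (isClosed_le (lf_cont _ _) continuous_const)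
      have := hL y hy
      rw [hLp, hLp x] at this
      exact this.le
    exact h2 h1

lemma not_int_of_max {α β : ℝ} (h : α ≠ 0 ∨ β ≠ 0) {p : ℝ × ℝ} (hm : ∀ q ∈ C, lf α β q ≤ lf α β p) : p ∉ interior C := by
  intro hp
  have h1 : ∀ᶠ s : ℝ in 𝓝 0, p + s • (α, β) ∈ C := by
    have hc : Continuous (fun s : ℝ => p + s • ((α, β) : ℝ × ℝ)) := by fun_prop
    have := hc.continuousAt (x := 0)
    unfold ContinuousAt at this
    simp only [zero_smul, add_zero] at this
    exact this.eventually (mem_interior_iff_mem_nhds.1 hp)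
  have h2 : ∀ᶠ s : ℝ in 𝓝[>] 0, p + s • (α, β) ∈ C ∧ 0 < s := 
    (h1.filter_mono nhdsWithin_le_nhds).and self_mem_nhdsWithin
  obtain ⟨s, hs, hs0⟩ := h2.exists
  have := hm _ hs
  have h3 : 0 < α ^ 2 + β ^ 2 := by
    rcases h with h | h <;> positivity
  simp [lf] at this
  nlinarith

lemma lf_pos_sq {α β : ℝ} (h : α ≠ 0 ∨ β ≠ 0) : 0 < α ^ 2 + β ^ 2 := by
  rcases h with h | h <;> positivity

/-- maxima over the vertices are maxima over the convex set -/
lemma Emb.ext_bd (H : Emb P F f C) {α β M : ℝ} (h : α ≠ 0 ∨ β ≠ 0) (hM : ∀ v, Bd F v → lf α β (f (P v)) ≤ M) :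
    ∀ p ∈ C, lf α β p ≤ M := by
  intro p hp
  obtain ⟨m, hm, hmax⟩ := H.comp.exists_isMaxOn ⟨p, hp⟩ (lf_cont α β).continuousOn
  have hmax' : ∀ q ∈ C, lf α β q ≤ lf α β m := fun q hq => hmax hq
  have h1 := not_int_of_max h hmax'
  have h2 : m ∈ frontier C := by rw [H.comp.isClosed.frontier_eq]; exact ⟨hm, h1⟩
  rw [← H.img] at h2
  obtain ⟨x, hx, rfl⟩ := h2
  obtain ⟨a, b, hab, hx⟩ := H.geo.front.1 hx
  rw [hull_pair, segment_eq_image_lineMap] at hx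
  obtain ⟨s, ⟨h0, h3⟩, rfl⟩ := hx
  have := hmax' p hp
  rw [H.line hab h0 h3, lf_line] at this
  have ha := hM a ⟨b, hab⟩
  have hb := hM b ⟨a, hab.symm⟩
  nlinarith

/-- there are vertices off the maximal level -/
lemma Emb.ex_lt (H : Emb P F f C) {α β M : ℝ} (h : α ≠ 0 ∨ β ≠ 0) (hM : ∀ v, Bd F v → lf α β (f (P v)) ≤ M) :
    ∃ v, Bd F v ∧ lf α β (f (P v)) < M := by
  by_contra hcon
  push Not at hcon
  have h1 : ∀ p ∈ C, lf α β p ≤ M := H.ext_bd h hM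
  have h2 : ∀ p ∈ C, lf (-α) (-β) p ≤ -M := H.ext_bd (by simpa using h) (fun v hv => by
    have := hcon v hv; simp [lf] at this ⊢; linarith)
  obtain ⟨o, ho⟩ := H.int
  refine not_int_of_max h (fun q hq => ?_) ho
  have := h1 q hq
  have := h2 o (interior_subset ho)
  simp [lf] at *; linarith

/-- each edge image supports C -/
lemma Emb.side (H : Emb P F f C) {a b : ι} (h : BdE F a b) {p q : ℝ × ℝ} (hp : p ∈ C) (hq : q ∈ C) :
    0 ≤ det3 (f (P a)) (f (P b)) p * det3 (f (P a)) (f (P b)) q := by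
  have hm := H.fseg h (s := 1/2) (by norm_num) (by norm_num)
  obtain ⟨α, β, hn, hs⟩ := supp H.conv H.int hm.2
  have ha := hs _ (H.frC (H.vfrontC ⟨b, h⟩))
  have hb := hs _ (H.frC (H.vfrontC ⟨a, h.symm⟩))
  have hp := hs p hp
  have hq := hs q hq
  rw [lf_line] at ha hb hp hq
  generalize f (P a) = A at *
  generalize f (P b) = B at *
  have e : lf α β B = lf α β A := by linarith
  rw [e] at hp hq
  have hps : 0 < α ^ 2 + β ^ 2 := lf_pos_sq hn
  have e2 : (α ^ 2 + β ^ 2) * (det3 A B p * det3 A B q) =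
      ((B.1 - A.1)^2 + (B.2 - A.2)^2) * ((lf α β p - lf α β A) * (lf α β q - lf α β A)) := by
    unfold lf at *
    unfold det3
    have e' : α * (B.1 - A.1) = - β * (B.2 - A.2) := by linarith
    generalize B.1 - A.1 = d1 at *
    generalize B.2 - A.2 = d2 at *
    have k1 : α * p.1 + β * p.2 - (α * A.1 + β * A.2) = α * (p.1 - A.1) + β * (p.2 - A.2) := by ring
    have k2 : α * q.1 + β * q.2 - (α * A.1 + β * A.2) = α * (q.1 - A.1) + β * (q.2 - A.2) := by ring
    rw [k1, k2]
    generalize p.1 - A.1 = x1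
    generalize p.2 - A.2 = x2
    generalize q.1 - A.1 = y1
    generalize q.2 - A.2 = y2
    have m1 : α * (d1 * x2 - d2 * x1) = - d2 * (α * x1 + β * x2) := by linear_combination x2 * e'
    have m2 : β * (d1 * x2 - d2 * x1) = d1 * (α * x1 + β * x2) := by linear_combination (-x1) * e'
    have n1 : α * (d1 * y2 - d2 * y1) = - d2 * (α * y1 + β * y2) := by linear_combination y2 * e'
    have n2 : β * (d1 * y2 - d2 * y1) = d1 * (α * y1 + β * y2) := by linear_combination (-y1) * e'
    calc _ = (α * (d1 * x2 - d2 * x1)) * (α * (d1 * y2 - d2 * y1)) + (β * (d1 * x2 - d2 * x1)) * (β * (d1 * y2 - d2 * y1)) := by ring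
      _ = _ := by rw [m1, m2, n1, n2]; ring
  have h3 : 0 ≤ (lf α β p - lf α β A) * (lf α β q - lf α β A) := mul_nonneg_of_nonpos_of_nonpos (by linarith) (by linarith)
  have h4 : 0 ≤ (α ^ 2 + β ^ 2) * (det3 A B p * det3 A B q) := by rw [e2]; positivity
  exact nonneg_of_mul_nonneg_right h4 hps

/-- a boundary edge is never at a nonextreme level -/
lemma Emb.nb (H : Emb P F f C) {α β : ℝ} {a b : ι} (h : BdE F a b) {p q : ℝ × ℝ} (hp : p ∈ C) (hq : q ∈ C)
    (hlo : lf α β p < lf α β (f (P a))) (hhi : lf α β (f (P a)) < lf α β q) : lf α β (f (P b)) ≠ lf α β (f (P a)) := by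
  intro e
  have hs := H.side h hp hq
  have hne : f (P a) ≠ f (P b) := fun he => h.1 (H.vinj ⟨b, h⟩ ⟨a, h.symm⟩ he)
  generalize f (P a) = A at *
  generalize f (P b) = B at *
  have e2 : (α ^ 2 + β ^ 2) * (det3 A B p * det3 A B q) =
      ((B.1 - A.1)^2 + (B.2 - A.2)^2) * ((lf α β p - lf α β A) * (lf α β q - lf α β A)) := by
    clear hs hlo hhi
    unfold lf at *
    unfold det3
    have e' : α * (B.1 - A.1) = - β * (B.2 - A.2) := by linarith
    generalize B.1 - A.1 = d1 at *
    generalize B.2 - A.2 = d2 at *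
    have k1 : α * p.1 + β * p.2 - (α * A.1 + β * A.2) = α * (p.1 - A.1) + β * (p.2 - A.2) := by ring
    have k2 : α * q.1 + β * q.2 - (α * A.1 + β * A.2) = α * (q.1 - A.1) + β * (q.2 - A.2) := by ring
    rw [k1, k2]
    generalize p.1 - A.1 = x1
    generalize p.2 - A.2 = x2
    generalize q.1 - A.1 = y1
    generalize q.2 - A.2 = y2
    have m1 : α * (d1 * x2 - d2 * x1) = - d2 * (α * x1 + β * x2) := by linear_combination x2 * e'
    have m2 : β * (d1 * x2 - d2 * x1) = d1 * (α * x1 + β * x2) := by linear_combination (-x1) * e'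
    have n1 : α * (d1 * y2 - d2 * y1) = - d2 * (α * y1 + β * y2) := by linear_combination y2 * e'
    have n2 : β * (d1 * y2 - d2 * y1) = d1 * (α * y1 + β * y2) := by linear_combination (-y1) * e'
    calc _ = (α * (d1 * x2 - d2 * x1)) * (α * (d1 * y2 - d2 * y1)) + (β * (d1 * x2 - d2 * x1)) * (β * (d1 * y2 - d2 * y1)) := by ring
      _ = _ := by rw [m1, m2, n1, n2]; ring
  have hn : α ≠ 0 ∨ β ≠ 0 := by
    by_contra hcon
    push Not at hcon
    rw [hcon.1, hcon.2] at hlo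
    simp [lf] at hlo
  have h1 := lf_pos_sq hn
  have h2 : 0 < (B.1 - A.1)^2 + (B.2 - A.2)^2 := by
    refine lf_pos_sq ?_
    by_contra hcon
    push Not at hcon
    exact hne (Prod.ext (by linarith [hcon.1]) (by linarith [hcon.2]))
  have h3 : (lf α β p - lf α β A) * (lf α β q - lf α β A) < 0 := mul_neg_of_neg_of_pos (by linarith) (by linarith)
  nlinarith [mul_nonneg h1.le hs]

end cvx
end TD

namespace TD
open Finset Topology
section cvx
variable {ι : Type} [Fintype ι] [DecidableEq ι] {Q P : ι → ℝ × ℝ} {t : Finset ι} {𝓕 F : Finset (Finset ι)}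
variable {f : ℝ × ℝ → ℝ × ℝ} {C : Set (ℝ × ℝ)}

/-- two boundary edges at a vertex do not point in the same direction -/
lemma Emb.not_same (H : Emb P F f C) {v a b : ι} (ha : BdE F v a) (hb : BdE F v b) (hab : a ≠ b) {k : ℝ} (hk : 0 < k)
    (h : f (P b) - f (P v) = k • (f (P a) - f (P v))) : False := by
  set m := 1 + k
  have hm : 0 < m := by positivity
  have s0 : 0 ≤ k / m := by positivity
  have s1 : k / m ≤ 1 := by rw [div_le_one hm]; simp [m]
  have t0 : 0 ≤ 1 / m := by positivity
  have t1 : 1 / m ≤ 1 := by rw [div_le_one hm]; simp [m]; exact hk.le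
  have e : AffineMap.lineMap (f (P v)) (f (P a)) (k / m) = AffineMap.lineMap (f (P v)) (f (P b)) (1 / m) := by
    rw [AffineMap.lineMap_apply, AffineMap.lineMap_apply, vsub_eq_sub, vsub_eq_sub, h, smul_smul]
    congr 2
    field_simp
  rw [← H.line ha s0 s1, ← H.line hb t0 t1] at e
  have e2 := H.inj (H.seg_front ha s0 s1) (H.seg_front hb t0 t1) e
  obtain ⟨_, t, ht, hv, ha'⟩ := ha.adj
  obtain ⟨_, t', ht', hv', hb'⟩ := hb.adj
  have g := H.geo.good t ht
  have g' := H.geo.good t' ht'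
  have p1 : AffineMap.lineMap (P v) (P a) (k / m) ∈ hull P t :=
    hull_convex.lineMap_mem (vert_mem hv) (vert_mem ha') ⟨s0, s1⟩
  have p2 : AffineMap.lineMap (P v) (P b) (1 / m) ∈ hull P t' :=
    hull_convex.lineMap_mem (vert_mem hv') (vert_mem hb') ⟨t0, t1⟩
  have k1 := H.geo.bc_glob ht ht' p1 (by rw [e2]; exact p2) a
  rw [bc_line, e2, bc_line, bc_self g ha', bc_ne g hv ha.1.symm, bc_ne g' hv' ha.1.symm, bc_ne g' hb' hab] at k1
  have : 0 < k / m := by positivity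
  linarith

/-- lexicographic negativity of a direction -/
def Ln (α β : ℝ) (d : ℝ × ℝ) : Prop := lf α β d < 0 ∨ (lf α β d = 0 ∧ lf (-β) α d < 0)

lemma Ln_zero {α β : ℝ} (h : α ≠ 0 ∨ β ≠ 0) {d : ℝ × ℝ} (h1 : lf α β d = 0) (h2 : lf (-β) α d = 0) : d = 0 := by
  have hp := lf_pos_sq h
  unfold lf at h1 h2
  have e1 : (α ^ 2 + β ^ 2) * d.1 = 0 := by linear_combination α * h1 - β * h2
  have e2 : (α ^ 2 + β ^ 2) * d.2 = 0 := by linear_combination β * h1 + α * h2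
  rw [mul_eq_zero] at e1 e2
  exact Prod.ext (e1.resolve_left hp.ne') (e2.resolve_left hp.ne')

lemma Emb.cone (H : Emb P F f C) {α β : ℝ} {v a b : ι} (ha : BdE F v a) (hb : BdE F v b)
    (hab : a ≠ b) (h1 : Ln α β (f (P a) - f (P v))) (h2 : Ln α β (f (P b) - f (P v))) {w : ℝ × ℝ} (hw : w ∈ C) :
    ¬ Ln α β (f (P v) - w) := by
  have k1 := H.side ha hw (H.frC (H.vfrontC ⟨v, hb.symm⟩))
  have k2 := H.side hb hw (H.frC (H.vfrontC ⟨v, ha.symm⟩))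
  have hns := fun k hk => H.not_same ha hb hab (k := k) hk
  have hne : f (P v) ≠ f (P a) := fun he => ha.1 (H.vinj ⟨a, ha⟩ ⟨v, ha.symm⟩ he)
  generalize f (P v) = V at *
  generalize f (P a) = A at *
  generalize f (P b) = B at *
  have ew : V - w = - (w - V) := by abel
  rw [ew]
  have d1 : det3 V A w = (A - V).1 * (w - V).2 - (A - V).2 * (w - V).1 := by simp [det3]
  have d2 : det3 V B w = (B - V).1 * (w - V).2 - (B - V).2 * (w - V).1 := by simp [det3]
  have d3 : det3 V A B = (A - V).1 * (B - V).2 - (A - V).2 * (B - V).1 := by simp [det3]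
  have d4 : det3 V B A = (B - V).1 * (A - V).2 - (B - V).2 * (A - V).1 := by simp [det3]
  rw [d1, d3] at k1
  rw [d2, d4] at k2
  have hA0 : A - V ≠ 0 := sub_ne_zero.2 hne.symm
  generalize A - V = x at *
  generalize B - V = y at *
  generalize w - V = z at *
  clear d1 d2 d3 d4 ew
  by_cases hD : x.1 * y.2 - x.2 * y.1 = 0
  · exfalso
    have hxp : 0 < x.1 ^ 2 + x.2 ^ 2 := by
      refine lf_pos_sq ?_
      by_contra hcon
      push Not at hcon
      exact hA0 (Prod.ext hcon.1 hcon.2)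
    obtain ⟨k, hk⟩ : ∃ k : ℝ, y = k • x := by
      refine ⟨(x.1 * y.1 + x.2 * y.2) / (x.1 ^ 2 + x.2 ^ 2), Prod.ext ?_ ?_⟩
      · simp; field_simp; linear_combination (-x.2) * hD
      · simp; field_simp; linear_combination (x.1) * hD
    rcases lt_or_ge 0 k with h | h
    · exact hns k h hk
    · subst hk
      have e1 : lf α β (k • x) = k * lf α β x := by simp [lf]; ring
      have e2 : lf (-β) α (k • x) = k * lf (-β) α x := by simp [lf]; ring
      unfold Ln at h1 h2
      rw [e1, e2] at h2
      rcases h1 with h1 | ⟨h1, h1'⟩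
      · rcases h2 with h2 | ⟨h2, h2'⟩
        · nlinarith
        · rcases mul_eq_zero.1 h2 with h3 | h3
          · rw [h3] at h2'; simp at h2'
          · linarith
      · rcases h2 with h2 | ⟨h2, h2'⟩
        · rw [h1] at h2; simp at h2
        · nlinarith
  · have hDp : 0 < (x.1 * y.2 - x.2 * y.1) ^ 2 := by positivity
    generalize hDD : x.1 * y.2 - x.2 * y.1 = D at *
    set s : ℝ := - ((y.1 * z.2 - y.2 * z.1) * D) / D ^ 2 with hs
    set r : ℝ := ((x.1 * z.2 - x.2 * z.1) * D) / D ^ 2 with hr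
    have hs0 : 0 ≤ s := by
      have : y.1 * x.2 - y.2 * x.1 = - D := by rw [← hDD]; ring
      rw [this] at k2
      exact div_nonneg (by linarith) hDp.le
    have hr0 : 0 ≤ r := div_nonneg k1 hDp.le
    have hz : z = s • x + r • y := by
      refine Prod.ext ?_ ?_
      · simp [hs, hr]; field_simp; rw [← hDD]; ring
      · simp [hs, hr]; field_simp; rw [← hDD]; ring
    have e1 : lf α β (-z) = - (s * lf α β x + r * lf α β y) := by rw [hz]; simp [lf]; ring
    have e2 : lf (-β) α (-z) = - (s * lf (-β) α x + r * lf (-β) α y) := by rw [hz]; simp [lf]; ring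
    unfold Ln at *
    rw [e1, e2]
    have hx : lf α β x ≤ 0 := by rcases h1 with h | h; exacts [h.le, h.1.le]
    have hy : lf α β y ≤ 0 := by rcases h2 with h | h; exacts [h.le, h.1.le]
    have m1 := mul_nonneg hs0 (neg_nonneg.2 hx)
    have m2 := mul_nonneg hr0 (neg_nonneg.2 hy)
    rintro (h | ⟨h, h'⟩)
    · linarith
    · have n1 : s * lf α β x = 0 := by linarith
      have n2 : r * lf α β y = 0 := by linarith
      have q1 : s * lf (-β) α x ≤ 0 := by
        rcases mul_eq_zero.1 n1 with h0 | h0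
        · rw [h0]; simp
        · have : lf (-β) α x ≤ 0 := by rcases h1 with h | h; exacts [absurd h0 h.ne, h.2.le]
          nlinarith
      have q2 : r * lf (-β) α y ≤ 0 := by
        rcases mul_eq_zero.1 n2 with h0 | h0
        · rw [h0]; simp
        · have : lf (-β) α y ≤ 0 := by rcases h2 with h | h; exacts [absurd h0 h.ne, h.2.le]
          nlinarith
      linarith

lemma lf_sub (α β : ℝ) (p q : ℝ × ℝ) : lf α β (p - q) = lf α β p - lf α β q := by simp [lf]; ring

lemma lx_Ln {α β : ℝ} {G : ι → ℝ × ℝ} {a b : ι} :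
    lx (fun v => lf α β (G v)) (fun v => lf (-β) α (G v)) a < lx (fun v => lf α β (G v)) (fun v => lf (-β) α (G v)) b ↔
      Ln α β (G a - G b) := by
  rw [lx_lt, Ln, lf_sub, lf_sub, sub_neg, sub_eq_zero, sub_neg]

lemma Ln_neg {α β : ℝ} {d : ℝ × ℝ} : Ln (-α) (-β) d ↔ Ln α β (-d) := by
  have e1 : lf (-α) (-β) d = lf α β (-d) := by simp [lf]
  have e2 : lf (-(-β)) (-α) d = lf (-β) α (-d) := by simp [lf]
  unfold Ln; rw [e1, e2]

/-- the level structure -/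
lemma Emb.lev (H : Emb P F f C) {G : ι → ℝ × ℝ} (hG : ∀ v, Bd F v → G v = f (P v)) (h1 : Harm F (fun v => (G v).1))
    (h2 : Harm F (fun v => (G v).2)) {α β c : ℝ} (h : α ≠ 0 ∨ β ≠ 0) (hlo : ∃ w, Bd F w ∧ lf α β (G w) < c)
    (hhi : ∃ w, Bd F w ∧ c < lf α β (G w)) : Lev F (fun v => lf α β (G v)) (fun v => lf (-β) α (G v)) c where
  hintr v hv hb := by
    refine Harm.flat_or ?_ v hv hb
    intro u hu hub
    have e1 := h1 u hu hub
    have e2 := h2 u hu hub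
    have : ∀ w, lf α β (G w) - lf α β (G u) = α * ((G w).1 - (G u).1) + β * ((G w).2 - (G u).2) := by
      intro w; simp [lf]; ring
    simp only [this]
    rw [sum_add_distrib, ← mul_sum, ← mul_sum, e1, e2]; simp
  inj a b ha hb e1 e2 := by
    refine H.vinj ha hb ?_
    rw [← hG a ha, ← hG b hb]
    exact sub_eq_zero.1 (Ln_zero h (by rw [lf_sub]; simpa using sub_eq_zero.2 e1) (by rw [lf_sub]; simpa using sub_eq_zero.2 e2))
  bmax v a b ha hb hab h3 h4 w hw := by
    rw [← not_lt]
    rw [lx_Ln] at *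
    rw [hG v ⟨a, ha⟩] at *
    rw [hG a ⟨v, ha.symm⟩] at h3
    rw [hG b ⟨v, hb.symm⟩] at h4
    rw [hG w hw]
    exact H.cone ha hb hab h3 h4 (H.frC (H.vfrontC hw))
  bmin v a b ha hb hab h3 h4 w hw := by
    rw [← not_lt]
    rw [lx_Ln] at *
    rw [hG v ⟨a, ha⟩] at *
    rw [hG a ⟨v, ha.symm⟩, ← neg_sub, ← Ln_neg] at h3
    rw [hG b ⟨v, hb.symm⟩, ← neg_sub, ← Ln_neg] at h4
    rw [hG w hw, ← neg_sub, ← Ln_neg]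
    exact H.cone ha hb hab h3 h4 (H.frC (H.vfrontC hw))
  lo := hlo
  hi := hhi
  nb a b hab hac := by
    obtain ⟨p, hp, hpl⟩ := hlo
    obtain ⟨q, hq, hql⟩ := hhi
    rw [← hac] at hpl hql ⊢
    rw [hG a ⟨b, hab⟩] at *
    rw [hG b ⟨a, hab.symm⟩]
    rw [hG p hp] at hpl
    rw [hG q hq] at hql
    exact H.nb hab (H.frC (H.vfrontC hp)) (H.frC (H.vfrontC hq)) hpl hql

end cvx
end TD

namespace TD
open Finset Topology
section cvx
variable {ι : Type} [Fintype ι] [DecidableEq ι] {Q P : ι → ℝ × ℝ} {t : Finset ι} {𝓕 F : Finset (Finset ι)}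
variable {f : ℝ × ℝ → ℝ × ℝ} {C : Set (ℝ × ℝ)}

lemma Emb.cont (H : Emb P F f C) : ContinuousOn f (frontier (KK P F)) := by
  have e : frontier (KK P F) = ⋃ p : {p : ι × ι // BdE F p.1 p.2}, hull P {p.1.1, p.1.2} := by
    ext x
    rw [H.geo.front]
    simp
  rw [e]
  refine LocallyFinite.continuousOn_iUnion (locallyFinite_of_finite _) (fun _ => hull_closed) ?_
  rintro ⟨⟨a, b⟩, hab⟩
  obtain ⟨g, hg⟩ := H.aff a b hab
  rw [hull_pair]
  exact (AffineMap.continuous_of_finiteDimensional g).continuousOn.congr hg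

/-- an interior edge between boundary vertices is never on an extreme level -/
lemma Emb.obs (H : Emb P F f C) {α β : ℝ} (hn : α ≠ 0 ∨ β ≠ 0) {a b : ι} (hab : IntE F a b) (ha : Bd F a) (hb : Bd F b)
    (hM : ∀ v, Bd F v → lf α β (f (P v)) ≤ lf α β (f (P a))) (he : lf α β (f (P b)) = lf α β (f (P a))) : False := by
  have hmax := H.ext_bd hn hM
  have hne : f (P a) ≠ f (P b) := fun he => hab.1 (H.vinj ha hb he)
  obtain ⟨o, ho⟩ := H.int
  have hoC := interior_subset ho
  have hlo : lf α β o < lf α β (f (P a)) := by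
    refine lt_of_le_of_ne (hmax o hoC) (fun h => ?_)
    exact not_int_of_max hn (fun q hq => by rw [h]; exact hmax q hq) ho
  -- triangle
  let R : Fin 3 → ℝ × ℝ := ![f (P a), f (P b), o]
  have g : Good R {0, 1, 2} := by
    refine good_of_det ?_
    show det3 (f (P a)) (f (P b)) o ≠ 0
    intro h0
    generalize f (P a) = A at *
    generalize f (P b) = B at *
    unfold lf at he hlo
    unfold det3 at h0
    have e' : α * (B.1 - A.1) + β * (B.2 - A.2) = 0 := by linarith
    have k1 : α * (o.1 - A.1) + β * (o.2 - A.2) < 0 := by linarith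
    have hd : 0 < (B.1 - A.1)^2 + (B.2 - A.2)^2 := by
      refine lf_pos_sq ?_
      by_contra hcon
      push Not at hcon
      exact hne (Prod.ext (by linarith [hcon.1]) (by linarith [hcon.2]))
    generalize B.1 - A.1 = d1 at *
    generalize B.2 - A.2 = d2 at *
    generalize o.1 - A.1 = x1 at *
    generalize o.2 - A.2 = x2 at *
    have e1 : d2 * (α * x1 + β * x2) = 0 := by linear_combination x2 * e' - α * h0
    have e2 : d1 * (α * x1 + β * x2) = 0 := by linear_combination x1 * e' + β * h0
    rcases mul_eq_zero.1 e1 with h1 | h1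
    · rcases mul_eq_zero.1 e2 with h2 | h2
      · rw [h1, h2] at hd; simp at hd
      · linarith
    · linarith
  have hsub : interior (hull R {0, 1, 2}) ⊆ interior C := by
    refine interior_mono (convexHull_min ?_ H.conv)
    rintro _ ⟨i, _, rfl⟩
    fin_cases i
    · exact H.frC (H.vfrontC ha)
    · exact H.frC (H.vfrontC hb)
    · exact hoC
  have n01 : (0 : Fin 3) ≠ 1 := by decide
  have n02 : (0 : Fin 3) ≠ 2 := by decide
  have n12 : (1 : Fin 3) ≠ 2 := by decide
  -- level in barycentric coordinates
  have hlev : ∀ p, lf α β (f (P a)) - lf α β p = bc R {0, 1, 2} 2 p * (lf α β (f (P a)) - lf α β o) := by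
    intro p
    have h1 := bc_sum g p
    have h2 := congrArg (lf α β) (bc_comb g p)
    rw [lf_sum] at h2
    rw [sum_tri n01 n02 n12] at h1 h2
    have r0 : R 0 = f (P a) := rfl
    have r1 : R 1 = f (P b) := rfl
    have r2 : R 2 = o := rfl
    rw [r0, r1, r2, he] at h2
    linear_combination h2 - lf α β (f (P a)) * h1
  have hseg : ∀ p, p ∈ segment ℝ (f (P a)) (f (P b)) ↔ p ∈ hull R {0, 1} := by
    intro p; rw [hull_pair]
    rfl
  have hss : ({0, 1} : Finset (Fin 3)) ⊆ {0, 1, 2} := by decide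
  let O1 : Set (ℝ × ℝ) := {p | 0 < bc R {0, 1, 2} 0 p ∧ 0 < bc R {0, 1, 2} 1 p}
  have hO1 : IsOpen O1 := (isOpen_lt continuous_const (bc_cont _)).inter (isOpen_lt continuous_const (bc_cont _))
  have hO1s : ∀ p ∈ frontier C, p ∈ O1 → p ∈ segment ℝ (f (P a)) (f (P b)) := by
    intro p hp hpO
    rw [hseg, mem_face g hss]
    have h2 : 0 ≤ bc R {0, 1, 2} 2 p := by
      have := hlev p
      have h3 := hmax p (H.frC hp)
      by_contra hcon
      push Not at hcon
      nlinarith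
    have h3 : bc R {0, 1, 2} 2 p = 0 := by
      by_contra hcon
      refine hp.2 (hsub ((mem_int g).2 ?_))
      intro v hv
      fin_cases v
      · exact hpO.1
      · exact hpO.2
      · exact lt_of_le_of_ne h2 (Ne.symm hcon)
    constructor
    · rw [mem_hull g]
      intro v hv
      fin_cases v
      · exact hpO.1.le
      · exact hpO.2.le
      · exact h2
    · intro v hv hv'
      fin_cases v
      · simp at hv'
      · simp at hv'
      · exact h3
  have hsO1 : ∀ p, p ∈ segment ℝ (f (P a)) (f (P b)) → p ≠ f (P a) → p ≠ f (P b) → p ∈ O1 := by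
    intro p hp h1 h2
    rw [segment_eq_image_lineMap] at hp
    obtain ⟨s, ⟨s0, s1⟩, rfl⟩ := hp
    have s0' : s ≠ 0 := by rintro rfl; simp at h1
    have s1' : s ≠ 1 := by rintro rfl; simp at h2
    have r0 : f (P a) = R 0 := rfl
    have r1 : f (P b) = R 1 := rfl
    show 0 < _ ∧ 0 < _
    rw [r0, r1, bc_line, bc_line, bc_self g (by simp), bc_self g (by simp), bc_ne g (by simp) n01, bc_ne g (by simp) n01.symm]
    have := lt_of_le_of_ne s0 s0'.symm
    have := lt_of_le_of_ne s1 s1'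
    constructor <;> linarith
  -- the midpoint
  set m : ℝ × ℝ := AffineMap.lineMap (f (P a)) (f (P b)) (1/2 : ℝ) with hm
  have hmseg : m ∈ segment ℝ (f (P a)) (f (P b)) := by
    rw [segment_eq_image_lineMap]; exact ⟨1/2, by constructor <;> norm_num, rfl⟩
  have hmC : m ∈ C := H.conv.segment_subset (H.frC (H.vfrontC ha)) (H.frC (H.vfrontC hb)) hmseg
  have hml : lf α β m = lf α β (f (P a)) := by rw [hm, lf_line, he]; ring
  have hmf : m ∈ frontier C := by
    rw [H.comp.isClosed.frontier_eq]
    exact ⟨hmC, not_int_of_max hn (fun q hq => by rw [hml]; exact hmax q hq)⟩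
  have hma : m ≠ f (P a) := by
    intro h
    rw [hm, AffineMap.lineMap_eq_left_iff] at h
    rcases h with h | h
    · exact hne h
    · norm_num at h
  have hmb : m ≠ f (P b) := by
    intro h
    rw [hm, AffineMap.lineMap_eq_right_iff] at h
    rcases h with h | h
    · exact hne h
    · norm_num at h
  obtain ⟨x, hx, hxm⟩ : m ∈ f '' frontier (KK P F) := by rw [H.img]; exact hmf
  have hxS : x ∈ frontier (KK P F) \ {P a, P b} := by
    refine ⟨hx, ?_⟩
    simp only [Set.mem_insert_iff, Set.mem_singleton_iff, not_or]
    exact ⟨fun h => hma (by rw [← hxm, h]), fun h => hmb (by rw [← hxm, h])⟩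
  refine H.noobs a b hab ha hb x hxS ?_
  set Z := connectedComponentIn (frontier (KK P F) \ {P a, P b}) x with hZ
  have hZS : Z ⊆ frontier (KK P F) \ {P a, P b} := connectedComponentIn_subset _ _
  have hZf : Z ⊆ frontier (KK P F) := hZS.trans Set.sdiff_subset
  have hpre : IsPreconnected (f '' Z) := isPreconnected_connectedComponentIn.image f (H.cont.mono hZf)
  have hZseg : f '' Z ⊆ segment ℝ (f (P a)) (f (P b)) := by
    by_contra hcon
    obtain ⟨y, hy, hyn⟩ := Set.not_subset.1 hcon
    have hfr : f '' Z ⊆ frontier C := by rw [← H.img]; exact Set.image_mono hZf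
    have hcl : IsClosed (segment ℝ (f (P a)) (f (P b))) := by
      have : segment ℝ (f (P a)) (f (P b)) = hull R {0, 1} := by ext p; exact hseg p
      rw [this]; exact hull_closed
    obtain ⟨p, hp, hp1, hp2⟩ := hpre O1 (segment ℝ (f (P a)) (f (P b)))ᶜ hO1 hcl.isOpen_compl (by
      rintro p hp
      by_cases hps : p ∈ segment ℝ (f (P a)) (f (P b))
      · left
        obtain ⟨z, hz, rfl⟩ := hp
        have hz' := hZS hz
        have hz2 := hz'.2
        simp only [Set.mem_insert_iff, Set.mem_singleton_iff, not_or] at hz2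
        exact hsO1 _ hps (fun h => hz2.1 (H.inj hz'.1 (H.vfront ha) h)) (fun h => hz2.2 (H.inj hz'.1 (H.vfront hb) h))
      · right; exact hps) ⟨m, ⟨x, mem_connectedComponentIn hxS, hxm⟩, hsO1 m hmseg hma hmb⟩ ⟨y, hy, hyn⟩
    exact hp2 (hO1s p (hfr hp) hp1)
  have hclZ : closure Z ⊆ frontier (KK P F) := closure_minimal hZf isClosed_frontier
  have himg : f '' closure Z ⊆ segment ℝ (f (P a)) (f (P b)) := by
    have h1 : f '' closure Z ⊆ closure (f '' Z) := by
      rintro _ ⟨z, hz, rfl⟩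
      have := (H.cont z (hclZ hz)).mono hZf
      exact this.mem_closure_image hz
    refine h1.trans (closure_minimal hZseg ?_)
    have : segment ℝ (f (P a)) (f (P b)) = hull R {0, 1} := by ext p; exact hseg p
    rw [this]; exact hull_closed
  refine Collinear.subset himg ?_
  rw [collinear_iff_of_mem (p₀ := f (P a)) (left_mem_segment _ _ _)]
  refine ⟨f (P b) - f (P a), ?_⟩
  intro p hp
  rw [segment_eq_image_lineMap] at hp
  obtain ⟨s, _, rfl⟩ := hp
  exact ⟨s, by simp [AffineMap.lineMap_apply]⟩

/-- strong maximum principle -/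
lemma Emb.max2 (H : Emb P F f C) (hF : Disk F) {G : ι → ℝ × ℝ} (hG : ∀ v, Bd F v → G v = f (P v)) {α β : ℝ} (hn : α ≠ 0 ∨ β ≠ 0)
    (hh : Harm F (fun v => lf α β (G v))) {u : ι} (hu : Used F u) (hb : ¬ Bd F u) :
    ∃ w, Bd F w ∧ lf α β (G u) < lf α β (G w) := by
  by_contra hcon
  push Not at hcon
  set M := lf α β (G u) with hMdef
  have hle : ∀ v, Used F v → lf α β (G v) ≤ M := Harm.le_bd hF hh hcon
  have hflat : ∀ v, Used F v → ¬ Bd F v → lf α β (G v) = M → ∀ w, Adj F v w → lf α β (G w) = M := by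
    intro v hv hvb hvM w hw
    rcases hh.flat_or v hv hvb with h | ⟨_, x, hx, hx'⟩
    · rw [h w hw, hvM]
    · have := hle x hx.symm.used
      simp only [hvM] at hx'
      linarith
  have hMf : ∀ v, Bd F v → lf α β (f (P v)) ≤ M := fun v hv => by rw [← hG v hv]; exact hcon v hv
  have hobs : ∀ a b, IntE F a b → Bd F a → Bd F b → lf α β (G a) = M → lf α β (G b) = M → False := by
    intro a b hab ha hb e1 e2
    rw [hG a ha] at e1
    rw [hG b hb] at e2
    exact H.obs hn hab ha hb (fun v hv => by rw [e1]; exact hMf v hv) (by rw [e1, e2])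
  let X : Set ι := {v | lf α β (G v) = M ∧ Used F v ∧ (Bd F v → ∃ i, Adj F v i ∧ ¬ Bd F i ∧ lf α β (G i) = M)}
  have hI : ∀ v w, Used F v → ¬ Bd F v → lf α β (G v) = M → Adj F v w → w ∈ X := by
    intro v w hv hvb hvM hvw
    exact ⟨hflat v hv hvb hvM w hvw, hvw.symm.used, fun _ => ⟨v, hvw.symm, hvb, hvM⟩⟩
  have hall := hF.conn X ⟨u, ⟨rfl, hu, fun h => absurd h hb⟩, hu⟩ (by
    rintro v w ⟨hvM, hvu, hvX⟩ hvw
    by_cases hvb : Bd F v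
    swap
    · exact hI v w hvu hvb hvM hvw
    obtain ⟨i, hvi, hib, hiM⟩ := hvX hvb
    let A : Set ι := {y | y ∈ X ∧ Adj F v y ∧ (Bd F y → ∃ j, ({v, y, j} : Finset ι) ∈ F ∧ ¬ Bd F j ∧ lf α β (G j) = M)}
    have := hF.link v A ⟨i, ⟨⟨hiM, hvi.symm.used, fun h => absurd h hib⟩, hvi, fun h => absurd h hib⟩, hvi⟩ (by
      rintro y y' ⟨hyX, hvy, hyA⟩ hF3
      have hyy' : Adj F y y' := by
        rw [tri_rot] at hF3; exact tri_adj' hF hF3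
      by_cases hyb : Bd F y
      · obtain ⟨j, hj, hjb, hjM⟩ := hyA hyb
        by_cases hjy : y' = j
        · subst hjy
          exact ⟨⟨hjM, hyy'.symm.used, fun h => absurd h hjb⟩, tri_adj' hF hF3, fun h => absurd h hjb⟩
        · exact (hobs v y (IntE.of_two hF hF3 hj hjy) hvb hyb hvM hyX.1).elim
      · refine ⟨hI y y' hyX.2.1 hyb hyX.1 hyy', tri_adj' hF hF3, fun _ => ⟨y, by rw [tri_swap]; exact hF3, hyb, hyX.1⟩⟩) w hvw
    exact this.1)
  obtain ⟨w, hw, hwM⟩ := H.ex_lt hn hMf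
  have := (hall w hw.used).1
  rw [hG w hw] at this
  linarith

end cvx
end TD

namespace TD
open Finset Topology
section asm
variable {ι : Type} [Fintype ι] [DecidableEq ι] {Q P : ι → ℝ × ℝ} {t : Finset ι} {𝓕 F : Finset (Finset ι)}
variable {f : ℝ × ℝ → ℝ × ℝ} {C : Set (ℝ × ℝ)} {G : ι → ℝ × ℝ}

/-- Tutte embedding data -/
structure Tut (P : ι → ℝ × ℝ) (F : Finset (Finset ι)) (f : ℝ × ℝ → ℝ × ℝ) (C : Set (ℝ × ℝ)) (G : ι → ℝ × ℝ) : Prop where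
  emb : Emb P F f C
  bd : ∀ v, Bd F v → G v = f (P v)
  h1 : Harm F (fun v => (G v).1)
  h2 : Harm F (fun v => (G v).2)

lemma Tut.exists (H : Emb P F f C) : ∃ G, Tut P F f C G := by
  obtain ⟨g1, a1, b1⟩ := tutte H.geo.toDisk (fun v => (f (P v)).1)
  obtain ⟨g2, a2, b2⟩ := tutte H.geo.toDisk (fun v => (f (P v)).2)
  exact ⟨fun v => (g1 v, g2 v), H, fun v hv => Prod.ext (a1 v hv) (a2 v hv), b1, b2⟩

lemma Tut.disk (T : Tut P F f C G) : Disk F := T.emb.geo.toDisk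

lemma Tut.harm (T : Tut P F f C G) (α β : ℝ) : Harm F (fun v => lf α β (G v)) := by
  intro u hu hub
  have e1 := T.h1 u hu hub
  have e2 := T.h2 u hu hub
  have : ∀ w, lf α β (G w) - lf α β (G u) = α * ((G w).1 - (G u).1) + β * ((G w).2 - (G u).2) := by
    intro w; simp [lf]; ring
  simp only [this]
  rw [sum_add_distrib, ← mul_sum, ← mul_sum, e1, e2]; simp

lemma lf_neg (α β : ℝ) (p : ℝ × ℝ) : lf (-α) (-β) p = - lf α β p := by simp [lf]; ring

lemma Tut.hi (T : Tut P F f C G) {α β : ℝ} (hn : α ≠ 0 ∨ β ≠ 0) {u : ι} (hu : Used F u) (hb : ¬ Bd F u) :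
    ∃ w, Bd F w ∧ lf α β (G u) < lf α β (G w) := T.emb.max2 T.disk T.bd hn (T.harm α β) hu hb

lemma Tut.lo (T : Tut P F f C G) {α β : ℝ} (hn : α ≠ 0 ∨ β ≠ 0) {u : ι} (hu : Used F u) (hb : ¬ Bd F u) :
    ∃ w, Bd F w ∧ lf α β (G w) < lf α β (G u) := by
  obtain ⟨w, hw, h⟩ := T.hi (α := -α) (β := -β) (by simpa using hn) hu hb
  rw [lf_neg, lf_neg] at h
  exact ⟨w, hw, by linarith⟩

lemma Tut.lev (T : Tut P F f C G) {α β c : ℝ} (h : α ≠ 0 ∨ β ≠ 0) (hlo : ∃ w, Bd F w ∧ lf α β (G w) < c)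
    (hhi : ∃ w, Bd F w ∧ c < lf α β (G w)) : Lev F (fun v => lf α β (G v)) (fun v => lf (-β) α (G v)) c :=
  T.emb.lev T.bd T.h1 T.h2 h hlo hhi

/-- boundary vertex at a nonextreme level has a neighbour off the level -/
lemma Lev.bd_off {h h1 : ι → ℝ} {c : ℝ} (H : Lev F h h1 c) {z : ι} (hz : Bd F z) (hc : h z = c) : ∃ w, Adj F z w ∧ h w ≠ c := by
  obtain ⟨b, hb⟩ := hz
  exact ⟨b, hb.adj, H.nb z b hb hc⟩

lemma Tut.noflat (T : Tut P F f C G) {α β : ℝ} (hn : α ≠ 0 ∨ β ≠ 0) {u : ι} (hu : Used F u) (hb : ¬ Bd F u) :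
    ∃ w, Adj F u w ∧ lf α β (G w) ≠ lf α β (G u) := by
  by_contra hcon
  push Not at hcon
  set c := lf α β (G u) with hc
  have L := T.lev hn (T.lo hn hu hb) (T.hi hn hu hb)
  rw [← hc] at L
  let X : Set ι := {v | Used F v ∧ ¬ Bd F v ∧ lf α β (G v) = c ∧ ∀ w, Adj F v w → lf α β (G w) = c}
  by_cases hX : ∀ x y, x ∈ X → Adj F x y → y ∈ X
  · obtain ⟨v, hv⟩ := T.disk.bd_ex
    exact (T.disk.conn X ⟨u, ⟨hu, hb, rfl, hcon⟩, hu⟩ hX v hv.used).2.1 hv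
  push Not at hX
  obtain ⟨x, z, ⟨hxu, hxb, hxc, hxf⟩, hxz, hzX⟩ := hX
  have hzc := hxf z hxz
  have hz : ∃ w, Adj F z w ∧ lf α β (G w) ≠ c := by
    by_cases hzb : Bd F z
    · exact L.bd_off hzb hzc
    · by_contra h
      push Not at h
      exact hzX ⟨hxz.symm.used, hzb, hzc, h⟩
  obtain ⟨v1, v2, h12, t1, t2, _⟩ := (int_of_not_bd T.disk hxb hxz).symm.two T.disk
  have := L.main T.disk hzc hz (v := x) hxc t1 t2 h12
  have e : lf α β (G v1) = c := hxf v1 (by rw [tri_rot] at t1; exact tri_adj' T.disk t1)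
  simp only [e] at this
  simp at this

lemma Tut.off (T : Tut P F f C G) {α β c : ℝ} (hn : α ≠ 0 ∨ β ≠ 0) (L : Lev F (fun v => lf α β (G v)) (fun v => lf (-β) α (G v)) c)
    {z : ι} (hz : Used F z) (hc : lf α β (G z) = c) : ∃ w, Adj F z w ∧ lf α β (G w) ≠ c := by
  by_cases hb : Bd F z
  · exact L.bd_off hb hc
  · rw [← hc]; exact T.noflat hn hz hb

lemma Tut.opp (T : Tut P F f C G) {z v v1 v2 : ι} (t1 : ({z, v, v1} : Finset ι) ∈ F)
    (t2 : ({z, v, v2} : Finset ι) ∈ F) (h12 : v1 ≠ v2) : det3 (G z) (G v) (G v1) * det3 (G z) (G v) (G v2) < 0 := by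
  have hzv := tri_adj T.disk t1
  have hE := IntE.of_two T.disk t1 t2 h12
  have key : ∀ α β, (α ≠ 0 ∨ β ≠ 0) → lf α β (G v) = lf α β (G z) →
      (lf α β (G v1) - lf α β (G z)) * (lf α β (G v2) - lf α β (G z)) < 0 := by
    intro α β hn he
    have hlohi : (∃ w, Bd F w ∧ lf α β (G w) < lf α β (G z)) ∧ (∃ w, Bd F w ∧ lf α β (G z) < lf α β (G w)) := by
      by_cases hzb : Bd F z
      · by_cases hvb : Bd F v
        · constructor
          · by_contra hcon
            push Not at hcon
            refine T.emb.obs (α := -α) (β := -β) (by simpa using hn) hE hzb hvb ?_ ?_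
            · intro w hw
              rw [lf_neg, lf_neg, ← T.bd w hw, ← T.bd z hzb]; linarith [hcon w hw]
            · rw [lf_neg, lf_neg, ← T.bd v hvb, ← T.bd z hzb, he]
          · by_contra hcon
            push Not at hcon
            refine T.emb.obs (α := α) (β := β) hn hE hzb hvb ?_ ?_
            · intro w hw
              rw [← T.bd w hw, ← T.bd z hzb]; exact hcon w hw
            · rw [← T.bd v hvb, ← T.bd z hzb, he]
        · rw [← he]; exact ⟨T.lo hn hzv.symm.used hvb, T.hi hn hzv.symm.used hvb⟩
      · exact ⟨T.lo hn hzv.used hzb, T.hi hn hzv.used hzb⟩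
    have L := T.lev hn hlohi.1 hlohi.2
    exact L.main T.disk rfl (T.off hn L hzv.used rfl) he t1 t2 h12
  have hne : G z ≠ G v := by
    intro h
    obtain ⟨α, β, hn, he⟩ : ∃ α β, (α ≠ 0 ∨ β ≠ 0) ∧ lf α β (G v1) = lf α β (G z) := by
      by_cases h1 : G v1 = G z
      · exact ⟨1, 0, by simp, by rw [h1]⟩
      · refine ⟨-((G v1).2 - (G z).2), (G v1).1 - (G z).1, ?_, ?_⟩
        · by_contra hcon
          push Not at hcon
          exact h1 (Prod.ext (by linarith [hcon.2]) (by linarith [hcon.1]))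
        · simp [lf]; ring
    have := key α β hn (by rw [h])
    rw [he] at this; simp at this
  have hk := key (-((G v).2 - (G z).2)) ((G v).1 - (G z).1) (by
    by_contra hcon
    push Not at hcon
    exact hne (Prod.ext (by linarith [hcon.2]) (by linarith [hcon.1]))) (by simp [lf]; ring)
  have e : ∀ p, det3 (G z) (G v) p = lf (-((G v).2 - (G z).2)) ((G v).1 - (G z).1) p - lf (-((G v).2 - (G z).2)) ((G v).1 - (G z).1) (G z) := by
    intro p; simp [det3, lf]; ring
  rw [e, e]; exact hk

lemma det_line {a b c : ℝ × ℝ} (hac : a ≠ c) (h : det3 a b c = 0) : ∃ s : ℝ, b = AffineMap.lineMap a c s := by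
  have hd : 0 < (c.1 - a.1)^2 + (c.2 - a.2)^2 := by
    refine lf_pos_sq ?_
    by_contra hcon
    push Not at hcon
    exact hac (Prod.ext (by linarith [hcon.1]) (by linarith [hcon.2]))
  refine ⟨((b.1 - a.1) * (c.1 - a.1) + (b.2 - a.2) * (c.2 - a.2)) / ((c.1 - a.1)^2 + (c.2 - a.2)^2), ?_⟩
  unfold det3 at h
  refine Prod.ext ?_ ?_
  · simp [AffineMap.lineMap_apply]; field_simp; linear_combination (c.2 - a.2) * h
  · simp [AffineMap.lineMap_apply]; field_simp; linear_combination -(c.1 - a.1) * h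

lemma Tut.bdtri0 (T : Tut P F f C G) {a b c : ι} (ht : ({a, b, c} : Finset ι) ∈ F) (hb : Bd F b)
    (hac : BdE F a c) {s : ℝ} (s0 : 0 ≤ s) (s1 : s ≤ 1) : f (P b) ≠ AffineMap.lineMap (f (P a)) (f (P c)) s := by
  intro h
  rw [← T.emb.line hac s0 s1] at h
  have h2 := T.emb.inj (T.emb.vfront hb) (T.emb.seg_front hac s0 s1) h
  have g := T.emb.geo.good _ ht
  obtain ⟨n1, n2, n3⟩ := card3_ne g.1
  have := bc_self g (v := b) (by simp)
  rw [h2, bc_line, bc_ne g (by simp) n1.symm, bc_ne g (by simp) n3] at this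
  simp at this

lemma Tut.bdtri (T : Tut P F f C G) {a b c : ι} (ht : ({a, b, c} : Finset ι) ∈ F) (hab : BdE F a b) (hac : BdE F a c)
    (hbc : BdE F b c) : det3 (f (P a)) (f (P b)) (f (P c)) ≠ 0 := by
  intro h0
  have hne : f (P a) ≠ f (P c) := fun he => hac.1 (T.emb.vinj ⟨c, hac⟩ ⟨a, hac.symm⟩ he)
  obtain ⟨s, hs⟩ := det_line hne h0
  rcases lt_or_ge s 0 with h1 | h1
  · -- a between b and c
    refine T.bdtri0 (a := b) (b := a) (c := c) (by rw [tri_rot]; exact ht) ⟨c, hac⟩ hbc (s := -s / (1 - s)) 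
      (div_nonneg (by linarith) (by linarith)) (by rw [div_le_one (by linarith)]; linarith) ?_
    rw [hs]
    have : 1 - s ≠ 0 := by linarith
    refine Prod.ext ?_ ?_ <;>
    · simp [AffineMap.lineMap_apply]; field_simp; ring
  rcases le_or_gt s 1 with h2 | h2
  · exact T.bdtri0 ht ⟨c, hbc⟩ hac h1 h2 hs
  · refine T.bdtri0 (a := a) (b := c) (c := b) (by rw [tri_swap]; exact ht) ⟨a, hac.symm⟩ hab (s := 1 / s) 
      (div_nonneg (by linarith) (by linarith)) (by rw [div_le_one (by linarith)]; linarith) ?_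
    rw [hs]
    have : s ≠ 0 := by linarith
    refine Prod.ext ?_ ?_ <;>
    · simp [AffineMap.lineMap_apply]; field_simp; ring

lemma Tut.good (T : Tut P F f C G) {t : Finset ι} (ht : t ∈ F) : Good G t := by
  obtain ⟨a, b, c, n1, n2, n3, rfl⟩ := card_eq_three.1 (T.disk.card3 t ht)
  have main : ∀ a b c : ι, ({a, b, c} : Finset ι) ∈ F → IntE F a b → Good G {a, b, c} := by
    intro a b c ht h
    obtain ⟨d, e, hde, hd, he, hall⟩ := h.two T.disk
    refine good_of_det (fun h0 => ?_)
    rcases hall c ht with rfl | rfl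
    · have := T.opp ht he hde; rw [h0] at this; simp at this
    · have := T.opp ht hd hde.symm; rw [h0] at this; simp at this
  rcases (tri_adj T.disk ht).bd_or_int T.disk with h1 | h1
  swap
  · exact main a b c ht h1
  rcases (tri_adj' T.disk ht).bd_or_int T.disk with h2 | h2
  swap
  · have ht' := ht
    rw [tri_swap] at ht' ⊢; exact main a c b ht' h2
  have ht3 : ({b, c, a} : Finset ι) ∈ F := by rw [tri_swap, tri_rot]; exact ht
  rcases (tri_adj T.disk ht3).bd_or_int T.disk with h3 | h3
  swap
  · have := main b c a ht3 h3
    rwa [tri_swap, tri_rot] at this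
  refine good_of_det ?_
  rw [T.bd a ⟨b, h1⟩, T.bd b ⟨c, h3⟩, T.bd c ⟨a, h2.symm⟩]
  exact T.bdtri ht h1 h2 h3

lemma Tut.cfg (T : Tut P F f C G) : Cfg G F := by
  refine ⟨fun t ht => T.good ht, ?_⟩
  intro a b c d hc hd hcd
  have h := T.opp hc hd hcd
  rw [bc_det (T.good hc) (G d)] at h
  have h2 : 0 ≤ det3 (G a) (G b) (G c) * det3 (G a) (G b) (G c) := mul_self_nonneg _
  nlinarith

/-- all vertices lie in C, interior ones in the interior -/
lemma Tut.vint (T : Tut P F f C G) {u : ι} (hu : Used F u) (hb : ¬ Bd F u) : G u ∈ interior C := by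
  by_contra h
  obtain ⟨α, β, hn, hs⟩ := supp T.emb.conv T.emb.int h
  obtain ⟨w, hw, hlt⟩ := T.hi hn hu hb
  have := hs _ (T.emb.frC (T.emb.vfrontC hw))
  rw [T.bd w hw] at hlt
  linarith

lemma Tut.vC (T : Tut P F f C G) {u : ι} (hu : Used F u) : G u ∈ C := by
  by_cases hb : Bd F u
  · rw [T.bd u hb]; exact T.emb.frC (T.emb.vfrontC hb)
  · exact interior_subset (T.vint hu hb)

lemma Tut.hullC (T : Tut P F f C G) {t : Finset ι} (ht : t ∈ F) : hull G t ⊆ C := by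
  refine convexHull_min ?_ T.emb.conv
  rintro _ ⟨u, hu, rfl⟩
  exact T.vC ⟨t, ht, hu⟩

end asm
end TD

namespace TD
open Finset Topology
section asm
variable {ι : Type} [Fintype ι] [DecidableEq ι] {Q P : ι → ℝ × ℝ} {t : Finset ι} {𝓕 F : Finset (Finset ι)}
variable {f : ℝ × ℝ → ℝ × ℝ} {C : Set (ℝ × ℝ)} {G : ι → ℝ × ℝ}

/-- affine transfer between two realisations of a triangle -/
noncomputable def tr (P G : ι → ℝ × ℝ) (t : Finset ι) (x : ℝ × ℝ) : ℝ × ℝ := ∑ v ∈ t, bc P t v x • G v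

lemma tr_bc (hP : Good P t) (hG : Good G t) (x : ℝ × ℝ) (v : ι) : bc G t v (tr P G t x) = bc P t v x := by
  by_cases hv : v ∈ t
  · exact bc_uniq hG _ (bc_sum hP x) hv
  · rw [bc_not hv, bc_not hv]

lemma tr_tr (hP : Good P t) (hG : Good G t) (x : ℝ × ℝ) : tr G P t (tr P G t x) = x := by
  unfold tr
  conv_rhs => rw [← bc_comb hP x]
  exact sum_congr rfl (fun v _ => by rw [← tr_bc hP hG x v]; rfl)

lemma tr_mem (hP : Good P t) (hG : Good G t) {x : ℝ × ℝ} (hx : x ∈ hull P t) : tr P G t x ∈ hull G t := by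
  rw [mem_hull hG]; intro v hv; rw [tr_bc hP hG]; exact (mem_hull hP).1 hx v hv

lemma tr_univ (x : ℝ × ℝ) : tr P G t x = ∑ v, bc P t v x • G v := by
  unfold tr
  refine sum_subset (subset_univ _) (fun v _ hv => ?_)
  rw [bc_not hv, zero_smul]

lemma tr_line (hP : Good P t) (x y : ℝ × ℝ) (s : ℝ) :
    tr P G t (AffineMap.lineMap x y s) = AffineMap.lineMap (tr P G t x) (tr P G t y) s := by
  unfold tr
  simp only [bc_line]
  rw [AffineMap.lineMap_apply, vsub_eq_sub, vadd_eq_add, ← sum_sub_distrib, smul_sum, ← sum_add_distrib]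
  refine sum_congr rfl (fun v _ => ?_)
  module

lemma tr_vert (hP : Good P t) {v : ι} (hv : v ∈ t) : tr P G t (P v) = G v := by
  unfold tr
  rw [sum_eq_single v, bc_self hP hv, one_smul]
  · intro u hu huv; rw [bc_ne hP hv huv, zero_smul]
  · intro h; exact absurd hv h

lemma Tut.tr_front (T : Tut P F f C G) (ht : t ∈ F) {x : ℝ × ℝ} (hx : x ∈ hull P t) (hf : x ∈ frontier (KK P F)) :
    tr P G t x = f x := by
  obtain ⟨a, b, hab, hxab⟩ := T.emb.geo.front.1 hf
  obtain ⟨_, t', ht', ha, hb⟩ := hab.adj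
  have hsub : ({a, b} : Finset ι) ⊆ t' := by intro z hz; simp at hz; rcases hz with rfl | rfl <;> assumption
  have hx' := hull_mono hsub hxab
  have e : tr P G t x = tr P G t' x := by
    rw [tr_univ, tr_univ]
    exact sum_congr rfl (fun v _ => by rw [T.emb.geo.bc_glob ht ht' hx hx' v])
  rw [hull_pair, segment_eq_image_lineMap] at hxab
  obtain ⟨s, ⟨s0, s1⟩, rfl⟩ := hxab
  have g := T.emb.geo.good t' ht'
  rw [e, tr_line g, tr_vert g ha, tr_vert g hb, T.emb.line hab s0 s1, T.bd a ⟨b, hab⟩, T.bd b ⟨a, hab.symm⟩]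

/-- preimages of boundary points are boundary points -/
lemma Tut.pre_front (T : Tut P F f C G) (ht : t ∈ F) {x : ℝ × ℝ} (hx : x ∈ hull P t) (hf : tr P G t x ∉ interior C) :
    x ∈ frontier (KK P F) := by
  have gP := T.emb.geo.good t ht
  have gG := T.good ht
  obtain ⟨α, β, hn, hs⟩ := supp T.emb.conv T.emb.int hf
  set M := lf α β (tr P G t x) with hM
  have hpos := (mem_hull gP).1 hx
  have hsum : ∑ v ∈ t, bc P t v x * (M - lf α β (G v)) = 0 := by
    have h1 := bc_sum gP x
    have h2 : M = ∑ v ∈ t, bc P t v x * lf α β (G v) := by rw [hM, tr, lf_sum]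
    simp only [mul_sub, sum_sub_distrib, ← sum_mul]
    rw [h1, ← h2]; ring
  have hz : ∀ v ∈ t, bc P t v x * (M - lf α β (G v)) = 0 := by
    refine (sum_eq_zero_iff_of_nonneg (fun v hv => ?_)).1 hsum
    exact mul_nonneg (hpos v hv) (sub_nonneg.2 (hs _ (T.vC ⟨t, ht, hv⟩)))
  have hlev : ∀ v ∈ t, bc P t v x ≠ 0 → lf α β (G v) = M := by
    intro v hv h
    have := (mul_eq_zero.1 (hz v hv)).resolve_left h
    linarith
  have hbd : ∀ v ∈ t, bc P t v x ≠ 0 → Bd F v := by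
    intro v hv h
    by_contra hb
    obtain ⟨w, hw, hlt⟩ := T.hi hn ⟨t, ht, hv⟩ hb
    have := hs _ (T.vC hw.used)
    rw [hlev v hv h] at hlt
    linarith
  have hedge : ∀ a ∈ t, ∀ b ∈ t, a ≠ b → bc P t a x ≠ 0 → bc P t b x ≠ 0 → BdE F a b := by
    intro a ha b hb hab h1 h2
    have hadj : Adj F a b := ⟨hab, t, ht, ha, hb⟩
    rcases hadj.bd_or_int T.disk with h | h
    · exact h
    · exfalso
      have b1 := hbd a ha h1
      have b2 := hbd b hb h2
      have e1 := hlev a ha h1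
      have e2 := hlev b hb h2
      rw [T.bd a b1] at e1
      rw [T.bd b b2] at e2
      refine T.emb.obs hn h b1 b2 (fun v hv => ?_) (by rw [e1, e2])
      rw [e1]; exact hs _ (T.emb.frC (T.emb.vfrontC hv))
  by_cases hintr : x ∈ interior (hull P t)
  · exfalso
    have hp := (mem_int gP).1 hintr
    obtain ⟨o, ho⟩ := T.emb.int
    have h1 : lf α β o = M := by
      have e := congrArg (lf α β) (bc_comb gG o)
      rw [lf_sum] at e
      rw [← e, sum_congr rfl (fun v hv => by rw [hlev v hv (hp v hv).ne']), ← sum_mul, bc_sum gG, one_mul]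
    exact not_int_of_max hn (fun q hq => by rw [h1]; exact hs q hq) ho
  by_cases hv : ∀ v ∈ t, x ≠ P v
  · obtain ⟨a, b, c, he, ha, hb, hc⟩ := edge_case gP hx hintr hv
    have n := gP.1
    rw [he] at n
    obtain ⟨n1, n2, n3⟩ := card3_ne n
    refine T.emb.geo.bd_front (hedge a (by simp [he]) b (by simp [he]) n1 ha.ne' hb.ne') ?_
    refine (mem_face gP (by rw [he]; intro z hz; simp at hz ⊢; tauto)).2 ⟨hx, ?_⟩
    intro v hv hv'
    rw [he] at hv
    simp at hv hv'
    have : v = c := by tauto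
    rw [this, hc]
  · push Not at hv
    obtain ⟨v, hv, rfl⟩ := hv
    exact T.emb.vfront (hbd v hv (by rw [bc_self gP hv]; norm_num))

/-- used vertex images -/
def vim (F : Finset (Finset ι)) (G : ι → ℝ × ℝ) : Set (ℝ × ℝ) := G '' {v | Used F v}

lemma vim_fin : (vim F G).Finite := by unfold vim; exact (Set.toFinite _).image _

lemma Tut.reg (T : Tut P F f C G) {p : ℝ × ℝ} (hp : p ∈ interior C) (hv : p ∉ vim F G) : Reg G F p := by
  intro t ht hpt
  by_cases hi : p ∈ interior (hull G t)
  · exact Or.inl hi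
  right
  obtain ⟨a, b, c, he, ha, hb, hc⟩ := edge_case (T.good ht) hpt hi (fun v hvt h => hv ⟨v, ⟨t, ht, hvt⟩, h.symm⟩)
  subst he
  rcases (tri_adj T.disk ht).bd_or_int T.disk with h | h
  · exfalso
    have hm : p ∈ hull G {a, b} := by
      refine (mem_face (T.good ht) (by intro z hz; simp at hz ⊢; tauto)).2 ⟨hpt, ?_⟩
      intro v hv hv'
      simp at hv hv'
      have : v = c := by tauto
      rw [this, hc]
    rw [hull_pair, segment_eq_image_lineMap, T.bd a ⟨b, h⟩, T.bd b ⟨a, h.symm⟩] at hm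
    obtain ⟨s, ⟨s0, s1⟩, rfl⟩ := hm
    exact (T.emb.fseg h s0 s1).2 hp
  · obtain ⟨d, hd, hdF⟩ := ec_two' (c := c) T.disk.card3 h.1 (by rw [h.2])
    exact ⟨_, a, b, c, d, rfl, rfl, ht, hdF, hd.symm, ha, hb, hc⟩

lemma Tut.base (T : Tut P F f C G) : ∃ p ∈ interior C, p ∉ vim F G ∧ MM G F p = 2 := by
  obtain ⟨a, b, hab⟩ := T.disk.bd_ex
  obtain ⟨_, t, ht, ha, hb⟩ := hab.adj
  obtain ⟨c, hca, hcb, rfl⟩ := third3 (T.disk.card3 t ht) hab.1 ha hb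
  have gP := T.emb.geo.good _ ht
  have gG := T.good ht
  obtain ⟨n1, n2, n3⟩ := card3_ne gG.1
  set m : ℝ × ℝ := AffineMap.lineMap (G a) (G b) (1/2 : ℝ) with hm
  have hmf : m ∉ interior C := by
    rw [hm, T.bd a ⟨b, hab⟩, T.bd b ⟨a, hab.symm⟩]
    exact (T.emb.fseg hab (by norm_num) (by norm_num)).2
  have honly : ∀ t' ∈ F, m ∈ hull G t' → t' = {a, b, c} := by
    intro t' ht' hm'
    have gP' := T.emb.geo.good t' ht'
    have gG' := T.good ht'
    have hx := tr_mem gG' gP' hm'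
    have hxm : tr P G t' (tr G P t' m) = m := tr_tr gG' gP' m
    have hfr := T.pre_front ht' hx (by rw [hxm]; exact hmf)
    have e : f (AffineMap.lineMap (P a) (P b) (1/2 : ℝ)) = f (tr G P t' m) := by
      rw [T.emb.line hab (by norm_num) (by norm_num), ← T.bd a ⟨b, hab⟩, ← T.bd b ⟨a, hab.symm⟩, ← hm,
        ← T.tr_front ht' hx hfr, hxm]
    have e2 := T.emb.inj (T.emb.seg_front hab (by norm_num) (by norm_num)) hfr e
    rw [← e2] at hx
    have hmt : AffineMap.lineMap (P a) (P b) (1/2 : ℝ) ∈ hull P {a, b, c} :=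
      hull_convex.lineMap_mem (vert_mem ha) (vert_mem hb) ⟨by norm_num, by norm_num⟩
    have ka := T.emb.geo.carrier ht ht' hmt hx ha (by
      rw [bc_line, bc_self gP ha, bc_ne gP hb n1]; norm_num)
    have kb := T.emb.geo.carrier ht ht' hmt hx hb (by
      rw [bc_line, bc_self gP hb, bc_ne gP ha n1.symm]; norm_num)
    obtain ⟨d, _, _, rfl⟩ := third3 (T.disk.card3 t' ht') hab.1 ka kb
    rw [hab.one T.disk ht' ht]
  have hev : ∀ᶠ q in 𝓝 m, ∀ t' ∈ F, t' ≠ {a, b, c} → q ∉ hull G t' := by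
    rw [Filter.eventually_all_finset]
    intro t' ht'
    by_cases h : t' = {a, b, c}
    · exact Filter.Eventually.of_forall (fun q hq => absurd h hq)
    · have : m ∉ hull G t' := fun hm' => h (honly t' ht' hm')
      filter_upwards [hull_closed.isOpen_compl.mem_nhds this] with q hq _
      exact hq
  have hlim : Filter.Tendsto (fun s : ℝ => (AffineMap.lineMap m (G c) s : ℝ × ℝ)) (𝓝[>] 0) (𝓝 m) := by
    have hc : Continuous (fun s : ℝ => (AffineMap.lineMap m (G c) s : ℝ × ℝ)) := AffineMap.lineMap_continuous
    have := hc.tendsto 0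
    rw [AffineMap.lineMap_apply_zero] at this
    exact this.mono_left nhdsWithin_le_nhds
  have h3 : ∀ᶠ s : ℝ in 𝓝[>] 0, 0 < s ∧ s < 1 := by
    exact Ioo_mem_nhdsGT one_pos
  obtain ⟨s, hs, s0, s1⟩ := ((hlim.eventually hev).and h3).exists
  have hintr : AffineMap.lineMap m (G c) s ∈ interior (hull G {a, b, c}) := by
    rw [mem_int gG]
    intro v hv
    have hc' : c ∈ ({a, b, c} : Finset ι) := by simp
    simp only [mem_insert, mem_singleton] at hv
    rcases hv with rfl | rfl | rfl
    · rw [bc_line, hm, bc_line, bc_self gG ha, bc_ne gG hb n1, bc_ne gG hc' n2]; linarith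
    · rw [bc_line, hm, bc_line, bc_self gG hb, bc_ne gG ha n1.symm, bc_ne gG hc' n3]; linarith
    · rw [bc_line, hm, bc_line, bc_self gG hc', bc_ne gG ha n2.symm, bc_ne gG hb n3.symm]; linarith
  refine ⟨_, interior_mono (T.hullC ht) hintr, ?_, ?_⟩
  · rintro ⟨v, ⟨t', ht', hv⟩, he⟩
    have h1 : t' = {a, b, c} := by
      by_contra h
      exact hs t' ht' h (by rw [← he]; exact vert_mem hv)
    subst h1
    rw [← he, mem_int gG] at hintr
    have : ∃ w ∈ ({a, b, c} : Finset ι), w ≠ v := by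
      by_cases h : a = v
      · exact ⟨b, hb, by rw [← h]; exact n1.symm⟩
      · exact ⟨a, ha, h⟩
    obtain ⟨w, hw, hwv⟩ := this
    have := hintr w hw
    rw [bc_ne gG hv hwv] at this
    exact lt_irrefl _ this
  · unfold MM
    rw [sum_eq_single_of_mem _ ht (fun t' ht' hne => mm_off (hs t' ht' hne)), mm_in hintr]

lemma Tut.MM2 (T : Tut P F f C G) {p : ℝ × ℝ} (hp : p ∈ interior C) (hv : p ∉ vim F G) : MM G F p = 2 := by
  obtain ⟨q, hq, hqv, h⟩ := T.base
  rw [← h]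
  exact MM_const T.cfg (diff_countable_preconnected rank_plane isOpen_interior T.emb.conv.interior vim_fin.countable)
    (fun p hp => T.reg hp.1 hp.2) ⟨hp, hv⟩ ⟨hq, hqv⟩

lemma mm_two_le (hs : 𝓕 ⊆ F) {p : ℝ × ℝ} : MM Q 𝓕 p ≤ MM Q F p :=
  sum_le_sum_of_subset_of_nonneg hs (fun _ _ _ => mm_nonneg)

/-- a vertex image in the interior lies only in triangles of the star -/
lemma Tut.vert_star (T : Tut P F f C G) {v : ι} (hu : Used F v) (hb : ¬ Bd F v) (ht : t ∈ F) (hvt : G v ∈ hull G t) : v ∈ t := by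
  by_contra hcon
  have gG := T.good ht
  have hcov := star_cover (𝓕 := F.filter (fun t => v ∈ t)) (T.cfg.sub (filter_subset _ _)) v
    (by obtain ⟨s, hs, hvs⟩ := hu; exact ⟨s, by simp [hs, hvs]⟩) (by intro t ht; simp at ht; exact ht.2) (by
      intro x y hxy
      simp only [mem_filter] at hxy
      have hE := int_of_not_bd T.disk hb (tri_adj T.disk hxy.1)
      obtain ⟨d, hd, hdF⟩ := ec_two' (c := y) T.disk.card3 hE.1 (by rw [hE.2])
      exact ⟨d, hd, by simp [hdF]⟩)
  have hC : ∀ᶠ q in 𝓝 (G v), q ∈ interior C := isOpen_interior.mem_nhds (T.vint hu hb)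
  obtain ⟨U, hU, hUo, hvU⟩ := mem_nhds_iff.1 (hcov.and hC)
  have hintr : (interior (hull G t)).Nonempty := by
    refine ⟨∑ v ∈ t, (1/3 : ℝ) • G v, (mem_int gG).2 (fun u hu => ?_)⟩
    rw [bc_uniq gG (fun _ => 1/3) (by simp [gG.1]) hu]; norm_num
  have hcl : G v ∈ closure (interior (hull G t)) := by
    rw [hull_convex.closure_interior_eq_closure_of_nonempty_interior hintr]; exact subset_closure hvt
  have hne := mem_closure_iff.1 hcl U hUo hvU
  obtain ⟨q, hqv, hqU, hqt⟩ := ((vim_fin (F := F) (G := G)).countable.dense_compl ℝ).exists_mem_open (hUo.inter isOpen_interior) hne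
  have h1 := hU hqU
  have h2 := T.MM2 h1.2 hqv
  have h3 := MM_pos h1.1
  have h4 : MM G (insert t (F.filter (fun t => v ∈ t))) q ≤ MM G F q := mm_two_le (by
    intro z hz
    simp at hz
    rcases hz with rfl | hz
    · exact ht
    · exact hz.1)
  have h5 : MM G (insert t (F.filter (fun t => v ∈ t))) q = mm G t q + MM G (F.filter (fun t => v ∈ t)) q := by
    unfold MM; rw [sum_insert (by simp [hcon])]
  rw [mm_in hqt] at h5
  omega

lemma Tut.inj (T : Tut P F f C G) {s t : Finset ι} (hs : s ∈ F) (ht : t ∈ F) {x y : ℝ × ℝ} (hx : x ∈ hull P s)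
    (hy : y ∈ hull P t) (he : tr P G s x = tr P G t y) : x = y := by
  have ps := T.emb.geo.good s hs
  have pt := T.emb.geo.good t ht
  have gs := T.good hs
  have gt := T.good ht
  by_cases hq : tr P G s x ∈ interior C
  swap
  · have fx := T.pre_front hs hx hq
    have fy := T.pre_front ht hy (by rw [← he]; exact hq)
    refine T.emb.inj fx fy ?_
    rw [← T.tr_front hs hx fx, ← T.tr_front ht hy fy, he]
  have mx := tr_mem ps gs hx
  have my := tr_mem pt gt hy
  have ex : x = tr G P s (tr P G s x) := (tr_tr ps gs x).symm
  have ey : y = tr G P t (tr P G t y) := (tr_tr pt gt y).symm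
  rw [← he] at my ey
  generalize tr P G s x = q at *
  by_cases hv : q ∈ vim F G
  · obtain ⟨v, hu, rfl⟩ := hv
    have hb : ¬ Bd F v := by
      intro hb
      rw [T.bd v hb] at hq
      exact (T.emb.vfrontC hb).2 hq
    have h1 := T.vert_star hu hb hs mx
    have h2 := T.vert_star hu hb ht my
    rw [tr_vert gs h1] at ex
    rw [tr_vert gt h2] at ey
    rw [ex, ey]
  · have h2 := T.MM2 hq hv
    by_cases hst : s = t
    · subst hst; rw [ex, ey]
    have hsum : ∀ t' ∈ F, t' ≠ s → mm G s q + mm G t' q ≤ 2 := by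
      intro t' ht' hne
      have h4 : MM G {s, t'} q ≤ MM G F q := mm_two_le (by
        intro z hz
        simp at hz
        rcases hz with rfl | rfl <;> assumption)
      have h5 : MM G {s, t'} q = mm G s q + mm G t' q := by
        unfold MM; rw [sum_insert (by simp [hne.symm]), sum_singleton]
      omega
    have k1 := hsum t ht (Ne.symm hst)
    have k2 := mm_pos my
    have hni : q ∉ interior (hull G s) := by
      intro h
      rw [mm_in h] at k1
      omega
    rcases T.reg hq hv s hs mx with h | ⟨s', hs'⟩
    · exact absurd h hni
    have hne := hs'.ne T.cfg
    obtain ⟨a, b, c, d, rfl, rfl, m1, m2, hcd, pa, pb, pc⟩ := hs'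
    obtain ⟨e1, e2, e3⟩ := bc_edge (T.good m1) (T.good m2) pc
    have hqs' : q ∈ hull G {a, b, d} := by
      rw [mem_hull (T.good m2)]
      intro v hv
      simp at hv
      rcases hv with rfl | rfl | rfl
      · rw [e1]; exact pa.le
      · rw [e2]; exact pb.le
      · rw [e3]
    have hts : t = {a, b, d} := by
      by_contra hne'
      have h4 : MM G {{a, b, c}, {a, b, d}, t} q ≤ MM G F q := mm_two_le (by
        intro z hz
        simp only [mem_insert, mem_singleton] at hz
        rcases hz with rfl | rfl | rfl <;> assumption)
      have h5 : MM G {{a, b, c}, {a, b, d}, t} q = mm G {a, b, c} q + (mm G {a, b, d} q + mm G t q) := by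
        unfold MM; rw [sum_tri hne hst (Ne.symm hne')]
      have := mm_pos mx
      have := mm_pos hqs'
      omega
    subst hts
    obtain ⟨n1, n2, n3⟩ := card3_ne ps.1
    obtain ⟨o1, o2, o3⟩ := card3_ne pt.1
    rw [ex, ey]
    unfold tr
    rw [sum_tri n1 n2 n3, sum_tri o1 o2 o3, e1, e2, e3, pc]
    simp

/-- the extension -/
lemma Tut.final (T : Tut P F f C G) : ∃ g : ℝ × ℝ → ℝ × ℝ, (∀ t ∈ F, ∀ p ∈ hull P t, g p = tr P G t p) ∧
    Set.InjOn g (KK P F) ∧ Set.EqOn g f (frontier (KK P F)) := by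
  obtain ⟨g, _, hg⟩ := glue_cont (P := P) (F := F) (fun t p => ∑ v, bc P t v p • G v) (by
    intro t _
    exact continuous_finsetSum _ (fun v _ => (bc_cont v).smul continuous_const)) (by
    intro s hs t ht p h1 h2
    exact sum_congr rfl (fun v _ => by rw [T.emb.geo.bc_glob hs ht h1 h2 v]))
  have hg' : ∀ t ∈ F, ∀ p ∈ hull P t, g p = tr P G t p := fun t ht p hp => by rw [hg t ht p hp, tr_univ]
  refine ⟨g, hg', ?_, ?_⟩
  · intro x hx y hy he
    obtain ⟨s, hs, hxs⟩ := mem_KK.1 hx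
    obtain ⟨t, ht, hyt⟩ := mem_KK.1 hy
    rw [hg' s hs x hxs, hg' t ht y hyt] at he
    exact T.inj hs ht hxs hyt he
  · intro x hx
    have : x ∈ KK P F := KK_compact.isClosed.frontier_subset hx
    obtain ⟨s, hs, hxs⟩ := mem_KK.1 this
    rw [hg' s hs x hxs]
    exact T.tr_front hs hxs hx

end asm
end TD

namespace TD
section bridge
variable {ι : Type} [Fintype ι] [DecidableEq ι]

lemma triSet_hull (P : ι → ℝ × ℝ) (t : ι × ι × ι) : triSet P t = hull P (vset t) := by
  unfold triSet hull vset
  congr 1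
  simp [Set.image_insert_eq]

lemma space_KK (D : TriDisk ι) : D.space = KK D.pos (D.tris.image vset) := by
  ext x
  simp [TriDisk.space, KK, triSet_hull]

lemma good_bridge {P : ι → ℝ × ℝ} (hP : Function.Injective P) {t : ι × ι × ι}
    (h : AffineIndependent ℝ ![P t.1, P t.2.1, P t.2.2]) : Good P (vset t) := by
  have hi := h.injective
  have n1 : t.1 ≠ t.2.1 := fun e => by
    have := @hi 0 1 (by simp [e]); simp at this
  have n2 : t.1 ≠ t.2.2 := fun e => by
    have := @hi 0 2 (by simp [e]); simp at this
  have n3 : t.2.1 ≠ t.2.2 := fun e => by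
    have := @hi 1 2 (by simp [e]); simp at this
  refine ⟨Finset.card_eq_three.2 ⟨_, _, _, n1, n2, n3, rfl⟩, ?_⟩
  have hr := h.range
  have hm : ∀ v : vset t, P v ∈ Set.range ![P t.1, P t.2.1, P t.2.2] := by
    rintro ⟨v, hv⟩
    simp only [vset, Finset.mem_insert, Finset.mem_singleton] at hv
    rcases hv with rfl | rfl | rfl
    · exact ⟨0, rfl⟩
    · exact ⟨1, rfl⟩
    · exact ⟨2, rfl⟩
  exact hr.comp_embedding ⟨fun v : vset t => ⟨P v, hm v⟩, fun u v huv => by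
    simp only [Subtype.mk.injEq] at huv
    exact Subtype.ext (hP huv)⟩

lemma geo_bridge (D : TriDisk ι) : Geo D.pos (D.tris.image vset) := by
  refine ⟨D.inj, ?_, ?_, D.nonempty.image _, ?_⟩
  · intro t ht
    obtain ⟨s, hs, rfl⟩ := Finset.mem_image.1 ht
    exact good_bridge D.inj (D.indep s hs)
  · intro s hs t ht
    obtain ⟨s, hs1, rfl⟩ := Finset.mem_image.1 hs
    obtain ⟨t, ht1, rfl⟩ := Finset.mem_image.1 ht
    rw [← triSet_hull, ← triSet_hull, D.glue s hs1 t ht1]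
    rfl
  · rw [← space_KK]
    exact D.disk

lemma edge_bridge (D : TriDisk ι) {a b : ι} (h : Adj (D.tris.image vset) a b) : D.IsEdge a b := by
  obtain ⟨hab, t, ht, ha, hb⟩ := h
  obtain ⟨s, hs, rfl⟩ := Finset.mem_image.1 ht
  exact ⟨hab, s, hs, ha, hb⟩

/-- the transfer map as an affine map -/
noncomputable def trA (P G : ι → ℝ × ℝ) (t : Finset ι) : (ℝ × ℝ) →ᵃ[ℝ] (ℝ × ℝ) :=
  ∑ v ∈ t, ((LinearMap.toSpanSingleton ℝ (ℝ × ℝ) (G v)).toAffineMap.comp (bc P t v))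

lemma trA_apply (P G : ι → ℝ × ℝ) (t : Finset ι) (x : ℝ × ℝ) : trA P G t x = tr P G t x := by
  have h : ∀ s : Finset ι, (∑ v ∈ s, ((LinearMap.toSpanSingleton ℝ (ℝ × ℝ) (G v)).toAffineMap.comp (bc P t v))) x
      = ∑ v ∈ s, bc P t v x • G v := by
    intro s
    induction s using Finset.induction_on with
    | empty => simp
    | insert a s ha ih => rw [Finset.sum_insert ha, Finset.sum_insert ha, AffineMap.coe_add, Pi.add_apply, ih]; simp
  exact h t

end bridge
end TD

/-- **Theorem 1, general case.** Let `K` be a triangulated 2-disk in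
the plane and `f` a simplexwise linear embedding of `∂K` with convex image such that
no spanning edge of `K` is `f`-obstructive. Then `f` extends to a simplexwise linear
embedding of `K`. -/
theorem extension_convex_no_obstructive
    {ι : Type} [Fintype ι] [DecidableEq ι]
    (D : TriDisk ι)
    (f : ℝ × ℝ → ℝ × ℝ)
    (hSL : D.SLOnBoundary f)
    (hinj : Set.InjOn f (frontier D.space))
    (hconv : D.ConvexImage f)
    (hnoobs : ∀ a b : ι, ¬ D.Obstructive f a b) :
    ∃ G : ℝ × ℝ → ℝ × ℝ,
      D.SLOn G ∧ Set.InjOn G D.space ∧ Set.EqOn G f (frontier D.space) := by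
  have hg := TD.geo_bridge D
  have hS := TD.space_KK D
  obtain ⟨C, hC1, hC2, hC3, hC4⟩ := hconv
  have H : TD.Emb D.pos (D.tris.image vset) f C := by
    refine ⟨hg, ?_, by rw [← hS]; exact hinj, hC1, hC2, hC3, by rw [← hS]; exact hC4, ?_⟩
    · intro a b hab
      refine hSL a b ⟨TD.edge_bridge D hab.adj, ?_⟩
      rw [hS, ← TD.hull_pair]
      exact hg.bd_front hab
    · intro a b hab ha hb x hx hcol
      refine hnoobs a b ⟨⟨TD.edge_bridge D hab.adj, ?_, ?_, ?_⟩, x, ?_, ?_⟩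
      · rw [hS]; exact (hg.vert_front hab.adj.used).2 ha
      · rw [hS]; exact (hg.vert_front hab.adj.symm.used).2 hb
      · rw [hS]; exact hg.int_edge hab
      · rw [hS]; exact hx
      · rw [hS]; exact hcol
  obtain ⟨G, T⟩ := TD.Tut.exists H
  obtain ⟨g, h1, h2, h3⟩ := T.final
  refine ⟨g, ?_, by rw [hS]; exact h2, by rw [hS]; exact h3⟩
  intro t ht
  refine ⟨TD.trA D.pos G (vset t), ?_⟩
  intro p hp
  rw [TD.triSet_hull] at hp
  rw [TD.trA_apply]
  exact h1 _ (Finset.mem_image_of_mem _ ht) p hp
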